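/- For every natural number r ≥ 1, there exists a real-analytic μ-preserving diffeomorphism T of the torus T² (i.e., T and T⁻¹ admit real-analytic lifts ℝ² → ℝ² commuting with integer translations) such that: (1) T is minimal; (2) the Lebesgue measure μ is a generic measure for T; and (3) there exist r pairwise distinct T-invariant Borel probability measures μ_0, …, μ_{r−1}, each absolutely continuous with respect to μ, such that T is weakly mixing with respect to each μ_t. -/

import Mathlib

open MeasureTheory Filter Topology
open scoped ENNReal
noncomputable section

abbrev Torus2 := UnitAddCircle × UnitAddCircle

/-- Canonical projection `ℝ² → 𝕋²`. -/
def torusProj : ℝ × ℝ → Torus2 := fun p => ((p.1 : UnitAddCircle), (p.2 : UnitAddCircle))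

/-- `F : ℝ² → ℝ²` is a lift of `f : 𝕋² → 𝕋²`. -/
def IsLift (F : ℝ × ℝ → ℝ × ℝ) (f : Torus2 → Torus2) : Prop :=
  ∀ p : ℝ × ℝ, torusProj (F p) = f (torusProj p)

/-- `F` commutes with integer translations. -/
def IntEquivariant (F : ℝ × ℝ → ℝ × ℝ) : Prop :=
  ∀ p : ℝ × ℝ, ∀ m : ℤ × ℤ, F (p + ((m.1 : ℝ), (m.2 : ℝ))) = F p + ((m.1 : ℝ), (m.2 : ℝ))

/-- A real-analytic measure-preserving diffeomorphism of the torus 𝕋²: a bijection such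
that it and its inverse admit real-analytic lifts `ℝ² → ℝ²` commuting with integer
translations, preserving the Haar (Lebesgue) probability measure. -/
structure AnalyticMPTorusDiffeo where
  toEquiv : Torus2 ≃ Torus2
  lift : ℝ × ℝ → ℝ × ℝ
  liftInv : ℝ × ℝ → ℝ × ℝ
  lift_analytic : ∀ p : ℝ × ℝ, AnalyticAt ℝ lift p
  liftInv_analytic : ∀ p : ℝ × ℝ, AnalyticAt ℝ liftInv p
  lift_equivariant : IntEquivariant lift
  liftInv_equivariant : IntEquivariant liftInv
  lift_isLift : IsLift lift toEquiv
  liftInv_isLift : IsLift liftInv toEquiv.symm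
  measurePreserving : MeasurePreserving toEquiv volume volume

/-- generic point -/
def IsGenericPt (T : Torus2 → Torus2) (ν : Measure Torus2) (x : Torus2) : Prop :=
  ∀ f : C(Torus2, ℝ),
    Tendsto (fun N : ℕ => (N : ℝ)⁻¹ * ∑ i ∈ Finset.range N, f (T^[i] x)) atTop
      (𝓝 (∫ y, f y ∂ν))

def IsMinimalMap (T : Torus2 → Torus2) : Prop :=
  ∀ x : Torus2, Dense (Set.range fun n : ℕ => T^[n] x)

def IsWeakMixingWrt (T : Torus2 → Torus2) (ν : Measure Torus2) : Prop :=
  ∃ m : ℕ → ℕ, StrictMono m ∧ ∀ A B : Set Torus2, MeasurableSet A → MeasurableSet B →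
    Tendsto (fun n => |(ν (B ∩ (T^[m n]) ⁻¹' A)).toReal - (ν A).toReal * (ν B).toReal|)
      atTop (𝓝 0)


/-! ### Basics -/

/-- the circle -/
abbrev Crc := UnitAddCircle

lemma crc_dist_add_coe (x : Crc) (a b : ℝ) : dist (x + (a : Crc)) (x + (b : Crc)) ≤ |a - b| := by
  rw [dist_add_left, dist_eq_norm, ← AddCircle.coe_sub]
  exact (QuotientAddGroup.norm_mk_le_norm).trans_eq (Real.norm_eq_abs _)

lemma crc_norm_coe_le (a : ℝ) : ‖(a : Crc)‖ ≤ |a| := (QuotientAddGroup.norm_mk_le_norm).trans_eq (Real.norm_eq_abs _)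

/-- horizontal shear -/
def xsh (f : C(Crc, ℝ)) (K : ℤ) (p : Torus2) : Torus2 := (p.1 + ((f p.2 : ℝ) : Crc) + K • p.2, p.2)

/-- vertical shear -/
def ysh (q : ℕ) (f : C(Crc, ℝ)) (p : Torus2) : Torus2 := (p.1, p.2 + ((f (q • p.1) : ℝ) : Crc))

lemma continuous_crc_coe : Continuous (fun x : ℝ => (x : Crc)) := AddCircle.continuous_mk' 1

lemma xsh_continuous (f K) : Continuous (xsh f K) := by
  unfold xsh
  have := continuous_crc_coe
  fun_prop

lemma ysh_continuous (q f) : Continuous (ysh q f) := by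
  unfold ysh
  have := continuous_crc_coe
  fun_prop

def xshH (f : C(Crc, ℝ)) (K : ℤ) : Torus2 ≃ₜ Torus2 where
  toFun := xsh f K
  invFun := xsh (-f) (-K)
  left_inv p := by ext <;> simp [xsh]; abel
  right_inv p := by ext <;> simp [xsh]; abel
  continuous_toFun := xsh_continuous f K
  continuous_invFun := xsh_continuous (-f) (-K)

def yshH (q : ℕ) (f : C(Crc, ℝ)) : Torus2 ≃ₜ Torus2 where
  toFun := ysh q f
  invFun := ysh q (-f)
  left_inv p := by ext <;> simp [ysh]
  right_inv p := by ext <;> simp [ysh]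
  continuous_toFun := ysh_continuous q f
  continuous_invFun := ysh_continuous q (-f)

lemma ysh_mp (q f) : MeasurePreserving (ysh q f) volume volume := by
  have : MeasurePreserving (fun p : Crc × Crc => (id p.1, (fun (x y : Crc) => y + ((f (q • x) : ℝ) : Crc)) p.1 p.2))
      ((volume : Measure Crc).prod volume) ((volume : Measure Crc).prod volume) := by
    refine MeasurePreserving.skew_product (μa := (volume : Measure Crc)) (μc := (volume : Measure Crc)) (μd := (volume : Measure Crc)) (g := fun (x y : Crc) => y + ((f (q • x) : ℝ) : Crc)) (MeasurePreserving.id  (volume : Measure Crc)) ?_ ?_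
    · have := continuous_crc_coe
      have : Continuous (Function.uncurry fun (x y : Crc) => y + ((f (q • x) : ℝ) : Crc)) := by
        unfold Function.uncurry
        fun_prop
      exact this.measurable
    · filter_upwards with x
      exact (measurePreserving_add_right (volume : Measure Crc) ((f (q • x) : ℝ) : Crc)).map_eq
  exact this

lemma xsh_mp (f K) : MeasurePreserving (xsh f K) volume volume := by
  have : MeasurePreserving (fun p : Crc × Crc => (id p.1, (fun (x y : Crc) => y + (((f x : ℝ) : Crc) + K • x)) p.1 p.2))
      ((volume : Measure Crc).prod volume) ((volume : Measure Crc).prod volume) := by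
    refine MeasurePreserving.skew_product (μa := (volume : Measure Crc)) (μc := (volume : Measure Crc)) (μd := (volume : Measure Crc)) (g := fun (x y : Crc) => y + (((f x : ℝ) : Crc) + K • x)) (MeasurePreserving.id (volume : Measure Crc)) ?_ ?_
    · have := continuous_crc_coe
      have : Continuous (Function.uncurry fun (x y : Crc) => y + (((f x : ℝ) : Crc) + K • x)) := by
        unfold Function.uncurry
        fun_prop
      exact this.measurable
    · filter_upwards with x
      exact (measurePreserving_add_right (volume : Measure Crc) (((f x : ℝ) : Crc) + K • x)).map_eq
  have h2 := (Measure.measurePreserving_swap (μ := (volume : Measure Crc)) (ν := (volume : Measure Crc)))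
  have h3 := (h2.comp this).comp h2
  have e : xsh f K = (Prod.swap ∘ fun p : Crc × Crc => (id p.1, (fun (x y : Crc) => y + (((f x : ℝ) : Crc) + K • x)) p.1 p.2)) ∘ Prod.swap := by
    funext p
    simp [xsh, add_assoc]
  rw [e]
  exact h3

/-- integer vector in the complex plane -/
def cvec (m : ℤ × ℤ) : ℂ × ℂ := ((m.1 : ℂ), (m.2 : ℂ))

def cplx (p : ℝ × ℝ) : ℂ × ℂ := ((p.1 : ℂ), (p.2 : ℂ))

/-- analytic torus maps with entire lifts -/
structure EMap where
  h : Torus2 ≃ₜ Torus2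
  mp : MeasurePreserving h volume volume
  c : ℂ × ℂ → ℂ × ℂ
  ci : ℂ × ℂ → ℂ × ℂ
  c_diff : Differentiable ℂ c
  ci_diff : Differentiable ℂ ci
  c_ci : ∀ p, c (ci p) = p
  ci_c : ∀ p, ci (c p) = p
  rl : ℝ × ℝ → ℝ × ℝ
  rli : ℝ × ℝ → ℝ × ℝ
  c_real : ∀ p, c (cplx p) = cplx (rl p)
  ci_real : ∀ p, ci (cplx p) = cplx (rli p)
  c_per : ∀ m, ∃ m', ∀ p, c (p + cvec m) = c p + cvec m'
  ci_per : ∀ m, ∃ m', ∀ p, ci (p + cvec m) = ci p + cvec m'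
  lift : ∀ p, torusProj (rl p) = h (torusProj p)

/-- commutes with the `1/q` rotation, fixes the origin -/
def EMap.Good (e : EMap) (q : ℕ) : Prop :=
  (∀ p, e.c (p + ((1 / q : ℂ), 0)) = e.c p + ((1 / q : ℂ), 0)) ∧ e.h 0 = 0

def EMap.one : EMap where
  h := Homeomorph.refl _
  mp := MeasurePreserving.id _
  c := id
  ci := id
  c_diff := differentiable_id
  ci_diff := differentiable_id
  c_ci _ := rfl
  ci_c _ := rfl
  rl := id
  rli := id
  c_real _ := rfl
  ci_real _ := rfl
  c_per m := ⟨m, fun _ => rfl⟩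
  ci_per m := ⟨m, fun _ => rfl⟩
  lift _ := rfl

/-- composition `e ∘ f` -/
def EMap.comp (e f : EMap) : EMap where
  h := f.h.trans e.h
  mp := e.mp.comp f.mp
  c := e.c ∘ f.c
  ci := f.ci ∘ e.ci
  c_diff := e.c_diff.comp f.c_diff
  ci_diff := f.ci_diff.comp e.ci_diff
  c_ci p := by simp [f.c_ci, e.c_ci]
  ci_c p := by simp [f.ci_c, e.ci_c]
  rl := e.rl ∘ f.rl
  rli := f.rli ∘ e.rli
  c_real p := by simp [f.c_real, e.c_real]
  ci_real p := by simp [f.ci_real, e.ci_real]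
  c_per m := by
    obtain ⟨m1, h1⟩ := f.c_per m
    obtain ⟨m2, h2⟩ := e.c_per m1
    exact ⟨m2, fun p => by simp [h1, h2]⟩
  ci_per m := by
    obtain ⟨m1, h1⟩ := e.ci_per m
    obtain ⟨m2, h2⟩ := f.ci_per m1
    exact ⟨m2, fun p => by simp [h1, h2]⟩
  lift p := by simp [e.lift, f.lift]

@[simp] lemma EMap.comp_h (e f : EMap) (p) : (e.comp f).h p = e.h (f.h p) := rfl
@[simp] lemma EMap.one_h (p) : (EMap.one).h p = p := rfl

lemma EMap.Good.comp {e f : EMap} {q} (he : e.Good q) (hf : f.Good q) : (e.comp f).Good q :=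
  ⟨fun p => by simp only [EMap.comp, Function.comp, hf.1, he.1], by simp [hf.2, he.2]⟩

lemma EMap.good_one (q) : EMap.one.Good q := ⟨fun p => by simp [EMap.one], rfl⟩

/-- real function on the circle with an entire periodic extension -/
def EntPer (f : C(Crc, ℝ)) : Prop :=
  ∃ Φ : ℂ → ℂ, Differentiable ℂ Φ ∧ (∀ z, Φ (z + 1) = Φ z) ∧ ∀ x : ℝ, Φ x = ((f (x : Crc) : ℝ) : ℂ)

lemma per_int {Φ : ℂ → ℂ} (h : ∀ z, Φ (z + 1) = Φ z) (z : ℂ) (m : ℤ) : Φ (z + m) = Φ z := by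
  have : Function.Periodic Φ 1 := h
  simpa using this.int_mul m z

lemma exists_xsh (f : C(Crc, ℝ)) (K : ℤ) (hf : EntPer f) (h0 : f 0 = 0) (q : ℕ) :
    ∃ e : EMap, e.Good q ∧ ∀ p, e.h p = xsh f K p := by
  obtain ⟨Φ, hd, hp, hr⟩ := hf
  refine ⟨{ h := xshH f K, mp := xsh_mp f K, c := fun p => (p.1 + Φ p.2 + K * p.2, p.2),
            ci := fun p => (p.1 - Φ p.2 - K * p.2, p.2), c_diff := by fun_prop, ci_diff := by fun_prop,
            c_ci := fun p => by ext <;> simp; ring, ci_c := fun p => by ext <;> simp; ring,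
            rl := fun p => (p.1 + f p.2 + K * p.2, p.2), rli := fun p => (p.1 - f p.2 - K * p.2, p.2),
            c_real := fun p => by simp [cplx, hr], ci_real := fun p => by simp [cplx, hr],
            c_per := fun m => ⟨(m.1 + K * m.2, m.2), fun p => ?_⟩,
            ci_per := fun m => ⟨(m.1 - K * m.2, m.2), fun p => ?_⟩,
            lift := fun p => ?_ }, ⟨?_, ?_⟩, ?_⟩
  · ext <;> simp [cvec, per_int hp]; ring
  · ext <;> simp [cvec, per_int hp]; ring
  · have : (((K : ℝ) * p.2 : ℝ) : Crc) = K • (p.2 : Crc) := by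
      rw [← AddCircle.coe_zsmul]; simp
    simp [torusProj, xshH, xsh, this]
  · intro p; simp; ring
  · simp [xshH, xsh, h0]
  · intro p; rfl

lemma exists_ysh (q : ℕ) (hq : 0 < q) (f : C(Crc, ℝ)) (hf : EntPer f) (h0 : f 0 = 0) :
    ∃ e : EMap, e.Good q ∧ ∀ p, e.h p = ysh q f p := by
  obtain ⟨Φ, hd, hp, hr⟩ := hf
  have hq' : (q : ℂ) ≠ 0 := by exact_mod_cast hq.ne'
  have hr' : ∀ x : ℝ, Φ (q * x) = ((f (q • (x : Crc)) : ℝ) : ℂ) := fun x => by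
    have := hr (q * x)
    rw [← AddCircle.coe_nsmul]; simpa using this
  have hpm : ∀ (z : ℂ) (m : ℤ), Φ (q * (z + m)) = Φ (q * z) := fun z m => by
    have := per_int hp (q * z) (q * m)
    rw [← this]; push_cast; ring_nf
  refine ⟨{ h := yshH q f, mp := ysh_mp q f, c := fun p => (p.1, p.2 + Φ (q * p.1)),
            ci := fun p => (p.1, p.2 - Φ (q * p.1)), c_diff := by fun_prop, ci_diff := by fun_prop,
            c_ci := fun p => by simp, ci_c := fun p => by simp,
            rl := fun p => (p.1, p.2 + f (q • (p.1 : Crc))), rli := fun p => (p.1, p.2 - f (q • (p.1 : Crc))),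
            c_real := fun p => by simp [cplx, hr'], ci_real := fun p => by simp [cplx, hr'],
            c_per := fun m => ⟨m, fun p => ?_⟩,
            ci_per := fun m => ⟨m, fun p => ?_⟩,
            lift := fun p => ?_ }, ⟨?_, ?_⟩, ?_⟩
  · ext <;> simp [cvec, hpm]; ring
  · ext <;> simp [cvec, hpm]; ring
  · simp [torusProj, yshH, ysh]
  · intro p
    have : Φ (q * (p.1 + (q : ℂ)⁻¹)) = Φ (q * p.1) := by
      rw [mul_add, mul_inv_cancel₀ hq', hp]
    simp [this]
  · simp [yshH, ysh, h0]
  · intro p; rfl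

/-! density of entire periodic functions -/
def entAlg : Subalgebra ℝ C(Crc, ℝ) where
  carrier := {f | EntPer f}
  mul_mem' := by
    rintro f g ⟨Φ, h1, h2, h3⟩ ⟨Ψ, k1, k2, k3⟩
    exact ⟨fun z => Φ z * Ψ z, h1.mul k1, fun z => by simp [h2, k2], fun x => by simp [h3, k3]⟩
  add_mem' := by
    rintro f g ⟨Φ, h1, h2, h3⟩ ⟨Ψ, k1, k2, k3⟩
    exact ⟨fun z => Φ z + Ψ z, h1.add k1, fun z => by simp [h2, k2], fun x => by simp [h3, k3]⟩
  algebraMap_mem' r := ⟨fun _ => r, differentiable_const _, fun _ => rfl, fun x => by simp⟩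

def perFun (g : ℝ → ℝ) (hg : Continuous g) (hp : Function.Periodic g 1) : C(Crc, ℝ) :=
  ⟨hp.lift, continuous_coinduced_dom.mpr hg⟩

@[simp] lemma perFun_coe (g hg hp) (x : ℝ) : perFun g hg hp (x : Crc) = g x := rfl

lemma ent_dense (f : C(Crc, ℝ)) (ε : ℝ) (hε : 0 < ε) : ∃ g, EntPer g ∧ ∀ x, |g x - f x| ≤ ε := by
  have hs : entAlg.SeparatesPoints := by
    intro x y hxy
    let gs := perFun (fun x => Real.sin (2 * Real.pi * x)) (by fun_prop) (fun x => by
      simp [mul_add])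
    let gc := perFun (fun x => Real.cos (2 * Real.pi * x)) (by fun_prop) (fun x => by
      simp [mul_add])
    have hgs : EntPer gs := ⟨fun z => Complex.sin (2 * Real.pi * z), by fun_prop, fun z => by
      simp only [mul_add, mul_one]; exact Complex.sin_periodic _, fun x => by
        change _ = ((Real.sin (2 * Real.pi * x) : ℝ) : ℂ); simp⟩
    have hgc : EntPer gc := ⟨fun z => Complex.cos (2 * Real.pi * z), by fun_prop, fun z => by
      simp only [mul_add, mul_one]; exact Complex.cos_periodic _, fun x => by
        change _ = ((Real.cos (2 * Real.pi * x) : ℝ) : ℂ); simp⟩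
    by_contra hcon
    push Not at hcon
    have e1 := hcon gs ⟨gs, hgs, rfl⟩
    have e2 := hcon gc ⟨gc, hgc, rfl⟩
    apply hxy
    induction x using QuotientAddGroup.induction_on with | H x => ?_
    induction y using QuotientAddGroup.induction_on with | H y => ?_
    change Real.sin (2 * Real.pi * x) = Real.sin (2 * Real.pi * y) at e1
    change Real.cos (2 * Real.pi * x) = Real.cos (2 * Real.pi * y) at e2
    have h3 : Real.cos (2 * Real.pi * x - 2 * Real.pi * y) = 1 := by
      rw [Real.cos_sub, e1, e2]; have := Real.sin_sq_add_cos_sq (2 * Real.pi * y); nlinarith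
    obtain ⟨n, hn⟩ := (Real.cos_eq_one_iff _).1 h3
    have h4 : x - y = n := by
      have := Real.pi_pos
      have h5 : (2 * Real.pi) * (x - y) = (2 * Real.pi) * n := by linarith
      exact mul_left_cancel₀ (by positivity) h5
    have h6 : x = y + n := by linarith
    rw [h6]
    change ((y + n : ℝ) : Crc) = (y : Crc)
    have : ((n : ℝ) : Crc) = 0 := by
      rw [AddCircle.coe_eq_zero_iff]; exact ⟨n, by simp⟩
    rw [AddCircle.coe_add, this, add_zero]
  have h := ContinuousMap.subalgebra_topologicalClosure_eq_top_of_separatesPoints entAlg hs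
  have hf : f ∈ entAlg.topologicalClosure := by rw [h]; trivial
  have hf' : f ∈ closure (entAlg : Set C(Crc, ℝ)) := hf
  obtain ⟨g, hg, hd⟩ := Metric.mem_closure_iff.1 hf' ε hε
  refine ⟨g, hg, fun x => ?_⟩
  have := ContinuousMap.dist_apply_le_dist (f := f) (g := g) x
  rw [Real.dist_eq, abs_sub_comm] at this
  linarith

lemma ent_dense0 (f : C(Crc, ℝ)) (h0 : f 0 = 0) (ε : ℝ) (hε : 0 < ε) :
    ∃ g, EntPer g ∧ g 0 = 0 ∧ ∀ x, |g x - f x| ≤ ε := by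
  obtain ⟨g, hg, hd⟩ := ent_dense f (ε / 2) (by linarith)
  refine ⟨g - algebraMap ℝ C(Crc, ℝ) (g 0), entAlg.sub_mem hg (entAlg.algebraMap_mem _), by simp, fun x => ?_⟩
  have h1 := hd x
  have h2 := hd 0
  rw [h0] at h2
  have h3 : (g - algebraMap ℝ C(Crc, ℝ) (g 0)) x = g x - g 0 := rfl
  rw [h3]
  rw [abs_le] at *
  constructor <;> linarith [h1.1, h1.2, h2.1, h2.2]

/-- words in continuous shears -/
inductive CG (q : ℕ) : (Torus2 → Torus2) → Prop
  | one : CG q (fun p => p)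
  | xs (f : C(Crc, ℝ)) (K : ℤ) (h0 : f 0 = 0) (h : Torus2 → Torus2) : CG q h → CG q (fun p => xsh f K (h p))
  | ys (f : C(Crc, ℝ)) (h0 : f 0 = 0) (h : Torus2 → Torus2) : CG q h → CG q (fun p => ysh q f (h p))

lemma CG.comp {q g h} (hg : CG q g) (hh : CG q h) : CG q (fun p => g (h p)) := by
  induction hg with
  | one => exact hh
  | xs f K h0 g _ ih => exact CG.xs f K h0 _ ih
  | ys f h0 g _ ih => exact CG.ys f h0 _ ih

lemma CG.approx {q : ℕ} (hq : 0 < q) {h} (hh : CG q h) : ∀ ε > 0, ∃ e : EMap, e.Good q ∧ ∀ p, dist (e.h p) (h p) ≤ ε := by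
  induction hh with
  | one => exact fun ε hε => ⟨EMap.one, EMap.good_one q, fun p => by simpa using hε.le⟩
  | xs f K h0 g _ ih =>
    intro ε hε
    have huc : UniformContinuous (xsh f K) := CompactSpace.uniformContinuous_of_continuous (xsh_continuous f K)
    obtain ⟨δ, hδ, huc⟩ := Metric.uniformContinuous_iff.1 huc (ε / 2) (by linarith)
    obtain ⟨e, he, hd⟩ := ih (δ / 2) (by linarith)
    obtain ⟨f', hf', h0', hd'⟩ := ent_dense0 f h0 (ε / 2) (by linarith)
    obtain ⟨e', he', hx⟩ := exists_xsh f' K hf' h0' q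
    refine ⟨e'.comp e, he'.comp he, fun p => ?_⟩
    have h1 : dist (xsh f K (e.h p)) (xsh f K (g p)) < ε / 2 := huc ((hd p).trans_lt (by linarith))
    have h2 : dist (xsh f' K (e.h p)) (xsh f K (e.h p)) ≤ ε / 2 := by
      simp only [xsh, Prod.dist_eq, dist_self, dist_add_right]
      exact max_le ((crc_dist_add_coe _ _ _).trans (hd' _)) (by linarith)
    rw [EMap.comp_h, hx]
    linarith [dist_triangle (xsh f' K (e.h p)) (xsh f K (e.h p)) (xsh f K (g p))]
  | ys f h0 g _ ih =>
    intro ε hε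
    have huc : UniformContinuous (ysh q f) := CompactSpace.uniformContinuous_of_continuous (ysh_continuous q f)
    obtain ⟨δ, hδ, huc⟩ := Metric.uniformContinuous_iff.1 huc (ε / 2) (by linarith)
    obtain ⟨e, he, hd⟩ := ih (δ / 2) (by linarith)
    obtain ⟨f', hf', h0', hd'⟩ := ent_dense0 f h0 (ε / 2) (by linarith)
    obtain ⟨e', he', hx⟩ := exists_ysh q hq f' hf' h0'
    refine ⟨e'.comp e, he'.comp he, fun p => ?_⟩
    have h1 : dist (ysh q f (e.h p)) (ysh q f (g p)) < ε / 2 := huc ((hd p).trans_lt (by linarith))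
    have h2 : dist (ysh q f' (e.h p)) (ysh q f (e.h p)) ≤ ε / 2 := by
      simp only [ysh, Prod.dist_eq, dist_self]
      exact max_le (by linarith) ((crc_dist_add_coe _ _ _).trans (hd' _))
    rw [EMap.comp_h, hx]
    linarith [dist_triangle (ysh q f' (e.h p)) (ysh q f (e.h p)) (ysh q f (g p))]

/-! ### Joint analyticity of separately holomorphic continuous functions -/
section Osgood


def osgM : Measure (Set.Icc (0 : ℝ) (2 * Real.pi)) := Measure.comap ((↑) : (Set.Icc (0 : ℝ) (2 * Real.pi)) → ℝ) volume

instance : IsFiniteMeasure osgM := ⟨by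
  rw [osgM, (MeasurableEmbedding.subtype_coe measurableSet_Icc).comap_apply, Set.image_univ, Subtype.range_coe]
  exact isCompact_Icc.measure_lt_top⟩

def osgI : C((Set.Icc (0 : ℝ) (2 * Real.pi)), ℂ) →L[ℂ] ℂ :=
  LinearMap.mkContinuous
    { toFun := fun g => ∫ θ : (Set.Icc (0 : ℝ) (2 * Real.pi)), g θ ∂osgM
      map_add' := fun g h => by
        have := fun g : C((Set.Icc (0 : ℝ) (2 * Real.pi)), ℂ) => (g.continuous.integrable_of_hasCompactSupport (μ := osgM)
          (HasCompactSupport.of_compactSpace _))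
        exact integral_add (this g) (this h)
      map_smul' := fun c g => integral_smul c _ }
    (osgM.real Set.univ) (fun g => by
      have := norm_integral_le_of_norm_le_const (μ := osgM) (f := g) (C := ‖g‖)
        (by filter_upwards with x using g.norm_coe_le_norm x)
      simpa [mul_comm] using this)

lemma osgI_apply (g : ℝ → ℂ) (hg : Continuous g) :
    osgI ⟨fun θ => g θ, by fun_prop⟩ = ∫ θ in (0 : ℝ)..(2 * Real.pi), g θ := by
  change ∫ θ : (Set.Icc (0 : ℝ) (2 * Real.pi)), g θ ∂osgM = _
  rw [intervalIntegral.integral_of_le (by positivity), ← integral_Icc_eq_integral_Ioc]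
  exact integral_subtype_comap measurableSet_Icc g

lemma osg_phi (f : ℂ × ℂ → ℂ) (hc : Continuous f) (h1 : ∀ w, Differentiable ℂ (fun z => f (z, w)))
    (a b : ℂ) : AnalyticAt ℂ (fun z => (⟨fun θ : (Set.Icc (0 : ℝ) (2 * Real.pi)) => f (z, circleMap b 1 θ), by fun_prop⟩ : C((Set.Icc (0 : ℝ) (2 * Real.pi)), ℂ))) a := by
  set Φ : ℂ → C((Set.Icc (0 : ℝ) (2 * Real.pi)), ℂ) := fun z => (⟨fun θ : (Set.Icc (0 : ℝ) (2 * Real.pi)) => f (z, circleMap b 1 θ), by fun_prop⟩ : C((Set.Icc (0 : ℝ) (2 * Real.pi)), ℂ)) with hΦ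
  have hΦc : Continuous Φ := by
    have : Continuous (fun p : ℂ × (Set.Icc (0 : ℝ) (2 * Real.pi)) => f (p.1, circleMap b 1 p.2)) := by fun_prop
    exact (ContinuousMap.curry ⟨_, this⟩).continuous
  have key := hasFPowerSeriesOn_cauchy_integral (f := Φ) (c := a) (R := 1) (hΦc.continuousOn.circleIntegrable (by norm_num)) one_pos
  refine key.analyticAt.congr ?_
  filter_upwards [Metric.ball_mem_nhds a one_pos] with w hw
  ext θ
  have e1 := ((h1 (circleMap b 1 θ)).differentiableOn (s := Metric.closedBall a 1)).circleIntegral_sub_inv_smul (w := w) (by simpa using hw)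
  have e2 : (∮ z in C(a, 1), (z - w)⁻¹ • Φ z) θ = ∮ z in C(a, 1), (z - w)⁻¹ • f (z, circleMap b 1 θ) := by
    have hcm : Continuous (fun t => deriv (circleMap a 1) t • (circleMap a 1 t - w)⁻¹ • Φ (circleMap a 1 t)) := by
      simp only [deriv_circleMap]
      have : ∀ t, circleMap a 1 t - w ≠ 0 := fun t h => by
        have h3 : circleMap a 1 t = w := by linear_combination h
        have := circleMap_mem_sphere a zero_le_one t
        rw [h3] at this
        rw [mem_sphere_iff_norm] at this
        rw [mem_ball_iff_norm] at hw
        linarith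
      have hcc : Continuous (circleMap a 1) := continuous_circleMap _ _
      have hcc' : Continuous (circleMap 0 1) := continuous_circleMap _ _
      have hinv : Continuous fun t => (circleMap a 1 t - w)⁻¹ := (hcc.sub continuous_const).inv₀ this
      exact (hcc'.mul continuous_const).smul (hinv.smul (hΦc.comp hcc))
    have := (ContinuousMap.evalCLM ℂ θ : C((Set.Icc (0 : ℝ) (2 * Real.pi)), ℂ) →L[ℂ] ℂ).intervalIntegral_comp_comm (hcm.intervalIntegrable (μ := volume) 0 (2 * Real.pi))
    simp only [circleIntegral]
    exact this.symm
  simp only [ContinuousMap.smul_apply]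
  rw [NNReal.coe_one, e2, e1, inv_smul_smul₀ Complex.two_pi_I_ne_zero]
  rfl

lemma osg_psi (b : ℂ) : AnalyticAt ℂ (fun w => Ring.inverse
    ((⟨fun θ : (Set.Icc (0 : ℝ) (2 * Real.pi)) => circleMap b 1 θ, by fun_prop⟩ : C((Set.Icc (0 : ℝ) (2 * Real.pi)), ℂ)) - algebraMap ℂ C((Set.Icc (0 : ℝ) (2 * Real.pi)), ℂ) w)) b ∧ 
    ∀ w ∈ Metric.ball b 1, ∀ θ, (Ring.inverse
    ((⟨fun θ : (Set.Icc (0 : ℝ) (2 * Real.pi)) => circleMap b 1 θ, by fun_prop⟩ : C((Set.Icc (0 : ℝ) (2 * Real.pi)), ℂ)) - algebraMap ℂ C((Set.Icc (0 : ℝ) (2 * Real.pi)), ℂ) w)) θ = (circleMap b 1 θ - w)⁻¹ := by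
  set γ : C((Set.Icc (0 : ℝ) (2 * Real.pi)), ℂ) := ⟨fun θ : (Set.Icc (0 : ℝ) (2 * Real.pi)) => circleMap b 1 θ, by fun_prop⟩
  have hne : ∀ w ∈ Metric.ball b 1, ∀ t : ℝ, circleMap b 1 t - w ≠ 0 := fun w hw t h => by
    have h3 : circleMap b 1 t = w := by linear_combination h
    have := circleMap_mem_sphere b zero_le_one t
    rw [h3] at this
    rw [mem_sphere_iff_norm] at this
    rw [mem_ball_iff_norm] at hw
    linarith
  have hu : ∀ w, ∀ hw : w ∈ Metric.ball b 1, ∃ u : (C((Set.Icc (0 : ℝ) (2 * Real.pi)), ℂ))ˣ, (u : C((Set.Icc (0 : ℝ) (2 * Real.pi)), ℂ)) = γ - algebraMap ℂ C((Set.Icc (0 : ℝ) (2 * Real.pi)), ℂ) w ∧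
      ((u⁻¹ : (C((Set.Icc (0 : ℝ) (2 * Real.pi)), ℂ))ˣ) : C((Set.Icc (0 : ℝ) (2 * Real.pi)), ℂ)) = ⟨fun θ : (Set.Icc (0 : ℝ) (2 * Real.pi)) => (circleMap b 1 θ - w)⁻¹, Continuous.inv₀ (by fun_prop) (fun t => hne w hw t)⟩ := by
    intro w hw
    refine ⟨⟨γ - algebraMap ℂ C((Set.Icc (0 : ℝ) (2 * Real.pi)), ℂ) w, ⟨fun θ : (Set.Icc (0 : ℝ) (2 * Real.pi)) => (circleMap b 1 θ - w)⁻¹, Continuous.inv₀ (by fun_prop) (fun t => hne w hw t)⟩, ?_, ?_⟩, rfl, rfl⟩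
    · ext θ
      exact mul_inv_cancel₀ (hne w hw θ)
    · ext θ
      exact inv_mul_cancel₀ (hne w hw θ)
  constructor
  · obtain ⟨u, hu1, _⟩ := hu b (Metric.mem_ball_self one_pos)
    have h1 : AnalyticAt ℂ Ring.inverse (u : C((Set.Icc (0 : ℝ) (2 * Real.pi)), ℂ)) := analyticAt_inverse u
    rw [hu1] at h1
    have h2 : AnalyticAt ℂ (fun w : ℂ => γ - algebraMap ℂ C((Set.Icc (0 : ℝ) (2 * Real.pi)), ℂ) w) b :=
      analyticAt_const.sub ((Algebra.linearMap ℂ C((Set.Icc (0 : ℝ) (2 * Real.pi)), ℂ)).toContinuousLinearMap.analyticAt b)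
    exact h1.comp (f := fun w : ℂ => γ - algebraMap ℂ C((Set.Icc (0 : ℝ) (2 * Real.pi)), ℂ) w) h2
  · intro w hw θ
    obtain ⟨u, hu1, hu2⟩ := hu w hw
    rw [← hu1, Ring.inverse_unit, hu2]
    rfl

theorem osgood (f : ℂ × ℂ → ℂ) (hc : Continuous f) (h1 : ∀ w, Differentiable ℂ (fun z => f (z, w)))
    (h2 : ∀ z, Differentiable ℂ (fun w => f (z, w))) (p : ℂ × ℂ) : AnalyticAt ℂ f p := by
  obtain ⟨a, b⟩ := p
  obtain ⟨hΨ, hΨ'⟩ := osg_psi b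
  have hΦ := osg_phi f hc h1 a b
  set Ψ := fun w => Ring.inverse
    ((⟨fun θ : (Set.Icc (0 : ℝ) (2 * Real.pi)) => circleMap b 1 θ, by fun_prop⟩ : C((Set.Icc (0 : ℝ) (2 * Real.pi)), ℂ)) - algebraMap ℂ C((Set.Icc (0 : ℝ) (2 * Real.pi)), ℂ) w)
  set Φ : ℂ → C((Set.Icc (0 : ℝ) (2 * Real.pi)), ℂ) := fun z => (⟨fun θ : (Set.Icc (0 : ℝ) (2 * Real.pi)) => f (z, circleMap b 1 θ), by fun_prop⟩ : C((Set.Icc (0 : ℝ) (2 * Real.pi)), ℂ))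
  let κ : C((Set.Icc (0 : ℝ) (2 * Real.pi)), ℂ) := ⟨fun θ : (Set.Icc (0 : ℝ) (2 * Real.pi)) => circleMap 0 1 θ * Complex.I, by fun_prop⟩
  have hA : AnalyticAt ℂ (fun p : ℂ × ℂ => (2 * Real.pi * Complex.I : ℂ)⁻¹ * osgI (κ * (Ψ p.2 * Φ p.1))) (a, b) := by
    have e1 : AnalyticAt ℂ (fun p : ℂ × ℂ => Φ p.1) (a, b) := hΦ.comp (f := Prod.fst) (x := (a, b)) analyticAt_fst
    have e2 : AnalyticAt ℂ (fun p : ℂ × ℂ => Ψ p.2) (a, b) := hΨ.comp (f := Prod.snd) (x := (a, b)) analyticAt_snd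
    exact analyticAt_const.mul ((osgI.analyticAt _).comp (analyticAt_const.mul (e2.mul e1)))
  refine hA.congr ?_
  have hn : {p : ℂ × ℂ | p.2 ∈ Metric.ball b 1} ∈ 𝓝 (a, b) :=
    continuous_snd.continuousAt.preimage_mem_nhds (Metric.ball_mem_nhds b one_pos)
  filter_upwards [hn] with p hp
  have e := ((h2 p.1).differentiableOn (s := Metric.closedBall b 1)).circleIntegral_sub_inv_smul (w := p.2) (by simpa using hp)

  have hne : ∀ t : ℝ, circleMap b 1 t - p.2 ≠ 0 := fun t h => by
    have h3 : circleMap b 1 t = p.2 := by linear_combination h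
    have := circleMap_mem_sphere b zero_le_one t
    rw [h3] at this
    rw [mem_sphere_iff_norm] at this
    rw [mem_ball_iff_norm] at hp
    linarith
  have hcont : Continuous (fun t : ℝ => (circleMap 0 1 t * Complex.I) * ((circleMap b 1 t - p.2)⁻¹ * f (p.1, circleMap b 1 t))) := by
    have hcc : Continuous (circleMap b 1) := continuous_circleMap _ _
    have hcc' : Continuous (circleMap 0 1) := continuous_circleMap _ _
    have hinv : Continuous fun t => (circleMap b 1 t - p.2)⁻¹ := (hcc.sub continuous_const).inv₀ hne
    fun_prop
  have e3 : κ * (Ψ p.2 * Φ p.1) = ⟨fun t : (Set.Icc (0 : ℝ) (2 * Real.pi)) => (circleMap 0 1 t * Complex.I) * ((circleMap b 1 t - p.2)⁻¹ * f (p.1, circleMap b 1 t)), hcont.comp continuous_subtype_val⟩ := by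
    ext θ
    simp only [ContinuousMap.mul_apply]
    rw [hΨ' p.2 hp θ]
    rfl
  rw [e3, osgI_apply _ hcont]
  simp only [circleIntegral, deriv_circleMap, smul_eq_mul] at e
  rw [e]
  have : (2 * Real.pi * Complex.I : ℂ) ≠ 0 := Complex.two_pi_I_ne_zero
  field_simp

/-- locally uniform limits of entire maps of `ℂ²` are analytic -/
theorem analytic_limit (F : ℕ → ℂ × ℂ → ℂ × ℂ) (G : ℂ × ℂ → ℂ × ℂ) (hF : ∀ n, Differentiable ℂ (F n))
    (hG : TendstoLocallyUniformly F G atTop) (p : ℂ × ℂ) : AnalyticAt ℂ G p := by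
  have hGc : Continuous G := hG.continuous (Frequently.of_forall fun n => (hF n).continuous)
  have key : ∀ (i : ℂ → ℂ × ℂ), Differentiable ℂ i → ∀ (π : ℂ × ℂ →L[ℂ] ℂ), Differentiable ℂ (fun z => π (G (i z))) := by
    intro i hi π
    have h1 : TendstoLocallyUniformly (fun n => (F n) ∘ i) (G ∘ i) atTop := hG.comp i hi.continuous
    have h2 : TendstoLocallyUniformly (fun n => fun z => π (F n (i z))) (fun z => π (G (i z))) atTop := by
      intro u hu x
      have := π.uniformContinuous hu
      exact h1 _ this x
    have h3 : TendstoLocallyUniformlyOn (fun n => fun z => π (F n (i z))) (fun z => π (G (i z))) atTop Set.univ :=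
      tendstoLocallyUniformlyOn_univ.2 h2
    have := h3.differentiableOn (Eventually.of_forall fun n =>
      (π.differentiable.comp ((hF n).comp hi)).differentiableOn) isOpen_univ
    exact differentiableOn_univ.1 this
  have h1 : AnalyticAt ℂ (fun p => (G p).1) p := osgood _ (continuous_fst.comp hGc)
    (fun w => key (fun z => (z, w)) (by fun_prop) (ContinuousLinearMap.fst ℂ ℂ ℂ))
    (fun z => key (fun w => (z, w)) (by fun_prop) (ContinuousLinearMap.fst ℂ ℂ ℂ)) p
  have h2 : AnalyticAt ℂ (fun p => (G p).2) p := osgood _ (continuous_snd.comp hGc)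
    (fun w => key (fun z => (z, w)) (by fun_prop) (ContinuousLinearMap.snd ℂ ℂ ℂ))
    (fun z => key (fun w => (z, w)) (by fun_prop) (ContinuousLinearMap.snd ℂ ℂ ℂ)) p
  exact h1.prod h2

end Osgood

/-! ### Rotations conjugated by analytic maps -/

/-- horizontal translation vector -/
def tv (a : ℝ) : Torus2 := ((a : Crc), 0)

lemma tv_add (a b : ℝ) : tv (a + b) = tv a + tv b := by simp [tv]
lemma tv_zero : tv 0 = 0 := by simp [tv]
lemma tv_int (n : ℤ) : tv n = 0 := by
  have : ((n : ℝ) : Crc) = 0 := by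
    rw [AddCircle.coe_eq_zero_iff]; exact ⟨n, by simp⟩
  simp [tv, this]
lemma tv_continuous : Continuous tv := by
  unfold tv
  have := continuous_crc_coe
  fun_prop

def EMap.rot (e : EMap) (a : ℝ) (x : Torus2) : Torus2 := e.h (e.h.symm x + tv a)

def EMap.rotC (e : EMap) (a : ℝ) (x : ℂ × ℂ) : ℂ × ℂ := e.c (e.ci x + ((a : ℂ), 0))

lemma EMap.rot_rot (e : EMap) (a b : ℝ) (x) : e.rot a (e.rot b x) = e.rot (b + a) x := by
  simp [EMap.rot, tv_add, add_assoc]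

lemma EMap.rot_zero (e : EMap) (x) : e.rot 0 x = x := by simp [EMap.rot, tv_zero]

lemma EMap.rot_iter (e : EMap) (a : ℝ) (i : ℕ) (x) : (e.rot a)^[i] x = e.rot (i * a) x := by
  induction i with
  | zero => simp [EMap.rot_zero]
  | succ n ih =>
    rw [Function.iterate_succ_apply', ih, EMap.rot_rot]
    congr 1; push_cast; ring

lemma EMap.rot_continuous2 (e : EMap) : Continuous (fun p : ℝ × Torus2 => e.rot p.1 p.2) := by
  unfold EMap.rot
  have := tv_continuous
  have := e.h.continuous
  have := e.h.symm.continuous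
  fun_prop

lemma EMap.rot_continuous (e : EMap) (a) : Continuous (e.rot a) :=
  e.rot_continuous2.comp (by fun_prop : Continuous fun x : Torus2 => (a, x))

lemma torus_add_mp (v : Torus2) : MeasurePreserving (fun x : Torus2 => x + v) volume volume :=
  (measurePreserving_add_right (volume : Measure Crc) v.1).prod (measurePreserving_add_right (volume : Measure Crc) v.2)

lemma EMap.rot_mp (e : EMap) (a : ℝ) : MeasurePreserving (e.rot a) volume volume := by
  have h1 : MeasurePreserving (fun x : Torus2 => x + tv a) volume volume := torus_add_mp _
  have h2 : MeasurePreserving e.h.symm volume volume := by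
    have := MeasurePreserving.symm e.h.toMeasurableEquiv e.mp
    exact this
  exact e.mp.comp (h1.comp h2)

lemma EMap.rotC_diff (e : EMap) (a : ℝ) : Differentiable ℂ (e.rotC a) := by
  unfold EMap.rotC
  exact e.c_diff.comp (e.ci_diff.add_const _)

lemma EMap.rotC_continuous2 (e : EMap) : Continuous (fun p : ℝ × (ℂ × ℂ) => e.rotC p.1 p.2) := by
  unfold EMap.rotC
  have := e.c_diff.continuous
  have := e.ci_diff.continuous
  fun_prop

lemma cvec_inj {m m' : ℤ × ℤ} (h : cvec m = cvec m') : m = m' := by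
  simp only [cvec, Prod.mk.injEq, Int.cast_inj] at h
  exact Prod.ext h.1 h.2

lemma EMap.rotC_per (e : EMap) (a : ℝ) (p) (m : ℤ × ℤ) : e.rotC a (p + cvec m) = e.rotC a p + cvec m := by
  obtain ⟨m1, h1⟩ := e.ci_per m
  obtain ⟨m2, h2⟩ := e.c_per m1
  have h3 : e.c (e.ci (0 + cvec m)) = e.c (e.ci 0) + cvec m2 := by rw [h1, h2]
  rw [e.c_ci, e.c_ci, zero_add, zero_add] at h3
  simp only [EMap.rotC]
  rw [h1, add_right_comm, h2, ← h3]

lemma EMap.rotC_real (e : EMap) (a : ℝ) (p : ℝ × ℝ) :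
    e.rotC a (cplx p) = cplx (e.rl (e.rli p + (a, 0))) := by
  simp only [EMap.rotC]
  rw [e.ci_real, ← e.c_real]
  congr 1
  simp [cplx]

lemma cplx_inj {p p' : ℝ × ℝ} (h : cplx p = cplx p') : p = p' := by
  simp only [cplx, Prod.mk.injEq, Complex.ofReal_inj] at h
  exact Prod.ext h.1 h.2

lemma EMap.rl_rli (e : EMap) (p) : e.rl (e.rli p) = p := by
  apply cplx_inj
  rw [← e.c_real, ← e.ci_real, e.c_ci]

lemma EMap.rot_lift (e : EMap) (a : ℝ) (p : ℝ × ℝ) :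
    torusProj (e.rl (e.rli p + (a, 0))) = e.rot a (torusProj p) := by
  rw [e.lift]
  unfold EMap.rot
  congr 1
  have h1 : e.h.symm (torusProj p) = torusProj (e.rli p) := by
    rw [Homeomorph.symm_apply_eq, ← e.lift, e.rl_rli]
  rw [h1]
  simp [torusProj, tv]

/-- iterate a good commutation -/
lemma EMap.Good.comm {e : EMap} {q : ℕ} (he : e.Good q) (j : ℤ) (p : ℂ × ℂ) :
    e.c (p + ((j / q : ℂ), 0)) = e.c p + ((j / q : ℂ), 0) := by
  have hn : ∀ (n : ℕ) (p), e.c (p + ((n / q : ℂ), 0)) = e.c p + ((n / q : ℂ), 0) := by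
    intro n
    induction n with
    | zero =>
      intro p
      have : (((0 : ℕ) / q : ℂ), (0 : ℂ)) = 0 := by simp
      rw [this]; simp
    | succ n ih =>
      intro p
      have e1 : p + (((n + 1 : ℕ) / q : ℂ), (0 : ℂ)) = (p + ((n / q : ℂ), 0)) + ((1 / q : ℂ), 0) := by
        ext <;> simp; ring
      rw [e1, he.1, ih]
      ext <;> simp; ring
  obtain ⟨n, rfl | rfl⟩ := j.eq_nat_or_neg
  · simpa using hn n p
  · have := hn n (p + ((-n / q : ℂ), 0))
    have e1 : p + ((-n / q : ℂ), (0 : ℂ)) + ((n / q : ℂ), 0) = p := by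
      ext <;> simp; ring
    rw [e1] at this
    rw [this]
    ext <;> simp; ring

lemma torusProj_surj (x : Torus2) : ∃ p, torusProj p = x := by
  obtain ⟨x, y⟩ := x
  induction x using QuotientAddGroup.induction_on with | H x => ?_
  induction y using QuotientAddGroup.induction_on with | H y => ?_
  exact ⟨(x, y), rfl⟩

lemma EMap.Good.commT {e : EMap} {q : ℕ} (he : e.Good q) (j : ℤ) (x : Torus2) :
    e.h (x + tv (j / q)) = e.h x + tv (j / q) := by
  obtain ⟨p, rfl⟩ := torusProj_surj x
  have h1 : torusProj p + tv (j / q) = torusProj (p + ((j / q : ℝ), 0)) := by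
    simp [torusProj, tv]
  rw [h1, ← e.lift, ← e.lift]
  have h2 : e.rl (p + ((j / q : ℝ), 0)) = e.rl p + ((j / q : ℝ), 0) := by
    apply cplx_inj
    rw [← e.c_real]
    have := he.comm j (cplx p)
    rw [e.c_real] at this
    have e3 : cplx (p + ((j / q : ℝ), 0)) = cplx p + ((j / q : ℂ), 0) := by simp [cplx]
    rw [e3, this]
    simp [cplx]
  rw [h2]
  simp [torusProj, tv]

lemma EMap.Good.rot_comp (H : EMap) {e : EMap} {q : ℕ} (he : e.Good q) (j : ℤ) (x : Torus2) :
    (H.comp e).rot (j / q) x = H.rot (j / q) x := by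
  have h1 : (H.comp e).h.symm x = e.h.symm (H.h.symm x) := rfl
  simp only [EMap.rot, h1, EMap.comp_h, he.commT, Homeomorph.apply_symm_apply]

lemma EMap.Good.rotC_comp (H : EMap) {e : EMap} {q : ℕ} (he : e.Good q) (j : ℤ) (x : ℂ × ℂ) :
    (H.comp e).rotC (j / q) x = H.rotC (j / q) x := by
  have := he.comm j (e.ci (H.ci x))
  rw [e.c_ci] at this
  simp only [EMap.rotC, EMap.comp, Function.comp]
  push_cast
  rw [this]

lemma unif_ev {Y Z : Type*} [TopologicalSpace Y] [PseudoMetricSpace Z] (g : ℝ × Y → Z) (hg : Continuous g)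
    (K : Set Y) (hK : IsCompact K) (a : ℝ) (ε : ℝ) (hε : 0 < ε) :
    ∀ᶠ t in 𝓝 a, ∀ y ∈ K, dist (g (t, y)) (g (a, y)) ≤ ε := by
  refine hK.eventually_forall_of_forall_eventually (x₀ := a) (P := fun t y => dist (g (t, y)) (g (a, y)) ≤ ε) ?_
  intro y _
  have hc : Continuous (fun z : ℝ × Y => dist (g (z.1, z.2)) (g (a, z.2))) := by fun_prop
  have : Tendsto (fun z : ℝ × Y => dist (g (z.1, z.2)) (g (a, z.2))) (𝓝 (a, y)) (𝓝 0) := by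
    have := hc.tendsto (a, y)
    simpa using this
  filter_upwards [this.eventually (gt_mem_nhds hε)] with z hz using hz.le

/-! ### Block lemma -/

lemma sum_range_shift (g : ℕ → ℝ) (q : ℕ) (hg : ∀ m, g (m + q) = g m) (i : ℕ) :
    ∑ l ∈ Finset.range q, g (l + i) = ∑ l ∈ Finset.range q, g l := by
  induction i with
  | zero => rfl
  | succ i ih =>
    rw [← ih]
    have h1 := Finset.sum_range_succ (fun l => g (l + i)) q
    have h2 := Finset.sum_range_succ' (fun l => g (l + i)) q
    rw [h1] at h2
    have h3 : g (q + i) = g (0 + i) := by rw [add_comm, hg, zero_add]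
    rw [h3] at h2
    have := add_right_cancel h2
    rw [this]
    refine Finset.sum_congr rfl fun l _ => ?_
    congr 1; ring

def ubar (u : C(Crc, ℝ)) (p q : ℕ) (y : Crc) : ℝ :=
  (q : ℝ)⁻¹ * ∑ l ∈ Finset.range q, u (y + ((l * (p / q : ℝ) : ℝ) : Crc))

lemma ubar_continuous (u p q) : Continuous (ubar u p q) := by
  unfold ubar
  fun_prop

lemma ubar_mod (u : C(Crc, ℝ)) (p q : ℕ) (hq : 0 < q) (ω : ℝ) (x x' : Crc)
    (h : ∀ y : Crc, |u (x + y) - u (x' + y)| ≤ ω) : |ubar u p q x - ubar u p q x'| ≤ ω := by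
  unfold ubar
  have hq' : (0 : ℝ) < q := by exact_mod_cast hq
  rw [← mul_sub, ← Finset.sum_sub_distrib, abs_mul, abs_of_pos (by positivity : (0 : ℝ) < (q : ℝ)⁻¹)]
  have : |∑ l ∈ Finset.range q, (u (x + ((l * (p / q : ℝ) : ℝ) : Crc)) - u (x' + ((l * (p / q : ℝ) : ℝ) : Crc)))| ≤ q * ω := by
    refine (Finset.abs_sum_le_sum_abs _ _).trans ?_
    refine (Finset.sum_le_sum fun l _ => h _).trans ?_
    simp
  calc (q : ℝ)⁻¹ * _ ≤ (q : ℝ)⁻¹ * (q * ω) := by gcongr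
    _ = ω := by field_simp

lemma abs_shift_sum (a : ℕ → ℝ) (M : ℝ) (hM : ∀ i, |a i| ≤ M) (N l : ℕ) :
    |∑ i ∈ Finset.range N, a (i + l) - ∑ i ∈ Finset.range N, a i| ≤ 2 * l * M := by
  induction l with
  | zero => simp
  | succ l ih =>
    have h1 := Finset.sum_range_succ (fun i => a (i + l)) N
    have h2 := Finset.sum_range_succ' (fun i => a (i + l)) N
    have h3 : ∑ i ∈ Finset.range N, a (i + (l + 1)) = ∑ i ∈ Finset.range N, a (i + 1 + l) :=
      Finset.sum_congr rfl fun i _ => by congr 1; ring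
    have h4 := hM (N + l)
    have h5 := hM (0 + l)
    rw [h3]
    push_cast
    rw [abs_le] at *
    constructor <;> nlinarith

lemma block_sum (u : C(Crc, ℝ)) (p q : ℕ) (hq : 0 < q) (δ : ℝ) (hδ : 0 < δ) (ω M : ℝ)
    (hω : ∀ x x' : Crc, dist x x' ≤ q * δ → |u x - u x'| ≤ ω) (hM : ∀ x, |u x| ≤ M) (N : ℕ) (x : Crc) :
    |∑ i ∈ Finset.range N, u (x + ((i * (p / q + δ) : ℝ) : Crc)) -
      ∑ i ∈ Finset.range N, ubar u p q (x + ((i * δ : ℝ) : Crc))| ≤ N * ω + 2 * q * M := by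
  have hq' : (0 : ℝ) < q := by exact_mod_cast hq
  have hM0 : 0 ≤ M := (abs_nonneg _).trans (hM 0)
  set a : ℕ → ℝ := fun i => u (x + ((i * (p / q + δ) : ℝ) : Crc))
  let b : ℕ → ℕ → ℝ := fun l i => u (x + ((i * δ : ℝ) : Crc) + (((l + i : ℕ) * (p / q : ℝ) : ℝ) : Crc))
  have hb : ∀ i : ℕ, ubar u p q (x + ((i * δ : ℝ) : Crc)) = (q : ℝ)⁻¹ * ∑ l ∈ Finset.range q, b l i := by
    intro i
    unfold ubar
    congr 1
    symm
    refine sum_range_shift (fun l => u (x + ((i * δ : ℝ) : Crc) + ((l * (p / q : ℝ) : ℝ) : Crc))) q ?_ i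
    intro m
    have e1 : (((m + q : ℕ) * (p / q : ℝ) : ℝ) : Crc) = ((m * (p / q : ℝ) : ℝ) : Crc) := by
      have : ((m + q : ℕ) * (p / q : ℝ) : ℝ) = m * (p / q : ℝ) + (p : ℤ) := by
        push_cast; field_simp
      rw [this, AddCircle.coe_add]
      have h0 : (((p : ℤ) : ℝ) : Crc) = 0 := by
        rw [AddCircle.coe_eq_zero_iff]; exact ⟨p, by simp⟩
      rw [h0, add_zero]
    simp only [e1]
  have hl : ∀ l ∈ Finset.range q, |∑ i ∈ Finset.range N, a i - ∑ i ∈ Finset.range N, b l i| ≤ N * ω + 2 * q * M := by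
    intro l hl
    have hlq : (l : ℝ) ≤ q := by exact_mod_cast (Finset.mem_range.1 hl).le
    have h1 := abs_shift_sum a M (fun i => hM _) N l
    have h2 : |∑ i ∈ Finset.range N, a (i + l) - ∑ i ∈ Finset.range N, b l i| ≤ N * ω := by
      rw [← Finset.sum_sub_distrib]
      refine (Finset.abs_sum_le_sum_abs _ _).trans ?_
      refine (Finset.sum_le_sum fun i _ => ?_).trans (by simp : ∑ i ∈ Finset.range N, ω ≤ N * ω)
      apply hω
      have : x + ((i * δ : ℝ) : Crc) + (((l + i : ℕ) * (p / q : ℝ) : ℝ) : Crc) =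
          x + ((i * δ + (l + i : ℕ) * (p / q : ℝ) : ℝ) : Crc) := by
        rw [add_assoc, ← AddCircle.coe_add]
      rw [this]
      refine (crc_dist_add_coe _ _ _).trans ?_
      have e2 : ((i + l : ℕ) * (p / q + δ) - (i * δ + (l + i : ℕ) * (p / q : ℝ)) : ℝ) = l * δ := by
        push_cast; ring
      rw [e2, abs_of_nonneg (by positivity)]
      gcongr
    have h3 : 2 * (l : ℝ) * M ≤ 2 * q * M := by gcongr
    rw [abs_le] at *
    constructor <;> linarith [h1.1, h1.2, h2.1, h2.2]
  have hsum : ∑ i ∈ Finset.range N, a i - ∑ i ∈ Finset.range N, ubar u p q (x + ((i * δ : ℝ) : Crc)) =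
      (q : ℝ)⁻¹ * ∑ l ∈ Finset.range q, (∑ i ∈ Finset.range N, a i - ∑ i ∈ Finset.range N, b l i) := by
    rw [Finset.sum_sub_distrib, mul_sub]
    congr 1
    · simp; field_simp
    · simp only [hb]
      rw [← Finset.mul_sum, Finset.sum_comm]
  rw [hsum, abs_mul, abs_of_pos (by positivity : (0 : ℝ) < (q : ℝ)⁻¹)]
  calc (q : ℝ)⁻¹ * _ ≤ (q : ℝ)⁻¹ * (q * (N * ω + 2 * q * M)) := by
        gcongr
        refine (Finset.abs_sum_le_sum_abs _ _).trans ?_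
        refine (Finset.sum_le_sum hl).trans ?_
        rw [Finset.sum_const, Finset.card_range, nsmul_eq_mul]
    _ = _ := by field_simp

lemma riemann_sum (v : Crc → ℝ) (hv : Continuous v) (δ ω : ℝ) (hδ : 0 < δ) (x : Crc)
    (hω : ∀ x x' : Crc, dist x x' ≤ δ → |v x - v x'| ≤ ω) (N : ℕ) :
    |δ * ∑ i ∈ Finset.range N, v (x + ((i * δ : ℝ) : Crc)) - ∫ z in (0 : ℝ)..(N * δ), v (x + (z : Crc))| ≤ N * δ * ω := by
  have hc : Continuous (fun z : ℝ => v (x + (z : Crc))) := by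
    have := continuous_crc_coe
    fun_prop
  induction N with
  | zero => simp
  | succ N ih =>
    rw [Finset.sum_range_succ, ← intervalIntegral.integral_add_adjacent_intervals (b := N * δ)
      (hc.intervalIntegrable _ _) (hc.intervalIntegrable _ _)]
    have h2 : |δ * v (x + ((N * δ : ℝ) : Crc)) - ∫ z in (N * δ)..((N + 1 : ℕ) * δ), v (x + (z : Crc))| ≤ δ * ω := by
      have e1 : δ * v (x + ((N * δ : ℝ) : Crc)) = ∫ z in (N * δ)..((N + 1 : ℕ) * δ), v (x + ((N * δ : ℝ) : Crc)) := by
        rw [intervalIntegral.integral_const]; push_cast; simp; left; ring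
      rw [e1, ← intervalIntegral.integral_sub (by simp) (hc.intervalIntegrable _ _)]
      have := intervalIntegral.norm_integral_le_of_norm_le_const (a := N * δ) (b := (N + 1 : ℕ) * δ) (C := ω)
        (f := fun z => v (x + ((N * δ : ℝ) : Crc)) - v (x + (z : Crc))) ?_
      · have e3 : |((N + 1 : ℕ) * δ : ℝ) - N * δ| = δ := by
          push_cast; ring_nf; exact abs_of_pos hδ
        rw [e3, mul_comm ω] at this
        exact this
      · intro z hz
        rw [Set.uIoc_of_le (by push_cast; nlinarith)] at hz
        apply hω
        refine (crc_dist_add_coe _ _ _).trans ?_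
        rw [abs_le]
        push_cast at hz
        constructor <;> nlinarith [hz.1, hz.2]
    push_cast at *
    rw [abs_le] at *
    constructor <;> nlinarith [ih.1, ih.2, h2.1, h2.2]

lemma block (u : C(Crc, ℝ)) (p q : ℕ) (hq : 0 < q) (δ : ℝ) (hδ : 0 < δ) (ω M : ℝ)
    (hω : ∀ x x' : Crc, dist x x' ≤ q * δ → |u x - u x'| ≤ ω) (hM : ∀ x, |u x| ≤ M) (N : ℕ) (hN : 0 < N) (x : Crc) :
    |(N : ℝ)⁻¹ * ∑ i ∈ Finset.range N, u (x + ((i * (p / q + δ) : ℝ) : Crc)) -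
      (N * δ)⁻¹ * ∫ z in (0 : ℝ)..(N * δ), ubar u p q (x + (z : Crc))| ≤ 2 * ω + 2 * q * M / N := by
  have hN' : (0 : ℝ) < N := by exact_mod_cast hN
  have hq1 : (1 : ℝ) ≤ q := by exact_mod_cast hq
  have h1 := block_sum u p q hq δ hδ ω M hω hM N x
  have h2 := riemann_sum (ubar u p q) (ubar_continuous u p q) δ ω hδ x (fun x x' h => by
    apply ubar_mod u p q hq
    intro y
    apply hω
    rw [dist_add_right]
    nlinarith) N
  set A := ∑ i ∈ Finset.range N, u (x + ((i * (p / q + δ) : ℝ) : Crc))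
  set B := ∑ i ∈ Finset.range N, ubar u p q (x + ((i * δ : ℝ) : Crc))
  set I := ∫ z in (0 : ℝ)..(N * δ), ubar u p q (x + (z : Crc))
  have e : (N : ℝ)⁻¹ * A - (N * δ)⁻¹ * I = (N : ℝ)⁻¹ * (A - B) + (N * δ)⁻¹ * (δ * B - I) := by
    field_simp; ring
  rw [e]
  refine (abs_add_le _ _).trans ?_
  rw [abs_mul, abs_mul, abs_of_pos (by positivity : (0 : ℝ) < (N : ℝ)⁻¹), abs_of_pos (by positivity : (0 : ℝ) < (N * δ)⁻¹)]
  calc _ ≤ (N : ℝ)⁻¹ * (N * ω + 2 * q * M) + (N * δ)⁻¹ * (N * δ * ω) := by gcongr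
    _ = _ := by field_simp; ring

/-! ### File D: representatives, strips -/

def rep (y : Crc) : ℝ := (AddCircle.equivIco 1 0 y : ℝ)

lemma rep_nonneg (y : Crc) : 0 ≤ rep y := (AddCircle.equivIco 1 0 y).2.1
lemma rep_lt (y : Crc) : rep y < 1 := by
  have := (AddCircle.equivIco 1 0 y).2.2
  simpa [rep] using this
lemma coe_rep (y : Crc) : ((rep y : ℝ) : Crc) = y := AddCircle.coe_equivIco
lemma rep_coe {t : ℝ} (h0 : 0 ≤ t) (h1 : t < 1) : rep (t : Crc) = t := by
  have := AddCircle.equivIco_coe_eq (p := (1 : ℝ)) (a := 0) (x := t) ⟨h0, by simpa using h1⟩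
  simp [rep, this]
lemma rep_zero : rep 0 = 0 := by
  have := rep_coe (le_refl (0:ℝ)) zero_lt_one
  simpa using this
lemma norm_le_rep (y : Crc) : ‖y‖ ≤ rep y := by
  conv_lhs => rw [← coe_rep y]
  exact (crc_norm_coe_le _).trans_eq (abs_of_nonneg (rep_nonneg y))
lemma norm_le_one_sub_rep (y : Crc) : ‖y‖ ≤ 1 - rep y := by
  have : y = ((rep y - 1 : ℝ) : Crc) := by
    rw [AddCircle.coe_sub, coe_rep, AddCircle.coe_period]; simp
  conv_lhs => rw [this]
  refine (crc_norm_coe_le _).trans_eq ?_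
  rw [abs_of_nonpos (by linarith [rep_lt y])]; ring

lemma rep_measurable : Measurable rep :=
  measurable_subtype_coe.comp (AddCircle.measurableEquivIco 1 0).measurable

lemma rep_continuousAt {y : Crc} (hy : y ≠ 0) : ContinuousAt rep y :=
  continuousAt_subtype_val.comp (AddCircle.continuousAt_equivIco 1 0 (by simpa using hy))

/-- continuous circle function from a function on `[0,1]` with equal end values -/
def per (g : ℝ → ℝ) (hg : Continuous g) (h : g 0 = g 1) : C(Crc, ℝ) where
  toFun := AddCircle.liftIco 1 0 g
  continuous_toFun := AddCircle.liftIco_continuous (by simpa using h) hg.continuousOn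

lemma per_apply (g hg h) (y : Crc) : per g hg h y = g (rep y) := by
  conv_lhs => rw [← coe_rep y]
  exact AddCircle.liftIco_coe_apply ⟨rep_nonneg y, by simpa using rep_lt y⟩

lemma per_coe (g hg h) {t : ℝ} (h0 : 0 ≤ t) (h1 : t ≤ 1) : per g hg h (t : Crc) = g t := by
  rcases h1.lt_or_eq with h1 | rfl
  · rw [per_apply, rep_coe h0 h1]
  · rw [per_apply, AddCircle.coe_period, rep_zero, h]

/-- indicator of the `t`-th horizontal strip -/
def chi (r t : ℕ) (p : Torus2) : ℝ := if ⌊(r : ℝ) * rep p.2⌋₊ = t then 1 else 0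

lemma chi_measurable (r t) : Measurable (chi r t) := by
  unfold chi
  refine Measurable.ite ?_ measurable_const measurable_const
  have : Measurable (fun p : Torus2 => ⌊(r : ℝ) * rep p.2⌋₊) :=
    Nat.measurable_floor.comp ((rep_measurable.comp measurable_snd).const_mul _)
  exact this (measurableSet_singleton t)

lemma chi_nonneg (r t p) : 0 ≤ chi r t p := by unfold chi; split_ifs <;> simp
lemma chi_le_one (r t p) : chi r t p ≤ 1 := by unfold chi; split_ifs <;> simp

lemma nsmul_mp (r : ℕ) (hr : 0 < r) : MeasurePreserving (fun y : Crc => r • y) volume volume :=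
  by
  rcases Nat.lt_or_ge 1 r with h | h
  · exact (AddCircle.ergodic_nsmul h).toMeasurePreserving
  · obtain rfl : r = 1 := by omega
    simp only [one_smul]
    exact MeasurePreserving.id (volume : Measure Crc)

lemma ae_nsmul_ne (r : ℕ) (hr : 0 < r) : ∀ᵐ y : Crc, r • y ≠ 0 := by
  have h : ∀ᵐ y : Crc, y ≠ 0 := by
    rw [ae_iff]
    have h2 := AddCircle.volume_closedBall (T := 1) (x := (0 : Crc)) 0
    simpa using h2
  have := (nsmul_mp r hr).quasiMeasurePreserving.ae h
  exact this

lemma ae_fst {P : Crc → Prop} (h : ∀ᵐ y, P y) : ∀ᵐ p : Torus2, P p.1 :=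
  Measure.quasiMeasurePreserving_fst.ae h
lemma ae_snd {P : Crc → Prop} (h : ∀ᵐ y, P y) : ∀ᵐ p : Torus2, P p.2 :=
  Measure.quasiMeasurePreserving_snd.ae h

lemma floor_ev {x : ℝ} (hx : 0 ≤ x) (h : (⌊x⌋₊ : ℝ) ≠ x) : ∀ᶠ x' in 𝓝 x, ⌊x'⌋₊ = ⌊x⌋₊ := by
  have h1 : (⌊x⌋₊ : ℝ) < x := lt_of_le_of_ne (Nat.floor_le hx) h
  have h2 := Nat.lt_floor_add_one x
  filter_upwards [Ioo_mem_nhds h1 h2] with x' hx'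
  rw [Nat.floor_eq_iff (by linarith [hx'.1, (Nat.cast_nonneg ⌊x⌋₊ : (0:ℝ) ≤ _)])]
  exact ⟨hx'.1.le, hx'.2⟩

lemma chi_ev (r t : ℕ) (p : Torus2) (h : r • p.2 ≠ 0) : ∀ᶠ p' in 𝓝 p, chi r t p' = chi r t p := by
  have hy : p.2 ≠ 0 := by rintro h0; rw [h0] at h; simp at h
  have hc : ContinuousAt (fun p : Torus2 => (r:ℝ) * rep p.2) p :=
    continuousAt_const.mul ((rep_continuousAt hy).comp continuousAt_snd)
  have hf : (⌊(r : ℝ) * rep p.2⌋₊ : ℝ) ≠ r * rep p.2 := by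
    intro h1
    apply h
    rw [← coe_rep p.2, ← AddCircle.coe_nsmul, nsmul_eq_mul, ← h1]
    have := AddCircle.coe_nsmul (p := (1:ℝ)) (n := ⌊(r : ℝ) * rep p.2⌋₊) (x := 1)
    rw [nsmul_eq_mul, mul_one] at this
    rw [this, AddCircle.coe_period, smul_zero]
  filter_upwards [hc.eventually (floor_ev (mul_nonneg (Nat.cast_nonneg r) (rep_nonneg _)) hf)] with p' hp'
  simp only [chi]
  rw [hp']

/-- convergence of strip indicators -/
lemma chi_lim (r t : ℕ) (h : ℕ → Torus2 → Torus2) (hm : ∀ k, Measurable (h k)) (g : Torus2 → Torus2)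
    (hl : ∀ᵐ p, Tendsto (fun k => h k p) atTop (𝓝 (g p))) (hb : ∀ᵐ p, r • (g p).2 ≠ 0)
    (hg : ∀ᵐ p, chi r t (g p) = chi r t p) :
    Tendsto (fun k => ∫ p, |chi r t (h k p) - chi r t p|) atTop (𝓝 0) := by
  have : Tendsto (fun k => ∫ p, |chi r t (h k p) - chi r t p|) atTop (𝓝 (∫ p : Torus2, (0:ℝ))) := by
    refine tendsto_integral_of_dominated_convergence (fun _ => 1) ?_ (integrable_const _) ?_ ?_
    · intro k
      exact ((((chi_measurable r t).comp (hm k)).sub (chi_measurable r t)).abs).aestronglyMeasurable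
    · intro k
      refine Eventually.of_forall fun p => ?_
      rw [Real.norm_eq_abs, abs_abs, abs_le]
      constructor <;> linarith [chi_nonneg r t (h k p), chi_le_one r t (h k p), chi_nonneg r t p, chi_le_one r t p]
    · filter_upwards [hl, hb, hg] with p h1 h2 h3
      refine tendsto_const_nhds.congr' ?_
      filter_upwards [h1.eventually (chi_ev r t (g p) h2)] with k hk
      rw [hk, h3]; simp
  simpa using this

/-! ### File E: averaging lemmas and the G-map -/

lemma per_ext (v : ℝ → ℝ) (hv : Continuous v) (hp : Function.Periodic v 1) (c : ℝ)
    (h : ∀ Z, 0 ≤ Z → Z ≤ 1 → |∫ s in (0:ℝ)..Z, v s| ≤ c * Z) (Z : ℝ) (hZ : 0 ≤ Z) :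
    |∫ s in (0:ℝ)..Z, v s| ≤ c * Z := by
  have key : ∀ n : ℕ, ∀ Z : ℝ, n ≤ Z → Z ≤ n + 1 → |∫ s in (0:ℝ)..Z, v s| ≤ c * Z := by
    intro n
    induction n with
    | zero => intro Z h0 h1; exact h Z (by simpa using h0) (by simpa using h1)
    | succ n ih =>
      intro Z h0 h1
      push_cast at h0 h1
      have e1 : ∫ s in (0:ℝ)..Z, v s = (∫ s in (0:ℝ)..1, v s) + ∫ s in (0:ℝ)..(Z-1), v s := by
        rw [← intervalIntegral.integral_add_adjacent_intervals (hv.intervalIntegrable 0 1) (hv.intervalIntegrable 1 Z)]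
        congr 1
        have := intervalIntegral.integral_comp_add_right (a := 0) (b := Z - 1) v 1
        simp only [hp _] at this
        rw [this]; simp
      rw [e1]
      have h2 := h 1 zero_le_one le_rfl
      have h3 := ih (Z - 1) (by linarith) (by linarith)
      calc _ ≤ _ := abs_add_le _ _
        _ ≤ c * 1 + c * (Z - 1) := add_le_add h2 h3
        _ = _ := by ring
  exact key ⌊Z⌋₊ Z (Nat.floor_le hZ) (Nat.lt_floor_add_one Z).le

lemma zero_mean (u : ℝ → ℝ) (hu : Continuous u) (hp : Function.Periodic u 1) (h0 : ∫ s in (0:ℝ)..1, u s = 0)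
    (C : ℝ) (hC : ∀ s, |u s| ≤ C) (Z : ℝ) (hZ : 0 ≤ Z) : |∫ s in (0:ℝ)..Z, u s| ≤ C := by
  have key : ∀ n : ℕ, ∀ Z : ℝ, n ≤ Z → Z ≤ n + 1 → |∫ s in (0:ℝ)..Z, u s| ≤ C := by
    intro n
    induction n with
    | zero =>
      intro Z h0 h1
      simp at h0 h1
      have := intervalIntegral.norm_integral_le_of_norm_le_const (a := 0) (b := Z) (f := u) (C := C) (fun x _ => hC x)
      rw [Real.norm_eq_abs] at this
      refine this.trans ?_
      have hC0 : 0 ≤ C := (abs_nonneg _).trans (hC 0)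
      rw [abs_of_nonneg (by linarith)]
      nlinarith
    | succ n ih =>
      intro Z h2 h1
      push_cast at h2 h1
      have e1 : ∫ s in (0:ℝ)..Z, u s = (∫ s in (0:ℝ)..1, u s) + ∫ s in (0:ℝ)..(Z-1), u s := by
        rw [← intervalIntegral.integral_add_adjacent_intervals (hu.intervalIntegrable 0 1) (hu.intervalIntegrable 1 Z)]
        congr 1
        have := intervalIntegral.integral_comp_add_right (a := 0) (b := Z - 1) u 1
        simp only [hp _] at this
        rw [this]; simp
      rw [e1, h0, zero_add]
      exact ih (Z - 1) (by linarith) (by linarith)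
  exact key ⌊Z⌋₊ Z (Nat.floor_le hZ) (Nat.lt_floor_add_one Z).le

lemma zero_mean_scaled (u : ℝ → ℝ) (hu : Continuous u) (hp : Function.Periodic u 1) (h0 : ∫ s in (0:ℝ)..1, u s = 0)
    (C : ℝ) (hC : ∀ s, |u s| ≤ C) (k : ℝ) (hk : 0 < k) (a b : ℝ) (ha : 0 ≤ a) (hb : 0 ≤ b) :
    |∫ s in a..b, u (k * s)| ≤ 2 * C / k := by
  rw [intervalIntegral.integral_comp_mul_left u hk.ne', smul_eq_mul,
    ← intervalIntegral.integral_interval_sub_left (hu.intervalIntegrable 0 _) (hu.intervalIntegrable 0 _),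
    abs_mul, abs_of_pos (inv_pos.2 hk)]
  have h1 := zero_mean u hu hp h0 C hC (k * b) (by positivity)
  have h2 := zero_mean u hu hp h0 C hC (k * a) (by positivity)
  have := abs_sub (∫ s in (0:ℝ)..k*b, u s) (∫ s in (0:ℝ)..k*a, u s)
  rw [inv_mul_eq_div]
  gcongr
  linarith

/-- the averaging estimate for the G-map -/
lemma avg_lemma (v u : ℝ → ℝ) (hv : Continuous v) (hu : Continuous u) (hp : Function.Periodic u 1)
    (h0 : ∫ s in (0:ℝ)..1, u s = 0) (C c ω L : ℝ) (hL : 4 ≤ L) (hω : 0 ≤ ω) (hc : 0 ≤ c)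
    (hC : ∀ s, |u s| ≤ C) (hCv : ∀ s, |v s| ≤ C)
    (h1 : ∀ s, 0 ≤ s → s ≤ 1 / L → |v s| ≤ c + ω)
    (h2 : ∀ s, 1 / L ≤ s → s ≤ 1 - 1 / L → |v s - u (L ^ 2 * s)| ≤ ω) :
    (∀ Z, 0 ≤ Z → Z ≤ 1 → |∫ s in (0:ℝ)..Z, v s| ≤ (c + (ω + 4 * C / L)) * Z) ∧
    |∫ s in (0:ℝ)..1, v s| ≤ ω + 4 * C / L := by
  have hC0 : 0 ≤ C := (abs_nonneg _).trans (hC 0)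
  have hL0 : 0 < L := by linarith
  have hi : 1 / L ≤ 1 / 4 := one_div_le_one_div_of_le (by norm_num) hL
  have hi0 : 0 < 1 / L := by positivity
  have bd : ∀ (f : ℝ → ℝ) (K a b : ℝ), a ≤ b → (∀ s, a ≤ s → s ≤ b → |f s| ≤ K) → |∫ s in a..b, f s| ≤ K * (b - a) := by
    intro f K a b hab hf
    have := intervalIntegral.norm_integral_le_of_norm_le_const (a := a) (b := b) (f := f) (C := K) (fun x hx => by
      rw [Set.uIoc_of_le hab] at hx; exact hf x hx.1.le hx.2)
    rwa [Real.norm_eq_abs, abs_of_nonneg (sub_nonneg.2 hab)] at this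
  have mid : ∀ Z, 1 / L ≤ Z → Z ≤ 1 - 1 / L → |∫ s in (1/L)..Z, v s| ≤ ω * (Z - 1 / L) + 2 * C / L ^ 2 := by
    intro Z hZ hZ1
    have hv' := hv.intervalIntegrable (μ := volume) (1/L) Z
    have hu' : IntervalIntegrable (fun s => u (L ^ 2 * s)) volume (1/L) Z := (by fun_prop : Continuous fun s => u (L^2 * s)).intervalIntegrable _ _
    have e : ∫ s in (1/L)..Z, v s = (∫ s in (1/L)..Z, (v s - u (L^2 * s))) + ∫ s in (1/L)..Z, u (L^2 * s) := by
      rw [intervalIntegral.integral_sub hv' hu']; ring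
    rw [e]
    refine (abs_add_le _ _).trans (add_le_add ?_ ?_)
    · exact bd _ _ _ _ hZ fun s hs hs' => h2 s hs (hs'.trans hZ1)
    · exact zero_mean_scaled u hu hp h0 C hC _ (by positivity) _ _ hi0.le (by linarith)
  have fst : ∀ Z, 0 ≤ Z → Z ≤ 1 / L → |∫ s in (0:ℝ)..Z, v s| ≤ (c + ω) * Z := by
    intro Z hZ hZ1
    simpa using bd v (c + ω) 0 Z hZ fun s hs hs' => h1 s hs (hs'.trans hZ1)
  have fst' : |∫ s in (0:ℝ)..(1/L), v s| ≤ C * (1 / L) := by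
    simpa using bd v C 0 (1/L) hi0.le fun s hs hs' => hCv s
  have spl : ∀ a b d, ∫ s in a..d, v s = (∫ s in a..b, v s) + ∫ s in b..d, v s := fun a b d =>
    (intervalIntegral.integral_add_adjacent_intervals (hv.intervalIntegrable a b) (hv.intervalIntegrable b d)).symm
  have hCL : 0 ≤ C / L := by positivity
  have hLL : 2 * C / L ^ 2 = 2 * (C / L) * (1 / L) := by field_simp
  have hLL' : C * (1 / L) = C / L := by ring
  have h4 : 4 * C / L = 4 * (C / L) := by ring
  rw [h4]
  constructor
  · intro Z hZ hZ1
    rcases le_total Z (1 / L) with h | h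
    · refine (fst Z hZ h).trans ?_
      nlinarith
    · have a1 := fst (1/L) hi0.le le_rfl
      rcases le_total Z (1 - 1 / L) with h' | h'
      · have a2 := mid Z h h'
        rw [spl 0 (1/L) Z]
        refine (abs_add_le _ _).trans ?_
        rw [hLL] at a2
        have : (C / L) * (1 / L) ≤ (C / L) * Z := by gcongr
        nlinarith [mul_nonneg hc (sub_nonneg.2 h)]
      · have a2 := mid (1 - 1/L) (by linarith) le_rfl
        have a3 := bd v C (1 - 1/L) Z h' fun s _ _ => hCv s
        rw [spl 0 (1/L) Z, spl (1/L) (1 - 1/L) Z]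
        refine (abs_add_le _ _).trans ((add_le_add le_rfl (abs_add_le _ _)).trans ?_)
        rw [hLL] at a2
        have e1 : (C / L) * (1 / L) ≤ (C / L) * (1/4) := by gcongr
        have e2 : C * (Z - (1 - 1/L)) ≤ C / L := by rw [← hLL']; gcongr; linarith
        have e3 : (C / L) * (3/4) ≤ (C / L) * Z := by gcongr; linarith
        nlinarith [mul_nonneg hc (sub_nonneg.2 h), mul_nonneg hω (by linarith : 0 ≤ Z - (1 - 1/L))]
  · have a2 := mid (1 - 1/L) (by linarith) le_rfl
    have a3 := bd v C (1 - 1/L) 1 (by linarith) fun s _ _ => hCv s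
    rw [spl 0 (1/L) 1, spl (1/L) (1 - 1/L) 1]
    refine (abs_add_le _ _).trans ((add_le_add le_rfl (abs_add_le _ _)).trans ?_)
    rw [hLL] at a2
    have e1 : (C / L) * (1 / L) ≤ (C / L) * (1/4) := by gcongr
    nlinarith [mul_nonneg hω hi0.le]

lemma tri_integral (Φ : C(Crc, ℝ)) : ∫ s in (0:ℝ)..1, Φ ((2 * ‖(s : Crc)‖ : ℝ) : Crc) = ∫ y, Φ y := by
  have hc : Continuous fun s : ℝ => Φ ((2 * ‖(s : Crc)‖ : ℝ) : Crc) :=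
    Φ.continuous.comp (continuous_crc_coe.comp (continuous_const.mul (continuous_norm.comp continuous_crc_coe)))
  have hc' : Continuous fun s : ℝ => Φ (s : Crc) := Φ.continuous.comp continuous_crc_coe
  rw [← intervalIntegral.integral_add_adjacent_intervals (hc.intervalIntegrable 0 (1/2)) (hc.intervalIntegrable (1/2) 1)]
  have nrm : ∀ s : ℝ, |s| ≤ 1/2 → ‖(s : Crc)‖ = |s| := fun s hs =>
    (AddCircle.norm_coe_eq_abs_iff (p := (1:ℝ)) (by norm_num)).2 (by simpa using hs)
  have e1 : ∫ s in (0:ℝ)..(1/2), Φ ((2 * ‖(s : Crc)‖ : ℝ) : Crc) = ∫ s in (0:ℝ)..(1/2), Φ ((2 * s : ℝ) : Crc) := by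
    refine intervalIntegral.integral_congr fun s hs => ?_
    rw [Set.uIcc_of_le (by norm_num)] at hs
    rw [nrm s (by rw [abs_of_nonneg hs.1]; exact hs.2), abs_of_nonneg hs.1]
  have e2 : ∫ s in (1/2:ℝ)..1, Φ ((2 * ‖(s : Crc)‖ : ℝ) : Crc) = ∫ s in (1/2:ℝ)..1, Φ ((2 - 2 * s : ℝ) : Crc) := by
    refine intervalIntegral.integral_congr fun s hs => ?_
    rw [Set.uIcc_of_le (by norm_num)] at hs
    have : ((s : ℝ) : Crc) = ((s - 1 : ℝ) : Crc) := by rw [AddCircle.coe_sub, AddCircle.coe_period]; simp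
    have h3 : |s - 1| = 1 - s := by rw [abs_of_nonpos (by linarith [hs.2])]; ring
    rw [this, nrm (s - 1) (by rw [h3]; linarith [hs.1]), h3]
    congr 2; ring
  rw [e1, e2, intervalIntegral.integral_comp_mul_left (fun s : ℝ => Φ (s : Crc)) (by norm_num : (2:ℝ) ≠ 0),
    intervalIntegral.integral_comp_sub_mul (fun s : ℝ => Φ (s : Crc)) (by norm_num : (2:ℝ) ≠ 0),
    ← UnitAddCircle.intervalIntegral_preimage 0 Φ]
  norm_num
  ring

/-! ### File F: the G-map -/

def tent (s : ℝ) : ℝ := max 0 (1 - |s - 1|)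
def wv (L s : ℝ) : ℝ := 2 * ‖((L ^ 2 * max (1 / L) (min s 1) : ℝ) : Crc)‖

lemma tent_continuous : Continuous tent := by unfold tent; fun_prop
lemma wv_continuous (L) : Continuous (wv L) := by
  unfold wv
  exact continuous_const.mul (continuous_norm.comp (continuous_crc_coe.comp (by fun_prop)))
lemma tent_nonneg (s) : 0 ≤ tent s := le_max_left _ _
lemma tent_le (s) : tent s ≤ 1 := max_le zero_le_one (by linarith [abs_nonneg (s - 1)])
lemma tent_eq {s : ℝ} (h0 : 0 ≤ s) (h1 : s ≤ 1) : tent s = s := by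
  unfold tent
  rw [abs_of_nonpos (by linarith), max_eq_right (by linarith)]; ring
lemma tent_big {s : ℝ} (h : 2 ≤ s) : tent s = 0 := by
  unfold tent
  rw [abs_of_nonneg (by linarith), max_eq_left (by linarith)]
lemma crc_norm_le_half (y : Crc) : ‖y‖ ≤ 1 / 2 := by
  have := AddCircle.norm_le_half_period (p := (1:ℝ)) (x := y) (by norm_num)
  simpa using this
lemma wv_nonneg (L s) : 0 ≤ wv L s := by unfold wv; positivity
lemma wv_le (L s) : wv L s ≤ 1 := by
  unfold wv; linarith [crc_norm_le_half ((L ^ 2 * max (1 / L) (min s 1) : ℝ) : Crc)]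
lemma coe_nat_crc (n : ℕ) : ((n : ℝ) : Crc) = 0 := by
  have := AddCircle.coe_nsmul (p := (1:ℝ)) (n := n) (x := 1)
  rw [nsmul_eq_mul, mul_one] at this
  rw [this, AddCircle.coe_period, smul_zero]
lemma coe_int_crc (n : ℤ) : ((n : ℝ) : Crc) = 0 := by
  have := AddCircle.coe_zsmul (p := (1:ℝ)) (n := n) (x := 1)
  rw [zsmul_eq_mul, mul_one] at this
  rw [this, AddCircle.coe_period, smul_zero]
lemma wv_small {l : ℕ} (hl : 4 ≤ l) {s : ℝ} (h : s ≤ 1 / l) : wv l s = 0 := by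
  have hl' : (4:ℝ) ≤ l := by exact_mod_cast hl
  unfold wv
  rw [max_eq_left ((min_le_left _ _).trans h)]
  rw [show (l:ℝ)^2 * (1 / l) = l by field_simp, coe_nat_crc]; simp
lemma wv_big {l : ℕ} (hl : 4 ≤ l) {s : ℝ} (h : 1 ≤ s) : wv l s = 0 := by
  have hl' : (4:ℝ) ≤ l := by exact_mod_cast hl
  unfold wv
  rw [min_eq_right h, max_eq_right (by rw [div_le_one (by linarith)]; linarith)]
  rw [show (l:ℝ)^2 * 1 = ((l ^ 2 : ℕ) : ℝ) by push_cast; ring, coe_nat_crc]; simp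
lemma wv_mid {l : ℕ} {s : ℝ} (h : 1 / (l:ℝ) ≤ s) (h1 : s ≤ 1) :
    wv l s = 2 * ‖(((l:ℝ) ^ 2 * s : ℝ) : Crc)‖ := by
  unfold wv
  rw [min_eq_left h1, max_eq_right h]

def gb (l : ℕ) : C(Crc, ℝ) := per (fun z => min z (((l:ℝ) - 1) * (1 - z)) / l) (by fun_prop) (by
  rcases Nat.eq_zero_or_pos l with rfl | h
  · simp
  · have : (1:ℝ) ≤ l := by exact_mod_cast h
    simp [this])

def gf (l : ℕ) (hl : 4 ≤ l) (q : ℕ) : C(Crc, ℝ) :=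
  per (fun y => (- tent (l * y) + wv l (l * y) / l) / q)
    (by have := tent_continuous; have := wv_continuous l; fun_prop) (by
    have hl' : (4:ℝ) ≤ l := by exact_mod_cast hl
    rw [mul_zero, mul_one, tent_eq le_rfl zero_le_one, wv_small hl (by positivity), tent_big (by linarith), wv_big hl (by linarith)])

def gs (l : ℕ) (hl : 4 ≤ l) : C(Crc, ℝ) :=
  per (fun z => tent (l * z)) (by have := tent_continuous; fun_prop) (by
    have hl' : (4:ℝ) ≤ l := by exact_mod_cast hl
    rw [mul_zero, mul_one, tent_eq le_rfl zero_le_one, tent_big (by linarith)])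

lemma gb_zero (l) : gb l 0 = 0 := by
  rcases Nat.eq_zero_or_pos l with rfl | h
  · rw [gb, per_apply]; simp
  · have : (1:ℝ) ≤ l := by exact_mod_cast h
    rw [gb, per_apply, rep_zero]
    simp [this]
lemma gf_zero (l hl q) : gf l hl q 0 = 0 := by
  rw [gf, per_apply, rep_zero, mul_zero, tent_eq le_rfl zero_le_one, wv_small hl (by positivity)]; simp
lemma gs_zero (l hl) : gs l hl 0 = 0 := by
  rw [gs, per_apply, rep_zero, mul_zero, tent_eq le_rfl zero_le_one]

def GG (l : ℕ) (hl : 4 ≤ l) (q : ℕ) (p : Torus2) : Torus2 := ysh q (gs l hl) (xsh (gf l hl q) 0 (ysh q (gb l) p))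

lemma GG_CG (l hl q) : CG q (GG l hl q) :=
  .ys _ (gs_zero l hl) _ (.xs _ 0 (gf_zero l hl q) _ (.ys _ (gb_zero l) _ .one))

lemma gb_bd (l : ℕ) (hl : 4 ≤ l) (y) : 0 ≤ gb l y ∧ gb l y ≤ 1 / l := by
  have hl' : (4:ℝ) ≤ l := by exact_mod_cast hl
  have h0 := rep_nonneg y
  have h1 := rep_lt y
  rw [gb, per_apply]
  constructor
  · have : 0 ≤ min (rep y) (((l:ℝ) - 1) * (1 - rep y)) := le_min h0 (mul_nonneg (by linarith) (by linarith))
    positivity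
  · gcongr
    exact (min_le_left _ _).trans h1.le

lemma gf_far (l : ℕ) (hl : 4 ≤ l) (q : ℕ) (y : Crc) (h : 2 / l ≤ ‖y‖) : gf l hl q y = 0 := by
  have hl' : (4:ℝ) ≤ l := by exact_mod_cast hl
  have h1 : 2 ≤ l * rep y := by
    have := h.trans (norm_le_rep y)
    rw [div_le_iff₀ (by linarith)] at this
    linarith
  rw [gf, per_apply, tent_big h1, wv_big hl (by linarith)]; simp

lemma gs_far (l : ℕ) (hl : 4 ≤ l) (y : Crc) (h : 2 / l ≤ ‖y‖) : gs l hl y = 0 := by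
  have hl' : (4:ℝ) ≤ l := by exact_mod_cast hl
  have h1 : 2 ≤ l * rep y := by
    have := h.trans (norm_le_rep y)
    rw [div_le_iff₀ (by linarith)] at this
    linarith
  rw [gs, per_apply, tent_big h1]

lemma gf_bd (l : ℕ) (hl : 4 ≤ l) (q : ℕ) (hq : 0 < q) (y) : |gf l hl q y| ≤ 2 / q := by
  have hl' : (4:ℝ) ≤ l := by exact_mod_cast hl
  have hq' : (0:ℝ) < q := by exact_mod_cast hq
  rw [gf, per_apply, abs_div, abs_of_pos hq']
  gcongr
  have h1 := tent_nonneg (l * rep y)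
  have h2 := tent_le (l * rep y)
  have h3 := wv_nonneg l (l * rep y)
  have h4 := wv_le l (l * rep y)
  have h5 : wv l (l * rep y) / l ≤ 1 := by rw [div_le_one (by linarith)]; linarith
  have h6 : 0 ≤ wv l (l * rep y) / l := by positivity
  rw [abs_le]; constructor <;> linarith

lemma qsmul_div (q : ℕ) (hq : 0 < q) (z : ℝ) : q • ((z / q : ℝ) : Crc) = (z : Crc) := by
  rw [← AddCircle.coe_nsmul, nsmul_eq_mul]
  congr 1
  have hq' : (0:ℝ) < q := by exact_mod_cast hq
  field_simp

lemma GG_curve (l : ℕ) (hl : 4 ≤ l) (q : ℕ) (hq : 0 < q) (z : ℝ) (h0 : 0 ≤ z) (h1 : z ≤ 1 - 1 / l) :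
    (GG l hl q (((z / q : ℝ) : Crc), 0)).2 = ((wv l z + z / l : ℝ) : Crc) := by
  have hl' : (4:ℝ) ≤ l := by exact_mod_cast hl
  have hq' : (0:ℝ) < q := by exact_mod_cast hq
  have hi : 0 < 1 / (l:ℝ) := by positivity
  have e1 : gb l (q • ((z / q : ℝ) : Crc)) = z / l := by
    rw [qsmul_div q hq, gb, per_coe _ _ _ h0 (by linarith), min_eq_left]
    have : l * z ≤ l - 1 := by
      calc (l:ℝ) * z ≤ l * (1 - 1/l) := by gcongr
        _ = l - 1 := by field_simp
    nlinarith
  have hzl : z / l ≤ 1 := by rw [div_le_one (by linarith)]; linarith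
  have e2 : gf l hl q ((z / l : ℝ) : Crc) = (- z + wv l z / l) / q := by
    rw [gf, per_coe _ _ _ (by positivity) hzl]
    rw [show (l:ℝ) * (z / l) = z by field_simp, tent_eq h0 (by linarith)]
  have e3 : q • (((z / q : ℝ) : Crc) + (((- z + wv l z / l) / q : ℝ) : Crc)) = ((wv l z / l : ℝ) : Crc) := by
    rw [← AddCircle.coe_add, ← qsmul_div q hq (wv l z / l)]
    congr 2; ring
  have w0 := wv_nonneg l z
  have w1 := wv_le l z
  have e4 : gs l hl ((wv l z / l : ℝ) : Crc) = wv l z := by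
    rw [gs, per_coe _ _ _ (by positivity) (by rw [div_le_one (by linarith)]; linarith)]
    rw [show (l:ℝ) * (wv l z / l) = wv l z by field_simp, tent_eq w0 w1]
  simp only [GG, ysh, xsh, e1, zero_smul, add_zero, zero_add, e2, e3, e4]
  rw [← AddCircle.coe_add, add_comm]

lemma GG_dens (l : ℕ) (hl : 4 ≤ l) (q : ℕ) (hq : 0 < q) (y xs ys : Crc) :
    ∃ x, dist (GG l hl q (x, y)).2 ys ≤ 1 / l ∧ dist (GG l hl q (x, y)).1 xs ≤ 1 / q := by
  have hl' : (4:ℝ) ≤ l := by exact_mod_cast hl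
  have hq' : (0:ℝ) < q := by exact_mod_cast hq
  let D : ℝ → ℝ := fun x => gf l hl q (y + ((gb l (q • (x : Crc)) : ℝ) : Crc))
  have hD : Continuous D := by
    refine (gf l hl q).continuous.comp (continuous_const.add (continuous_crc_coe.comp ((gb l).continuous.comp ?_)))
    exact (continuous_nsmul q).comp continuous_crc_coe
  have hDb : ∀ x, |D x| ≤ 2 / q := fun x => gf_bd l hl q hq _
  have hsurj : Function.Surjective fun x => x + D x := by
    refine Continuous.surjective (continuous_id.add hD) ?_ ?_
    · refine tendsto_atTop_mono (f := fun x : ℝ => id x + -(2 / (q:ℝ))) (fun x => ?_) (tendsto_atTop_add_const_right _ _ tendsto_id)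
      have := (abs_le.1 (hDb x)).1
      simp only [id]; linarith
    · refine tendsto_atBot_mono (f := fun x : ℝ => id x + (2 / (q:ℝ))) (fun x => ?_) (tendsto_atBot_add_const_right _ _ tendsto_id)
      have := (abs_le.1 (hDb x)).2
      simp only [id]; linarith
  obtain ⟨xr, rfl⟩ : ∃ xr : ℝ, (xr : Crc) = xs := ⟨_, coe_rep xs⟩
  set w := rep (ys - y) with hw
  have w0 := rep_nonneg (ys - y)
  have w1 := rep_lt (ys - y)
  obtain ⟨x, hx⟩ := hsurj ((⌊(q:ℝ) * xr⌋ + w / l) / q)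
  simp only at hx
  have hwl : w / l ≤ 1 := by rw [div_le_one (by linarith)]; linarith
  have hG1 : (GG l hl q ((x : Crc), y)).1 = (((⌊(q:ℝ) * xr⌋ + w / l) / q : ℝ) : Crc) := by
    rw [← hx]
    simp only [GG, ysh, xsh, D, zero_smul, add_zero, AddCircle.coe_add]
  have hG2 : (GG l hl q ((x : Crc), y)).2 = ys + ((gb l (q • (x:Crc)) : ℝ) : Crc) := by
    have : (GG l hl q ((x : Crc), y)).2 = y + ((gb l (q • (x:Crc)) : ℝ) : Crc) + ((gs l hl (q • (GG l hl q ((x : Crc), y)).1) : ℝ) : Crc) := by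
      simp only [GG, ysh, xsh]
    rw [this, hG1, qsmul_div q hq, AddCircle.coe_add, coe_int_crc, zero_add, gs, per_coe _ _ _ (by positivity) hwl]
    rw [show (l:ℝ) * (w / l) = w by field_simp, tent_eq w0 w1.le, coe_rep]
    abel
  refine ⟨(x : Crc), ?_, ?_⟩
  · rw [hG2]
    have h := crc_dist_add_coe ys (gb l (q • (x:Crc))) 0
    rw [AddCircle.coe_zero, add_zero] at h
    refine h.trans ?_
    have := gb_bd l hl (q • (x:Crc))
    rw [sub_zero, abs_of_nonneg this.1]; exact this.2
  · rw [hG1]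
    have h := crc_dist_add_coe 0 ((⌊(q:ℝ) * xr⌋ + w / l) / q) xr
    rw [zero_add, zero_add] at h
    refine h.trans ?_
    have f1 := Int.floor_le ((q:ℝ) * xr)
    have f2 := Int.lt_floor_add_one ((q:ℝ) * xr)
    have h7 : 0 ≤ w / l := by positivity
    rw [show (⌊(q:ℝ) * xr⌋ + w / l) / q - xr = (⌊(q:ℝ) * xr⌋ + w / l - q * xr) / q by field_simp, abs_div, abs_of_pos hq']
    gcongr
    rw [abs_le]; constructor <;> linarith

lemma GG_far (l : ℕ) (hl : 4 ≤ l) (q : ℕ) (p : Torus2) (hy : 3 / l ≤ ‖p.2‖) (hx : 2 / l ≤ ‖q • p.1‖) :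
    GG l hl q p = ysh q (gb l) p := by
  have hb := gb_bd l hl (q • p.1)
  have e1 : gf l hl q (p.2 + ((gb l (q • p.1) : ℝ) : Crc)) = 0 := by
    apply gf_far
    have h1 := norm_sub_le (p.2 + ((gb l (q • p.1) : ℝ) : Crc)) ((gb l (q • p.1) : ℝ) : Crc)
    rw [add_sub_cancel_right] at h1
    have h2 := crc_norm_coe_le (gb l (q • p.1))
    rw [abs_of_nonneg hb.1] at h2
    have : 3 / (l:ℝ) = 2 / l + 1 / l := by ring
    linarith [hb.2]
  have e2 := gs_far l hl (q • p.1) hx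
  simp [GG, ysh, xsh, e1, e2]

lemma GG_dist (l : ℕ) (hl : 4 ≤ l) (q : ℕ) (p : Torus2) (hy : 3 / l ≤ ‖p.2‖) (hx : 2 / l ≤ ‖q • p.1‖) :
    dist (GG l hl q p) p ≤ 1 / l := by
  rw [GG_far l hl q p hy hx, Prod.dist_eq]
  have hb := gb_bd l hl (q • p.1)
  have h := crc_dist_add_coe p.2 (gb l (q • p.1)) 0
  rw [AddCircle.coe_zero, add_zero, sub_zero, abs_of_nonneg hb.1] at h
  exact max_le (by simp [ysh]) (h.trans hb.2)

/-- the G-lemma: existence of the map used at odd steps -/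
lemma G_lemma (r q : ℕ) (hr : 0 < r) (hq : 0 < q) (Φ : ℕ → C(Crc, ℝ)) (n : ℕ) (ε : ℝ) (hε : 0 < ε) :
    ∃ e : EMap, e.Good q ∧ (∀ t < r, ∫ p, |chi r t (e.h p) - chi r t p| ≤ ε) ∧
      (∀ j < n, ∀ Z > 0, |Z⁻¹ * (∫ z in (0:ℝ)..Z, Φ j (e.h ((z : Crc), 0)).2) - ∫ y, Φ j y| ≤ |Φ j 0 - ∫ y, Φ j y| + ε) ∧
      (∀ j < n, |(∫ z in (0:ℝ)..1, Φ j (e.h ((z : Crc), 0)).2) - ∫ y, Φ j y| ≤ ε) ∧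
      (∀ y xs ys : Crc, ∃ x, dist (e.h (x, y)).2 ys ≤ ε ∧ dist (e.h (x, y)).1 xs ≤ 1 / q + ε) := by
  have hq' : (0:ℝ) < q := by exact_mod_cast hq
  have hex : ∀ l : ℕ, ∃ e : EMap, e.Good q ∧ ∀ p, dist (e.h p) (GG (l + 4) (by omega) q p) ≤ 1 / (l + 4 : ℕ) :=
    fun l => (GG_CG (l + 4) (by omega) q).approx hq _ (by positivity)
  choose e he hd using hex
  have hlim : Tendsto (fun l : ℕ => 1 / ((l + 4 : ℕ) : ℝ)) atTop (𝓝 0) :=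
    (tendsto_const_div_atTop_nhds_zero_nat 1).comp (tendsto_add_atTop_nat 4)
  have ev : ∀ c > 0, ∀ᶠ l : ℕ in atTop, 1 / ((l + 4 : ℕ) : ℝ) < c := fun c hc => hlim.eventually (gt_mem_nhds hc)
  -- (a)
  have hA : ∀ t, ∀ᶠ l in atTop, ∫ p, |chi r t ((e l).h p) - chi r t p| ≤ ε := by
    intro t
    have := chi_lim r t (fun l => (e l).h) (fun l => (e l).h.continuous.measurable) id ?_ ?_ ?_
    · exact this.eventually (ge_mem_nhds hε)
    · have h1 := ae_snd (ae_nsmul_ne 1 one_pos)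
      have h2 := ae_fst (ae_nsmul_ne q hq)
      filter_upwards [h1, h2] with p h1 h2
      rw [one_smul] at h1
      rw [tendsto_iff_dist_tendsto_zero]
      refine squeeze_zero' (g := fun l : ℕ => 2 * (1 / ((l + 4 : ℕ) : ℝ))) (Eventually.of_forall fun _ => dist_nonneg) ?_ (by simpa using hlim.const_mul 2)
      filter_upwards [ev (‖p.2‖ / 3) (by positivity), ev (‖q • p.1‖ / 2) (by positivity)] with l h3 h4
      have h5 := GG_dist (l + 4) (by omega) q p (by rw [show (3:ℝ) / ((l + 4 : ℕ) : ℝ) = 3 * (1 / ((l + 4 : ℕ) : ℝ)) by ring]; linarith)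
        (by rw [show (2:ℝ) / ((l + 4 : ℕ) : ℝ) = 2 * (1 / ((l + 4 : ℕ) : ℝ)) by ring]; linarith)
      have := dist_triangle ((e l).h p) (GG (l + 4) (by omega) q p) p
      have := hd l p
      simp only [id]
      linarith
    · exact ae_snd (ae_nsmul_ne r hr)
    · exact Eventually.of_forall fun _ => rfl
  -- (d)
  have hD : ∀ j, ∀ᶠ l in atTop, (∀ Z > 0, |Z⁻¹ * (∫ z in (0:ℝ)..Z, Φ j ((e l).h ((z : Crc), 0)).2) - ∫ y, Φ j y| ≤ |Φ j 0 - ∫ y, Φ j y| + ε) ∧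
      |(∫ z in (0:ℝ)..1, Φ j ((e l).h ((z : Crc), 0)).2) - ∫ y, Φ j y| ≤ ε := by
    intro j
    set m := ∫ y, Φ j y with hm
    have hB : ∀ y, |Φ j y - m| ≤ ‖Φ j‖ + |m| := fun y => (abs_sub _ _).trans (add_le_add ((Φ j).norm_coe_le_norm y) le_rfl)
    set C := ‖Φ j‖ + |m| with hCdef
    have hC0 : 0 ≤ C := by positivity
    obtain ⟨η, hη, hmod⟩ := Metric.uniformContinuous_iff.1 (CompactSpace.uniformContinuous_of_continuous (Φ j).continuous) (ε/2) (by positivity)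
    have hCε : 0 < ε / (8 * (C + 1)) := by positivity
    filter_upwards [ev (η / 2) (by positivity), ev _ hCε] with l hl1 hl2
    set L : ℝ := ((l + 4 : ℕ) : ℝ) with hL
    have hL4 : 4 ≤ L := by rw [hL]; push_cast; linarith [(Nat.cast_nonneg l : (0:ℝ) ≤ l)]
    have hi0 : 0 < 1 / L := by positivity
    let v : ℝ → ℝ := fun z => Φ j ((e l).h (((z / q : ℝ) : Crc), 0)).2 - m
    let u : ℝ → ℝ := fun s => Φ j ((2 * ‖(s : Crc)‖ : ℝ) : Crc) - m
    have hvc0 : Continuous fun z : ℝ => Φ j ((e l).h ((z : Crc), 0)).2 := by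
      refine (Φ j).continuous.comp (continuous_snd.comp ((e l).h.continuous.comp (Continuous.prodMk ?_ continuous_const)))
      exact continuous_crc_coe
    have hv : Continuous v := (hvc0.comp (continuous_id.div_const _)).sub continuous_const
    have huc : Continuous fun s : ℝ => Φ j ((2 * ‖(s : Crc)‖ : ℝ) : Crc) :=
      (Φ j).continuous.comp (continuous_crc_coe.comp (continuous_const.mul (continuous_norm.comp continuous_crc_coe)))
    have hu : Continuous u := huc.sub continuous_const
    have hup : Function.Periodic u 1 := fun s => by
      simp only [u]; rw [AddCircle.coe_add, AddCircle.coe_period, add_zero]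
    have hvp : Function.Periodic v 1 := fun z => by
      simp only [v]
      have h1 := (he l).commT 1 (((z / q : ℝ) : Crc), 0)
      have h2 : ((((z + 1) / q : ℝ) : Crc), (0 : Crc)) = (((z / q : ℝ) : Crc), 0) + tv (((1:ℤ):ℝ) / q) := by
        simp [tv, add_div]
      rw [h2, h1]; simp [tv]
    have hu0 : ∫ s in (0:ℝ)..1, u s = 0 := by
      simp only [u]
      rw [intervalIntegral.integral_sub, tri_integral]
      · simp [hm]
      · exact huc.intervalIntegrable 0 1
      · simp
    have hcl : ∀ z, 0 ≤ z → z ≤ 1 - 1 / L → |Φ j ((e l).h (((z / q : ℝ) : Crc), 0)).2 - Φ j ((wv L z : ℝ) : Crc)| ≤ ε / 2 := by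
      intro z hz0 hz1
      have h1 := GG_curve (l + 4) (by omega) q hq z hz0 hz1
      have h2 : dist ((e l).h (((z / q : ℝ) : Crc), 0)).2 (((wv L z + z / L : ℝ)) : Crc) ≤ 1 / L := by
        rw [← h1]; exact (le_max_right _ _).trans (hd l _)
      have h3 : dist (((wv L z + z / L : ℝ)) : Crc) ((wv L z : ℝ) : Crc) ≤ 1 / L := by
        have := crc_dist_add_coe 0 (wv L z + z / L) (wv L z)
        simp only [zero_add] at this
        refine this.trans ?_
        rw [add_sub_cancel_left, abs_of_nonneg (by positivity)]
        gcongr; linarith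
      have h4 := dist_triangle ((e l).h (((z / q : ℝ) : Crc), 0)).2 (((wv L z + z / L : ℝ)) : Crc) ((wv L z : ℝ) : Crc)
      exact (hmod (by linarith)).le
    have h4C : 4 * C / L ≤ ε / 2 := by
      rw [show 4 * C / L = 4 * C * (1 / L) by ring]
      calc 4 * C * (1 / L) ≤ 4 * (C + 1) * (ε / (8 * (C + 1))) := by gcongr; linarith
        _ = ε / 2 := by field_simp; norm_num
    have key := avg_lemma v u hv hu hup hu0 C |Φ j 0 - m| (ε / 2) L hL4 (by positivity) (abs_nonneg _)
      (fun s => hB _) (fun s => hB _) ?_ ?_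
    · have key1 := per_ext v hv hvp _ key.1
      have cv : ∀ Z : ℝ, (∫ z in (0:ℝ)..Z, Φ j ((e l).h ((z : Crc), 0)).2) = Z * m + (q:ℝ)⁻¹ * ∫ s in (0:ℝ)..(q * Z), v s := by
        intro Z
        have h1 := intervalIntegral.integral_comp_mul_left (a := 0) (b := Z) v hq'.ne'
        have h2 : (fun x : ℝ => v (q * x)) = fun x : ℝ => Φ j ((e l).h ((x : Crc), 0)).2 - m := by
          funext x
          simp only [v]
          rw [mul_div_cancel_left₀ _ hq'.ne']
        rw [h2, intervalIntegral.integral_sub (hvc0.intervalIntegrable _ _) (by simp)] at h1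
        simp only [intervalIntegral.integral_const, smul_eq_mul, mul_zero, sub_zero] at h1
        linarith
      constructor
      · intro Z hZ
        have h1 := key1 (q * Z) (by positivity)
        rw [cv Z, show Z⁻¹ * (Z * m + (q:ℝ)⁻¹ * ∫ s in (0:ℝ)..(q * Z), v s) - m = (q * Z)⁻¹ * ∫ s in (0:ℝ)..(q * Z), v s by
          field_simp; ring, abs_mul, abs_of_pos (by positivity), inv_mul_le_iff₀ (by positivity)]
        refine h1.trans ?_
        rw [mul_comm]
        gcongr
        linarith
      · rw [cv 1, one_mul, add_sub_cancel_left, mul_one, abs_mul, abs_of_pos (by positivity), inv_mul_le_iff₀ hq']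
        have e1 : ∀ N : ℕ, ∫ s in (0:ℝ)..N, v s = N * ∫ s in (0:ℝ)..1, v s := by
          intro N
          induction N with
          | zero => simp
          | succ N ih =>
            rw [← intervalIntegral.integral_add_adjacent_intervals (hv.intervalIntegrable 0 N) (hv.intervalIntegrable _ _), ih]
            push_cast
            rw [hvp.intervalIntegral_add_eq N 0, zero_add]; ring
        rw [e1, abs_mul, abs_of_pos hq']
        have := key.2
        gcongr
        linarith
    · intro s h0 h1
      have h2 := hcl s h0 (by linarith [one_div_le_one_div_of_le (by norm_num) hL4])
      rw [wv_small (by omega) h1] at h2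
      simp only [AddCircle.coe_zero] at h2
      simp only [v]
      calc _ ≤ _ := abs_sub_le _ (Φ j 0) _
        _ ≤ _ := by linarith
    · intro s h0 h1
      have h2 := hcl s (by linarith) h1
      rw [wv_mid h0 (by linarith)] at h2
      simp only [v, u]
      rwa [sub_sub_sub_cancel_right]
  have hAll : ∀ᶠ l in atTop, (∀ t ∈ Finset.range r, ∫ p, |chi r t ((e l).h p) - chi r t p| ≤ ε) ∧
      (∀ j ∈ Finset.range n, (∀ Z > 0, |Z⁻¹ * (∫ z in (0:ℝ)..Z, Φ j ((e l).h ((z : Crc), 0)).2) - ∫ y, Φ j y| ≤ |Φ j 0 - ∫ y, Φ j y| + ε) ∧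
      |(∫ z in (0:ℝ)..1, Φ j ((e l).h ((z : Crc), 0)).2) - ∫ y, Φ j y| ≤ ε) ∧ 1 / ((l + 4 : ℕ) : ℝ) < ε / 2 :=
    ((Finset.eventually_all _).2 fun t _ => hA t).and (((Finset.eventually_all _).2 fun j _ => hD j).and (ev _ (by positivity)))
  obtain ⟨l, h1, h2, h3⟩ := hAll.exists
  refine ⟨e l, he l, fun t ht => h1 t (Finset.mem_range.2 ht), fun j hj => (h2 j (Finset.mem_range.2 hj)).1,
    fun j hj => (h2 j (Finset.mem_range.2 hj)).2, fun y xs ys => ?_⟩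
  obtain ⟨x, hx1, hx2⟩ := GG_dens (l + 4) (by omega) q hq y xs ys
  refine ⟨x, ?_, ?_⟩
  · have := dist_triangle ((e l).h (x, y)).2 (GG (l + 4) (by omega) q (x, y)).2 ys
    have := (le_max_right _ _).trans (hd l (x, y))
    linarith
  · have := dist_triangle ((e l).h (x, y)).1 (GG (l + 4) (by omega) q (x, y)).1 xs
    have := (le_max_left _ _).trans (hd l (x, y))
    linarith

/-! ### File M: step shears and the belt map -/

lemma exists_step (N : ℕ) (hN : 0 < N) (A : ℤ → ℤ) (hp : ∀ i, A (i + N) = A i) (h01 : ∀ i, A i = 0 ∨ A i = 1)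
    (hA0 : A 0 = 0) (c : ℝ) :
    ∃ f : ℕ → C(Crc, ℝ), (∀ k, f k 0 = 0) ∧
      (A (-1) = 0 → ∀ k, ∀ a : ℝ, 0 ≤ a → a ≤ 1 → f k ((-a / N : ℝ) : Crc) = 0) ∧
      (∀ k y, ∃ a : ℝ, 0 ≤ a ∧ a ≤ 1 ∧ f k y = c * a) ∧
      ∀ o : ℝ, 0 < o → o < 1 → ∀ᶠ k in atTop, ∀ R : ℤ, f k (((R + o) / N : ℝ) : Crc) = c * A R := by
  have hN' : (0:ℝ) < N := by exact_mod_cast hN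
  let w : ℝ → ℝ := fun u => (A ⌊u⌋ : ℝ)
  have hw0 : ∀ u, 0 ≤ w u := fun u => by rcases h01 ⌊u⌋ with h | h <;> simp [w, h]
  have hw1 : ∀ u, w u ≤ 1 := fun u => by rcases h01 ⌊u⌋ with h | h <;> simp [w, h]
  have hwm : Measurable w := (measurable_from_top (f := fun n : ℤ => (A n : ℝ))).comp Int.measurable_floor
  have hwi : ∀ a b : ℝ, IntervalIntegrable w volume a b := fun a b => by
    refine (intervalIntegrable_const (c := (1:ℝ))).mono_fun hwm.aestronglyMeasurable (Eventually.of_forall fun u => ?_)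
    show |w u| ≤ |(1:ℝ)|
    rw [abs_of_nonneg (hw0 u), abs_one]; exact hw1 u
  let P : ℝ → ℝ := fun s => ∫ u in (0:ℝ)..s, w u
  have hP : Continuous P := intervalIntegral.continuous_primitive hwi 0
  have hPd : ∀ a b, P b - P a = ∫ u in a..b, w u := fun a b => intervalIntegral.integral_interval_sub_left (hwi _ _) (hwi _ _)
  have hconst : ∀ (R : ℤ) (a b : ℝ), a ≤ b → R ≤ a → b ≤ R + 1 → P b - P a = (b - a) * A R := by
    intro R a b hab ha hb
    rw [hPd, intervalIntegral.integral_congr_ae (g := fun _ => (A R : ℝ))]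
    · simp
    · have : ∀ᵐ u : ℝ, u ≠ R + 1 := by rw [ae_iff]; simp
      filter_upwards [this] with u hu hu'
      rw [Set.uIoc_of_le hab] at hu'
      have : ⌊u⌋ = R := Int.floor_eq_iff.2 ⟨by linarith [hu'.1], lt_of_le_of_ne (by linarith [hu'.2]) hu⟩
      simp only [w, this]
  let κ : ℕ → ℝ := fun k => (k:ℝ) + 1
  have hκ : ∀ k, 0 < κ k := fun k => by positivity
  let g : ℕ → ℝ → ℝ := fun k t => c * (κ k * (P (N * t + 1 / κ k) - P (N * t)))
  have hgc : ∀ k, Continuous (g k) := fun k => by simp only [g]; fun_prop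
  have hgp : ∀ k, Function.Periodic (g k) 1 := fun k t => by
    simp only [g]
    congr 2
    rw [hPd, hPd, mul_add, mul_one, add_right_comm, ← intervalIntegral.integral_comp_add_right]
    congr 1; funext u
    simp only [w]
    rw [show u + (N:ℝ) = u + ((N:ℤ):ℝ) by simp, Int.floor_add_intCast, hp]
  refine ⟨fun k => perFun (g k) (hgc k) (hgp k), ?_, ?_, ?_, ?_⟩
  · intro k
    have : perFun (g k) (hgc k) (hgp k) ((0:ℝ) : Crc) = g k 0 := rfl
    rw [AddCircle.coe_zero] at this
    rw [this]
    simp only [g]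
    have h1 : 1 / κ k ≤ 1 := by rw [div_le_one (hκ k)]; simp only [κ]; linarith [(Nat.cast_nonneg k : (0:ℝ) ≤ k)]
    rw [hconst 0 _ _ (by have := hκ k; simp; positivity) (by simp) (by simpa using h1), hA0]; simp
  · intro hA1 k a ha0 ha1
    have : perFun (g k) (hgc k) (hgp k) ((-a/N:ℝ) : Crc) = g k (-a/N) := rfl
    rw [this]
    simp only [g]
    have h1 : 1 / κ k ≤ 1 := by rw [div_le_one (hκ k)]; simp only [κ]; linarith [(Nat.cast_nonneg k : (0:ℝ) ≤ k)]
    have h2 : 0 < 1 / κ k := by have := hκ k; positivity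
    rw [show (N:ℝ) * (-a / N) = -a by field_simp]
    have z : ∀ b : ℝ, -1 ≤ b → b ≤ 0 → P 0 - P b = 0 := fun b hb hb' => by
      rw [hconst (-1) b 0 hb' (by simpa using hb) (by simp), hA1]; simp
    have z' : ∀ b : ℝ, 0 ≤ b → b ≤ 1 → P b - P 0 = 0 := fun b hb hb' => by
      rw [hconst 0 0 b hb (by simp) (by simpa using hb'), hA0]; simp
    have e1 := z (-a) (by linarith) (by linarith)
    rcases le_total (-a + 1 / κ k) 0 with h | h
    · have e2 := z _ (by linarith) h
      rw [show P (-a + 1 / κ k) - P (-a) = 0 by linarith]; simp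
    · have e2 := z' _ h (by linarith)
      rw [show P (-a + 1 / κ k) - P (-a) = 0 by linarith]; simp
  · intro k y
    obtain ⟨t, rfl⟩ : ∃ t : ℝ, (t : Crc) = y := ⟨_, coe_rep y⟩
    have hk := hκ k
    have h2 : 0 < 1 / κ k := by positivity
    refine ⟨κ k * (P (N * t + 1 / κ k) - P (N * t)), ?_, ?_, rfl⟩
    · rw [hPd]
      have := intervalIntegral.integral_nonneg (μ := volume) (f := w) (by linarith : N * t ≤ N * t + 1 / κ k) fun u _ => hw0 u
      positivity
    · rw [hPd]
      have := intervalIntegral.integral_mono_on (μ := volume) (f := w) (g := fun _ => 1) (by linarith : N * t ≤ N * t + 1 / κ k)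
        (hwi _ _) (by simp) fun u _ => hw1 u
      rw [intervalIntegral.integral_const, add_sub_cancel_left, smul_eq_mul, mul_one] at this
      calc _ ≤ κ k * (1 / κ k) := by gcongr
        _ = 1 := by field_simp
  · intro o ho0 ho1
    have hlim : Tendsto (fun k : ℕ => 1 / κ k) atTop (𝓝 0) := tendsto_one_div_add_atTop_nhds_zero_nat
    filter_upwards [hlim.eventually (gt_mem_nhds (by linarith : 0 < 1 - o))] with k hk R
    have : perFun (g k) (hgc k) (hgp k) (((R + o)/N:ℝ) : Crc) = g k ((R + o)/N) := rfl
    rw [this]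
    simp only [g]
    have h2 : 0 < 1 / κ k := by have := hκ k; positivity
    rw [show (N:ℝ) * ((R + o) / N) = R + o by field_simp, hconst R _ _ (by linarith) (by linarith) (by linarith)]
    have := hκ k
    field_simp
    ring

def bpt (N1 N2 q : ℕ) (p0 : Torus2) (s : ℤ × ℤ) : Torus2 :=
  (p0.1 + (((s.1 : ℝ) / (N1 * q) : ℝ) : Crc), p0.2 + (((s.2 : ℝ) / N2 : ℝ) : Crc))

/-- the discrete commutator step -/
def dstep (A S : ℤ → ℤ) (s : ℤ × ℤ) : ℤ × ℤ :=
  let i1 := s.1 - A s.2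
  let R2 := s.2 - S i1
  let i3 := i1 + A R2
  (i3, R2 + S i3)

lemma exists_phi (N1 N2 q : ℕ) (h1 : 0 < N1) (h2 : 0 < N2) (hq : 0 < q) (A S : ℤ → ℤ)
    (hAp : ∀ i, A (i + N2) = A i) (hA01 : ∀ i, A i = 0 ∨ A i = 1) (hA0 : A 0 = 0) (hA1 : A (-1) = 0)
    (hSp : ∀ i, S (i + N1) = S i) (hS01 : ∀ i, S i = 0 ∨ S i = 1) (hS0 : S 0 = 0) :
    ∃ φ : ℕ → Torus2 → Torus2, (∀ k, CG q (φ k)) ∧ (∀ k x, φ k (x, 0) = (x, 0)) ∧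
      ∀ (p0 : Torus2) (ζ o : ℝ), 0 < ζ → ζ < 1 → 0 < o → o < 1 → q • p0.1 = ((ζ / N1 : ℝ) : Crc) → p0.2 = ((o / N2 : ℝ) : Crc) →
        ∀ᶠ k in atTop, ∀ s, φ k (bpt N1 N2 q p0 s) = bpt N1 N2 q p0 (dstep A S s) := by
  have hq' : (0:ℝ) < q := by exact_mod_cast hq
  have h1' : (0:ℝ) < N1 := by exact_mod_cast h1
  have h2' : (0:ℝ) < N2 := by exact_mod_cast h2
  obtain ⟨f, hf0, hf1, -, hf⟩ := exists_step N2 h2 A hAp hA01 hA0 (1 / (N1 * q))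
  obtain ⟨σ, hσ0, -, hσ1, hσ⟩ := exists_step N1 h1 S hSp hS01 hS0 (1 / N2)
  refine ⟨fun k p => ysh q (σ k) (xsh (f k) 0 (ysh q (-σ k) (xsh (-f k) 0 p))), ?_, ?_, ?_⟩
  · intro k
    exact .ys _ (hσ0 k) _ (.xs _ 0 (hf0 k) _ (.ys _ (by simp [hσ0]) _ (.xs _ 0 (by simp [hf0]) _ .one)))
  · intro k x
    obtain ⟨a, ha0, ha1, ha⟩ := hσ1 k (q • x)
    have e : f k (((-(1 / N2 * a) : ℝ)) : Crc) = 0 := by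
      rw [show (-(1 / N2 * a) : ℝ) = -a / N2 by ring]
      exact hf1 hA1 k a ha0 ha1
    simp [ysh, xsh, hf0, ha] at e ⊢
    rw [e]
    simp [ha]
  · intro p0 ζ o hζ0 hζ1 ho0 ho1 hx hy
    filter_upwards [hf o ho0 ho1, hσ ζ hζ0 hζ1] with k hfk hσk s
    have X : ∀ i R : ℤ, f k (bpt N1 N2 q p0 (i, R)).2 = 1 / (N1 * q) * A R := by
      intro i R
      rw [← hfk R]
      simp only [bpt]
      rw [hy, ← AddCircle.coe_add]; congr 2; ring
    have Y : ∀ i R : ℤ, σ k (q • (bpt N1 N2 q p0 (i, R)).1) = 1 / N2 * S i := by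
      intro i R
      rw [← hσk i]
      simp only [bpt]
      rw [smul_add, hx, show ((i:ℝ) / (N1 * q)) = ((i:ℝ) / N1) / q by field_simp, qsmul_div q hq, ← AddCircle.coe_add]; congr 2; ring
    have X1 : ∀ i R : ℤ, xsh (f k) 0 (bpt N1 N2 q p0 (i, R)) = bpt N1 N2 q p0 (i + A R, R) := by
      intro i R
      simp only [xsh]
      rw [X i R]
      simp only [bpt, zero_smul, add_zero, add_assoc, ← AddCircle.coe_add]
      congr 3
      push_cast; ring
    have X2 : ∀ i R : ℤ, xsh (-f k) 0 (bpt N1 N2 q p0 (i, R)) = bpt N1 N2 q p0 (i - A R, R) := by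
      intro i R
      simp only [xsh, ContinuousMap.neg_apply]
      rw [X i R]
      simp only [bpt, zero_smul, add_zero, add_assoc, ← AddCircle.coe_add]
      congr 3
      push_cast; ring
    have Y1 : ∀ i R : ℤ, ysh q (σ k) (bpt N1 N2 q p0 (i, R)) = bpt N1 N2 q p0 (i, R + S i) := by
      intro i R
      simp only [ysh]
      rw [Y i R]
      simp only [bpt, add_assoc, ← AddCircle.coe_add]
      congr 3
      push_cast; ring
    have Y2 : ∀ i R : ℤ, ysh q (-σ k) (bpt N1 N2 q p0 (i, R)) = bpt N1 N2 q p0 (i, R - S i) := by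
      intro i R
      simp only [ysh, ContinuousMap.neg_apply]
      rw [Y i R]
      simp only [bpt, add_assoc, ← AddCircle.coe_add]
      congr 3
      push_cast; ring
    obtain ⟨i, R⟩ := s
    rw [X2, Y2, X1, Y1]
    rfl

/-! ### belt combinatorics; `m = μ + 3`, `P = 2 μ + 3` -/

def beltA (μ : ℕ) (R : ℤ) : ℤ := if 1 ≤ R % (μ + 3) ∧ R % (μ + 3) ≤ μ + 1 then 1 else 0
def beltS (μ : ℕ) (c : ℕ) (i : ℤ) : ℤ := if 4 * μ + 6 + 2 * c ≤ i % (8 * μ + 12) ∧ (i % (8 * μ + 12)) % 2 = 0 then 1 else 0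

lemma beltA_ev (μ : ℕ) (t ρ : ℤ) (h0 : -1 ≤ ρ) (h1 : ρ < μ + 3) :
    beltA μ (t * (μ + 3) + ρ) = if 1 ≤ ρ ∧ ρ ≤ μ + 1 then 1 else 0 := by
  unfold beltA
  rcases h0.lt_or_eq with h | rfl
  · have : (t * (μ + 3) + ρ) % (μ + 3 : ℤ) = ρ := by
      rw [add_comm, Int.add_mul_emod_self_right, Int.emod_eq_of_lt (by omega) h1]
    rw [this]
  · have : (t * (μ + 3) + -1) % (μ + 3 : ℤ) = μ + 2 := by
      rw [show t * ((μ:ℤ) + 3) + -1 = (μ + 2) + (t - 1) * (μ + 3) by ring, Int.add_mul_emod_self_right, Int.emod_eq_of_lt (by omega) (by omega)]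
    rw [this, if_neg (by omega), if_neg (by omega)]

lemma beltS_ev (μ c : ℕ) (i : ℤ) (h0 : -1 ≤ i) (h1 : i < 8 * μ + 12) :
    beltS μ c i = if 4 * μ + 6 + 2 * c ≤ i ∧ i % 2 = 0 then 1 else 0 := by
  unfold beltS
  rcases h0.lt_or_eq with h | rfl
  · rw [Int.emod_eq_of_lt (by omega) h1]
  · have : (-1) % (8 * μ + 12 : ℤ) = 8 * μ + 11 := by
      rw [show (-1:ℤ) = (8 * μ + 11) + (-1) * (8 * μ + 12) by ring, Int.add_mul_emod_self_right, Int.emod_eq_of_lt (by omega) (by omega)]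
    rw [this, if_neg (by omega), if_neg (by omega)]

lemma dstep_ev (μ c : ℕ) (t e ρ a s a2 s2 : ℤ) (he0 : 0 ≤ e) (he1 : e < 8 * μ + 12) (h0 : 0 ≤ ρ) (h1 : ρ < μ + 3)
    (ha : a = if 1 ≤ ρ ∧ ρ ≤ μ + 1 then 1 else 0)
    (hs : s = if 4 * μ + 6 + 2 * c ≤ e - a ∧ (e - a) % 2 = 0 then 1 else 0)
    (ha2 : a2 = if 1 ≤ ρ - s ∧ ρ - s ≤ μ + 1 then 1 else 0)
    (hs2 : s2 = if 4 * μ + 6 + 2 * c ≤ e - a + a2 ∧ (e - a + a2) % 2 = 0 then 1 else 0) :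
    dstep (beltA μ) (beltS μ c) (e, t * (μ + 3) + ρ) = (e - a + a2, t * (μ + 3) + (ρ - s + s2)) := by
  have ha' : a = 0 ∨ a = 1 := by rw [ha]; split_ifs <;> simp
  have hs' : s = 0 ∨ s = 1 := by rw [hs]; split_ifs <;> simp
  have ha2' : a2 = 0 ∨ a2 = 1 := by rw [ha2]; split_ifs <;> simp
  have e1 : beltA μ (t * (μ + 3) + ρ) = a := by rw [beltA_ev μ t ρ (by omega) h1, ha]
  have e2 : beltS μ c (e - a) = s := by rw [beltS_ev μ c _ (by omega) (by omega), hs]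
  have e3 : beltA μ (t * (μ + 3) + ρ - s) = a2 := by
    rw [add_sub_assoc, beltA_ev μ t _ (by omega) (by omega), ha2]
  have hlt : e - a + a2 < 8 * μ + 12 := by
    by_contra hcon
    have : e = 8 * μ + 11 := by omega
    have ha0 : a = 0 := by omega
    have ha21 : a2 = 1 := by omega
    have hs0 : s = 0 := by rw [hs, if_neg (by omega)]
    rw [hs0, sub_zero, ← ha] at ha2
    omega
  have e4 : beltS μ c (e - a + a2) = s2 := by rw [beltS_ev μ c _ (by omega) hlt, hs2]
  simp only [dstep, e1, e2, e3, e4]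
  congr 1; ring

/-- belt position -/
def bel (μ : ℕ) (θ : ℤ) : ℤ × ℤ := if θ < μ + 2 then (0, θ + 1) else (1, 2 * μ + 3 - θ)

lemma dstep_move (μ c : ℕ) (t j θ : ℤ) (hj : c ≤ j) (hj1 : j < 2 * μ + 3) (h0 : 0 ≤ θ) (h1 : θ < 2 * μ + 3) :
    dstep (beltA μ) (beltS μ c) (4 * μ + 6 + 2 * j + (bel μ θ).1, t * (μ + 3) + (bel μ θ).2) =
      (4 * μ + 6 + 2 * j + (bel μ ((θ + 1) % (2 * μ + 3))).1, t * (μ + 3) + (bel μ ((θ + 1) % (2 * μ + 3))).2) := by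
  have hm : (θ + 1) % (2 * μ + 3 : ℤ) = if θ = 2 * μ + 2 then 0 else θ + 1 := by
    split_ifs with h
    · rw [h, show (2 * (μ:ℤ) + 2 + 1) = 2 * μ + 3 by ring, Int.emod_self]
    · exact Int.emod_eq_of_lt (by omega) (by omega)
  rw [hm]
  rcases lt_or_ge θ (μ + 1) with c1 | c1
  · simp only [bel, if_pos (show θ < μ + 2 by omega), if_neg (show ¬ θ = 2 * μ + 2 by omega), if_pos (show θ + 1 < (μ:ℤ) + 2 by omega)]
    rw [dstep_ev μ c t _ _ 1 0 1 1 (by omega) (by omega) (by omega) (by omega) (by rw [if_pos (by omega)]) (by rw [if_neg (by omega)])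
      (by rw [if_pos (by omega)]) (by rw [if_pos (by omega)])]
    congr 1 <;> ring
  · rcases c1.eq_or_lt with c2 | c2
    · simp only [bel, if_pos (show θ < μ + 2 by omega), if_neg (show ¬ θ = 2 * μ + 2 by omega), if_neg (show ¬ θ + 1 < (μ:ℤ) + 2 by omega)]
      rw [dstep_ev μ c t _ _ 0 1 1 0 (by omega) (by omega) (by omega) (by omega) (by rw [if_neg (by omega)]) (by rw [if_pos (by omega)])
        (by rw [if_pos (by omega)]) (by rw [if_neg (by omega)])]
      congr 1 <;> [ring; (subst c2; ring)]
    · rcases lt_or_ge θ (2 * μ + 2) with c3 | c3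
      · simp only [bel, if_neg (show ¬ θ < μ + 2 by omega), if_neg (show ¬ θ = 2 * μ + 2 by omega), if_neg (show ¬ θ + 1 < (μ:ℤ) + 2 by omega)]
        rw [dstep_ev μ c t _ _ 1 1 1 0 (by omega) (by omega) (by omega) (by omega) (by rw [if_pos (by omega)]) (by rw [if_pos (by omega)])
          (by rw [if_pos (by omega)]) (by rw [if_neg (by omega)])]
        congr 1 <;> ring
      · obtain rfl : θ = 2 * μ + 2 := by omega
        simp only [bel, if_neg (show ¬ (2 * μ + 2 : ℤ) < μ + 2 by omega), if_true, if_pos (show (0:ℤ) < μ + 2 by omega)]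
        rw [dstep_ev μ c t _ _ 1 1 0 1 (by omega) (by omega) (by omega) (by omega) (by rw [if_pos (by omega)]) (by rw [if_pos (by omega)])
          (by rw [if_neg (by omega)]) (by rw [if_pos (by omega)])]
        congr 1 <;> ring

lemma dstep_fix (μ c : ℕ) (t e ρ : ℤ) (he0 : 0 ≤ e) (he1 : e < 8 * μ + 12) (h0 : 0 ≤ ρ) (h1 : ρ < μ + 3)
    (h : e < 4 * μ + 6 + 2 * c ∨ ρ = 0 ∨ (ρ = μ + 2 ∧ e % 2 = 1)) :
    dstep (beltA μ) (beltS μ c) (e, t * (μ + 3) + ρ) = (e, t * (μ + 3) + ρ) := by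
  rcases h with h | h | h
  · by_cases c1 : 1 ≤ ρ ∧ ρ ≤ μ + 1
    · rw [dstep_ev μ c t _ _ 1 0 1 0 he0 he1 h0 h1 (by rw [if_pos c1]) (by rw [if_neg (by omega)]) (by rw [if_pos (by omega)]) (by rw [if_neg (by omega)])]
      congr 1 <;> ring
    · rw [dstep_ev μ c t _ _ 0 0 0 0 he0 he1 h0 h1 (by rw [if_neg c1]) (by rw [if_neg (by omega)]) (by rw [if_neg (by omega)]) (by rw [if_neg (by omega)])]
      congr 1 <;> ring
  · by_cases c1 : 4 * μ + 6 + 2 * c ≤ e ∧ e % 2 = 0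
    · rw [dstep_ev μ c t _ _ 0 1 0 1 he0 he1 h0 h1 (by rw [if_neg (by omega)]) (by rw [if_pos (by omega)]) (by rw [if_neg (by omega)]) (by rw [if_pos (by omega)])]
      congr 1 <;> ring
    · rw [dstep_ev μ c t _ _ 0 0 0 0 he0 he1 h0 h1 (by rw [if_neg (by omega)]) (by rw [if_neg (by omega)]) (by rw [if_neg (by omega)]) (by rw [if_neg (by omega)])]
      congr 1 <;> ring
  · rw [dstep_ev μ c t _ _ 0 0 0 0 he0 he1 h0 h1 (by rw [if_neg (by omega)]) (by rw [if_neg (by omega)]) (by rw [if_neg (by omega)]) (by rw [if_neg (by omega)])]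
    congr 1 <;> ring

def Dst (μ : ℕ) : ℕ → ℤ × ℤ → ℤ × ℤ
  | 0, s => s
  | c + 1, s => dstep (beltA μ) (beltS μ (c + 1)) (Dst μ c s)

lemma Dst_fix (μ c : ℕ) (t e ρ : ℤ) (he0 : 0 ≤ e) (he1 : e < 8 * μ + 12) (h0 : 0 ≤ ρ) (h1 : ρ < μ + 3)
    (h : e < 4 * μ + 6 ∨ ρ = 0 ∨ (ρ = μ + 2 ∧ e % 2 = 1)) :
    Dst μ c (e, t * (μ + 3) + ρ) = (e, t * (μ + 3) + ρ) := by
  induction c with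
  | zero => rfl
  | succ c ih =>
    rw [Dst, ih, dstep_fix μ (c+1) t e ρ he0 he1 h0 h1]
    omega

lemma Dst_move (μ c : ℕ) (t θ : ℤ) (j : ℕ) (hj1 : j < 2 * μ + 3) (h0 : 0 ≤ θ) (h1 : θ < 2 * μ + 3) :
    Dst μ c (4 * μ + 6 + 2 * j + (bel μ θ).1, t * (μ + 3) + (bel μ θ).2) =
      (4 * μ + 6 + 2 * j + (bel μ ((θ + (min c j : ℕ)) % (2 * μ + 3))).1, t * (μ + 3) + (bel μ ((θ + (min c j : ℕ)) % (2 * μ + 3))).2) := by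
  induction c with
  | zero => simp [Dst, Int.emod_eq_of_lt h0 h1]
  | succ c ih =>
    rw [Dst, ih]
    set θ' := (θ + (min c j : ℕ)) % (2 * μ + 3 : ℤ) with hθ'
    have b0 : 0 ≤ θ' := Int.emod_nonneg _ (by omega)
    have b1 : θ' < 2 * μ + 3 := Int.emod_lt_of_pos _ (by omega)
    rcases lt_or_ge j (c + 1) with h | h
    · have : min (c + 1) j = min c j := by omega
      rw [this, ← hθ']
      apply dstep_fix
      · unfold bel; split_ifs <;> simp <;> omega
      · unfold bel; split_ifs <;> simp <;> omega
      · unfold bel; split_ifs <;> simp <;> omega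
      · unfold bel; split_ifs <;> simp <;> omega
      · left; unfold bel; split_ifs <;> simp <;> omega
    · rw [dstep_move μ (c+1) t j θ' (by exact_mod_cast h) (by exact_mod_cast hj1) b0 b1]
      have : (θ' + 1) % (2 * μ + 3 : ℤ) = (θ + (min (c+1) j : ℕ)) % (2 * μ + 3 : ℤ) := by
        rw [hθ', Int.emod_add_emod, show min (c+1) j = min c j + 1 by omega]
        push_cast; congr 1; ring
      rw [this]

lemma bel_surj (μ : ℕ) (b ρ : ℤ) (hb : b = 0 ∨ b = 1) (h0 : 1 ≤ ρ) (h1 : ρ < μ + 3) (h : ¬ (ρ = μ + 2 ∧ b = 1)) :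
    ∃ θ : ℤ, 0 ≤ θ ∧ θ < 2 * μ + 3 ∧ bel μ θ = (b, ρ) := by
  rcases hb with rfl | rfl
  · exact ⟨ρ - 1, by omega, by omega, by unfold bel; rw [if_pos (by omega)]; simp⟩
  · exact ⟨2 * μ + 3 - ρ, by omega, by omega, by unfold bel; rw [if_neg (by omega)]; simp⟩

lemma bel_bd (μ : ℕ) (θ : ℤ) (h0 : 0 ≤ θ) (h1 : θ < 2 * μ + 3) :
    0 ≤ (bel μ θ).1 ∧ (bel μ θ).1 ≤ 1 ∧ 1 ≤ (bel μ θ).2 ∧ (bel μ θ).2 < μ + 3 := by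
  unfold bel; split_ifs <;> simp <;> omega

/-- general bounds: cell displacement at most one, strip preserved -/
lemma Dst_bd (μ c : ℕ) (t e ρ : ℤ) (he0 : 0 ≤ e) (he1 : e < 8 * μ + 12) (h0 : 0 ≤ ρ) (h1 : ρ < μ + 3) :
    |(Dst μ c (e, t * (μ + 3) + ρ)).1 - e| ≤ 1 ∧
    ∃ ρ' : ℤ, 0 ≤ ρ' ∧ ρ' < μ + 3 ∧ (Dst μ c (e, t * (μ + 3) + ρ)).2 = t * (μ + 3) + ρ' := by
  by_cases h : e < 4 * μ + 6 ∨ ρ = 0 ∨ (ρ = μ + 2 ∧ e % 2 = 1)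
  · rw [Dst_fix μ c t e ρ he0 he1 h0 h1 h]
    exact ⟨by simp, ρ, h0, h1, rfl⟩
  · obtain ⟨j, b, hb, hj, rfl⟩ : ∃ (j : ℕ) (b : ℤ), (b = 0 ∨ b = 1) ∧ j < 2 * μ + 3 ∧ e = 4 * μ + 6 + 2 * j + b :=
      ⟨((e - (4 * μ + 6)) / 2).toNat, (e - (4 * μ + 6)) % 2, by omega, by omega, by omega⟩
    obtain ⟨θ, t0, t1, hθ⟩ := bel_surj μ b ρ hb (by omega) h1 (by omega)
    have e1 : b = (bel μ θ).1 := by rw [hθ]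
    have e2 : ρ = (bel μ θ).2 := by rw [hθ]
    have hD := Dst_move μ c t θ j hj t0 t1
    rw [← e1, ← e2] at hD
    rw [hD]
    have b0 : 0 ≤ (θ + (min c j : ℕ)) % (2 * μ + 3 : ℤ) := Int.emod_nonneg _ (by omega)
    have b1 : (θ + (min c j : ℕ)) % (2 * μ + 3 : ℤ) < 2 * μ + 3 := Int.emod_lt_of_pos _ (by omega)
    have := bel_bd μ _ b0 b1
    refine ⟨?_, _, by omega, this.2.2.2, rfl⟩
    simp only
    rw [abs_le]; constructor <;> omega

lemma exists_belt (μ r q : ℕ) (hr : 0 < r) (hq : 0 < q) (c : ℕ) :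
    ∃ φ : ℕ → Torus2 → Torus2, (∀ k, CG q (φ k)) ∧ (∀ k x, φ k (x, 0) = (x, 0)) ∧
      ∀ (p0 : Torus2) (ζ o : ℝ), 0 < ζ → ζ < 1 → 0 < o → o < 1 → q • p0.1 = ((ζ / (8 * μ + 12 : ℕ) : ℝ) : Crc) →
        p0.2 = ((o / (r * (μ + 3) : ℕ) : ℝ) : Crc) →
        ∀ᶠ k in atTop, ∀ s, φ k (bpt (8 * μ + 12) (r * (μ + 3)) q p0 s) = bpt (8 * μ + 12) (r * (μ + 3)) q p0 (Dst μ c s) := by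
  induction c with
  | zero => exact ⟨fun _ p => p, fun _ => .one, fun _ _ => rfl, fun _ _ _ _ _ _ _ _ _ => Eventually.of_forall fun _ _ => rfl⟩
  | succ c ih =>
    obtain ⟨φ, h1, h2, h3⟩ := ih
    obtain ⟨ψ, k1, k2, k3⟩ := exists_phi (8 * μ + 12) (r * (μ + 3)) q (by omega) (by positivity) hq (beltA μ) (beltS μ (c + 1))
      (fun i => by
        unfold beltA
        have : (i + ((r * (μ + 3) : ℕ) : ℤ)) % ((μ:ℤ) + 3) = i % (μ + 3) := by
          push_cast; rw [Int.add_mul_emod_self_right]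
        rw [this])
      (fun i => by unfold beltA; split_ifs <;> simp)
      (by have := beltA_ev μ 0 0 (by omega) (by omega); simpa using this)
      (by have := beltA_ev μ 0 (-1) (by omega) (by omega); simpa using this)
      (fun i => by
        unfold beltS
        have : (i + ((8 * μ + 12 : ℕ) : ℤ)) % (8 * (μ:ℤ) + 12) = i % (8 * μ + 12) := by
          push_cast; rw [Int.add_emod_right]
        rw [this])
      (fun i => by unfold beltS; split_ifs <;> simp)
      (by rw [beltS_ev μ (c+1) 0 (by omega) (by omega), if_neg (by omega)])
    refine ⟨fun k p => ψ k (φ k p), fun k => (k1 k).comp (h1 k), fun k x => by simp only [h2, k2], ?_⟩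
    intro p0 ζ o a1 a2 a3 a4 a5 a6
    filter_upwards [h3 p0 ζ o a1 a2 a3 a4 a5 a6, k3 p0 ζ o a1 a2 a3 a4 a5 a6] with k b1 b2 s
    rw [b1, b2, Dst]

/-! ### File O: cell integrals -/

instance crc_prob : IsProbabilityMeasure (volume : Measure UnitAddCircle) := ⟨by simp⟩
instance torus_prob : IsProbabilityMeasure (volume : Measure (UnitAddCircle × UnitAddCircle)) :=
  inferInstanceAs (IsProbabilityMeasure ((volume : Measure UnitAddCircle).prod (volume : Measure UnitAddCircle)))

lemma mp_int {X Y : Type*} [MeasurableSpace X] [MeasurableSpace Y] {μ : Measure X} {ν : Measure Y} {g : X → Y} (hg : MeasurePreserving g μ ν) {f : Y → ℝ} (hf : AEStronglyMeasurable f ν) :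
    ∫ x, f (g x) ∂μ = ∫ y, f y ∂ν := by
  rw [← hg.map_eq, integral_map hg.measurable.aemeasurable (by rw [hg.map_eq]; exact hf)]

lemma crc_int (f : Crc → ℝ) : ∫ z : Crc, f z = ∫ t in (0:ℝ)..1, f (t : Crc) := by
  have := UnitAddCircle.intervalIntegral_preimage 0 f
  simpa using this.symm

/-- cell indicator -/
def cind (N i : ℕ) (z : Crc) : ℝ := if ⌊(N:ℝ) * rep z⌋₊ = i then 1 else 0

lemma cind_measurable (N i : ℕ) : Measurable (cind N i) := by
  unfold cind
  refine Measurable.ite ?_ measurable_const measurable_const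
  have : Measurable (fun z : Crc => ⌊(N : ℝ) * rep z⌋₊) :=
    Nat.measurable_floor.comp (rep_measurable.const_mul _)
  exact this (measurableSet_singleton i)

lemma cind_nonneg (N i z) : 0 ≤ cind N i z := by unfold cind; split_ifs <;> simp
lemma cind_le_one (N i z) : cind N i z ≤ 1 := by unfold cind; split_ifs <;> simp

lemma cell_lt (N : ℕ) (hN : 0 < N) (z : Crc) : ⌊(N:ℝ) * rep z⌋₊ < N := by
  have hN' : (0:ℝ) < N := by exact_mod_cast hN
  rw [Nat.floor_lt (mul_nonneg hN'.le (rep_nonneg z))]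
  nlinarith [rep_lt z]

lemma cell_meas (N : ℕ) (hN : 0 < N) (i : ℕ) (hi : i < N) : ∫ z : Crc, cind N i z = (N:ℝ)⁻¹ := by
  have hN' : (0:ℝ) < N := by exact_mod_cast hN
  rw [crc_int, intervalIntegral.integral_of_le zero_le_one, integral_Ioc_eq_integral_Ioo, ← integral_Ico_eq_integral_Ioo]
  have e : ∀ t ∈ Set.Ico (0:ℝ) 1, cind N i (t : Crc) = (Set.Ico ((i:ℝ) / N) ((i + 1) / N)).indicator (fun _ => (1:ℝ)) t := by
    intro t ht
    unfold cind
    rw [rep_coe ht.1 ht.2, Set.indicator_apply]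
    congr 1
    rw [Nat.floor_eq_iff (mul_nonneg hN'.le ht.1), Set.mem_Ico, div_le_iff₀ hN', lt_div_iff₀ hN', mul_comm t]
  rw [setIntegral_congr_fun measurableSet_Ico e, integral_indicator measurableSet_Ico, Measure.restrict_restrict measurableSet_Ico]
  have hs : Set.Ico ((i:ℝ) / N) ((i + 1) / N) ∩ Set.Ico 0 1 = Set.Ico ((i:ℝ) / N) ((i + 1) / N) := by
    rw [Set.inter_eq_left]
    apply Set.Ico_subset_Ico (by positivity)
    rw [div_le_one hN']; exact_mod_cast hi
  rw [hs]
  simp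
  rw [max_eq_left (by rw [← sub_div]; simp), ← sub_div]; simp

lemma cells2 (N1 N2 q : ℕ) (h1 : 0 < N1) (h2 : 0 < N2) (hq : 0 < q) (Q : ℕ → ℕ → ℝ) :
    Integrable (fun p : Torus2 => Q ⌊(N1:ℝ) * rep (q • p.1)⌋₊ ⌊(N2:ℝ) * rep p.2⌋₊) ∧
    ∫ p : Torus2, Q ⌊(N1:ℝ) * rep (q • p.1)⌋₊ ⌊(N2:ℝ) * rep p.2⌋₊ =
      ((N1:ℝ) * N2)⁻¹ * ∑ i ∈ Finset.range N1, ∑ R ∈ Finset.range N2, Q i R := by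
  have e : (fun p : Torus2 => Q ⌊(N1:ℝ) * rep (q • p.1)⌋₊ ⌊(N2:ℝ) * rep p.2⌋₊) = fun p : Torus2 =>
      ∑ i ∈ Finset.range N1, ∑ R ∈ Finset.range N2, Q i R * (cind N1 i (q • p.1) * cind N2 R p.2) := by
    funext p
    rw [Finset.sum_eq_single ⌊(N1:ℝ) * rep (q • p.1)⌋₊, Finset.sum_eq_single ⌊(N2:ℝ) * rep p.2⌋₊]
    · simp [cind]
    · intro b _ hb; simp [cind, hb.symm]
    · intro h; exact absurd (Finset.mem_range.2 (cell_lt N2 h2 _)) h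
    · intro b _ hb; simp [cind, hb.symm]
    · intro h; exact absurd (Finset.mem_range.2 (cell_lt N1 h1 _)) h
  have hi1 : ∀ i, Integrable (fun x : Crc => cind N1 i (q • x)) := fun i =>
    Integrable.of_bound ((cind_measurable N1 i).comp (nsmul_mp q hq).measurable).aestronglyMeasurable 1
      (Eventually.of_forall fun x => by rw [Real.norm_eq_abs, abs_of_nonneg (cind_nonneg _ _ _)]; exact cind_le_one _ _ _)
  have hi2 : ∀ i, Integrable (fun x : Crc => cind N2 i x) := fun i =>
    Integrable.of_bound (cind_measurable N2 i).aestronglyMeasurable 1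
      (Eventually.of_forall fun x => by rw [Real.norm_eq_abs, abs_of_nonneg (cind_nonneg _ _ _)]; exact cind_le_one _ _ _)
  have hii : ∀ i R, Integrable (fun p : Torus2 => Q i R * (cind N1 i (q • p.1) * cind N2 R p.2)) := fun i R =>
    ((hi1 i).mul_prod (hi2 R)).const_mul _
  rw [e]
  refine ⟨integrable_finsetSum _ fun i _ => integrable_finsetSum _ fun R _ => hii i R, ?_⟩
  rw [integral_finsetSum _ fun i _ => integrable_finsetSum _ fun R _ => hii i R, Finset.mul_sum]
  refine Finset.sum_congr rfl fun i hi => ?_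
  rw [integral_finsetSum _ fun R _ => hii i R, Finset.mul_sum]
  refine Finset.sum_congr rfl fun R hR => ?_
  rw [integral_const_mul]
  have := integral_prod_mul (μ := (volume : Measure Crc)) (ν := (volume : Measure Crc)) (fun x => cind N1 i (q • x)) (fun y => cind N2 R y)
  have e3 : ∫ p : Torus2, cind N1 i (q • p.1) * cind N2 R p.2 = (N1:ℝ)⁻¹ * (N2:ℝ)⁻¹ := by
    refine this.trans ?_
    rw [cell_meas N2 h2 R (Finset.mem_range.1 hR), ← cell_meas N1 h1 i (Finset.mem_range.1 hi)]
    congr 1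
    exact mp_int (nsmul_mp q hq) (cind_measurable N1 i).aestronglyMeasurable
  rw [e3, mul_inv]; ring

lemma cells_approx (N1 N2 q : ℕ) (h1 : 0 < N1) (h2 : 0 < N2) (hq : 0 < q) (Q : ℕ → ℕ → ℝ) (W : Torus2 → ℝ) (hW : Integrable W)
    (ω : ℝ) (h : ∀ᵐ p : Torus2, |W p - Q ⌊(N1:ℝ) * rep (q • p.1)⌋₊ ⌊(N2:ℝ) * rep p.2⌋₊| ≤ ω) :
    |(∫ p, W p) - ((N1:ℝ) * N2)⁻¹ * ∑ i ∈ Finset.range N1, ∑ R ∈ Finset.range N2, Q i R| ≤ ω := by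
  obtain ⟨a, b⟩ := cells2 N1 N2 q h1 h2 hq Q
  rw [← b, ← integral_sub hW a]
  have := norm_integral_le_of_norm_le_const (μ := (volume : Measure Torus2))
    (f := fun p => W p - Q ⌊(N1:ℝ) * rep (q • p.1)⌋₊ ⌊(N2:ℝ) * rep p.2⌋₊) h
  simpa using this

/-- strip sums -/
lemma strip_sum (r m t : ℕ) (ht : t < r) (f : ℕ → ℝ) :
    ∑ R ∈ Finset.range (r * m), (if R / m = t then f R else 0) = ∑ ρ ∈ Finset.range m, f (t * m + ρ) := by
  rcases Nat.eq_zero_or_pos m with rfl | hm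
  · simp
  rw [← Finset.sum_filter]
  have : (Finset.range (r * m)).filter (fun R => R / m = t) = (Finset.range m).image (fun ρ => t * m + ρ) := by
    ext R
    simp only [Finset.mem_filter, Finset.mem_range, Finset.mem_image]
    constructor
    · rintro ⟨h, rfl⟩
      exact ⟨R % m, Nat.mod_lt _ hm, Nat.div_add_mod' R m⟩
    · rintro ⟨ρ, hρ, rfl⟩
      refine ⟨?_, ?_⟩
      · calc t * m + ρ < (t + 1) * m := by rw [add_mul]; omega
          _ ≤ r * m := Nat.mul_le_mul_right _ ht
      · rw [add_comm, Nat.add_mul_div_right _ _ hm, Nat.div_eq_of_lt hρ, zero_add]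
  rw [this, Finset.sum_image (by intro a _ b _ h; simpa using h)]

lemma chi_eq (r m t : ℕ) (hm : 0 < m) (p : Torus2) :
    chi r t p = if ⌊((r * m : ℕ):ℝ) * rep p.2⌋₊ / m = t then 1 else 0 := by
  unfold chi
  congr 2
  have : (r:ℝ) * rep p.2 = ((r * m : ℕ):ℝ) * rep p.2 / m := by
    have : (0:ℝ) < m := by exact_mod_cast hm
    push_cast; field_simp
  rw [this, Nat.floor_div_natCast]

/-! ### File P: discrete belt averages -/

lemma cyc_sum (P : ℕ) (hP : 0 < P) (g : ℤ → ℝ) (θ : ℕ) :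
    ∑ j ∈ Finset.range P, g ((θ + j : ℤ) % P) = ∑ j ∈ Finset.range P, g j := by
  induction θ with
  | zero =>
    refine Finset.sum_congr rfl fun j hj => ?_
    have := Finset.mem_range.1 hj
    congr 1
    push_cast
    rw [zero_add]
    exact Int.emod_eq_of_lt (by omega) (by omega)
  | succ θ ih =>
    rw [← ih]
    have h1 := Finset.sum_range_succ (fun j : ℕ => g ((θ + j : ℤ) % P)) P
    have h2 := Finset.sum_range_succ' (fun j : ℕ => g ((θ + j : ℤ) % P)) P
    have h3 : ((θ : ℤ) + P) % P = (θ + (0:ℕ)) % P := by simp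
    rw [h3] at h1
    have h4 : ∑ j ∈ Finset.range P, g (((θ + 1 : ℕ) + j : ℤ) % P) = ∑ j ∈ Finset.range P, g ((θ + (j + 1 : ℕ) : ℤ) % P) := by
      refine Finset.sum_congr rfl fun j _ => ?_
      congr 2; push_cast; ring
    rw [h4]
    linarith

lemma sum_pairs (P : ℕ) (g : ℕ → ℝ) : ∑ i ∈ Finset.range (2 * P), g i = ∑ j ∈ Finset.range P, (g (2 * j) + g (2 * j + 1)) := by
  induction P with
  | zero => simp
  | succ P ih => rw [Finset.sum_range_succ, ← ih, mul_add, mul_one, Finset.sum_range_succ, Finset.sum_range_succ]; ring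

lemma bel_sum (μ : ℕ) (f : ℤ → ℝ) :
    ∑ θ ∈ Finset.range (2 * μ + 3), f (bel μ θ).2 = 2 * ∑ ρ ∈ Finset.range (μ + 3), f ρ - (2 * f 0 + f (μ + 2)) := by
  have e : 2 * μ + 3 = (μ + 2) + (μ + 1) := by ring
  rw [e, Finset.sum_range_add]
  have h1 : ∑ x ∈ Finset.range (μ + 2), f (bel μ x).2 = ∑ x ∈ Finset.range (μ + 2), f ((x + 1 : ℕ) : ℤ) := by
    refine Finset.sum_congr rfl fun x hx => ?_
    have := Finset.mem_range.1 hx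
    rw [bel, if_pos (by omega)]; simp
  have h2 : ∑ x ∈ Finset.range (μ + 1), f (bel μ ((μ + 2 + x : ℕ) : ℤ)).2 = ∑ x ∈ Finset.range (μ + 1), f ((x + 1 : ℕ) : ℤ) := by
    rw [← Finset.sum_range_reflect]
    refine Finset.sum_congr rfl fun x hx => ?_
    have := Finset.mem_range.1 hx
    rw [bel, if_neg (by omega)]
    congr 1
    simp only
    omega
  rw [h1, h2]
  have h3 := Finset.sum_range_succ' (fun x : ℕ => f (x : ℤ)) (μ + 2)
  have h4 := Finset.sum_range_succ (fun x : ℕ => f ((x + 1 : ℕ) : ℤ)) (μ + 1)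
  have h5 : f ((μ + 1 + 1 : ℕ) : ℤ) = f (μ + 2) := by congr 1
  simp only [Nat.cast_zero] at h3
  rw [h5] at h4
  rw [show μ + 3 = μ + 2 + 1 by ring, h3]
  linarith

lemma col_avg (μ t : ℕ) (ρ : ℕ) (h0 : 1 ≤ ρ) (h1 : ρ ≤ μ + 1) (f : ℤ → ℝ) (B : ℝ) (hB : ∀ a, |f a| ≤ B) :
    |((4 * μ + 6 : ℕ) : ℝ)⁻¹ * ∑ i ∈ Finset.range (4 * μ + 6), f (Dst μ (2 * μ + 2) ((4 * μ + 6 + i : ℕ), (t * (μ + 3) + ρ : ℕ))).2 -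
      ((μ + 3 : ℕ) : ℝ)⁻¹ * ∑ ρ' ∈ Finset.range (μ + 3), f ((t * (μ + 3) + ρ' : ℕ) : ℤ)| ≤ 6 * B / (μ + 3 : ℕ) := by
  have hB0 : 0 ≤ B := (abs_nonneg _).trans (hB 0)
  set S := ∑ ρ' ∈ Finset.range (μ + 3), f ((t * (μ + 3) + ρ' : ℕ) : ℤ) with hS
  have key : ∀ b : ℕ, b ≤ 1 → ∑ j ∈ Finset.range (2 * μ + 3), f (Dst μ (2 * μ + 2) ((4 * μ + 6 + (2 * j + b) : ℕ), (t * (μ + 3) + ρ : ℕ))).2 =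
      2 * S - (2 * f (t * (μ + 3)) + f (t * (μ + 3) + (μ + 2))) := by
    intro b hb
    obtain ⟨θ, t0, t1, hθ⟩ := bel_surj μ b ρ (by omega) (by omega) (by omega) (by omega)
    lift θ to ℕ using t0
    have := bel_sum μ (fun a => f (t * (μ + 3) + a))
    rw [hS]
    push_cast
    simp only [add_zero] at this
    rw [← this]
    have h2 := cyc_sum (2 * μ + 3) (by omega) (fun a => f (t * (μ + 3) + (bel μ a).2)) θ
    rw [← h2]
    refine Finset.sum_congr rfl fun j hj => ?_
    have hj' := Finset.mem_range.1 hj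
    have hD := Dst_move μ (2 * μ + 2) t θ j hj' (by omega) t1
    rw [hθ, min_eq_right (by omega : j ≤ 2 * μ + 2)] at hD
    simp only at hD
    rw [add_assoc] at hD
    rw [hD]
    push_cast
    rfl
  have e1 : ∑ i ∈ Finset.range (4 * μ + 6), f (Dst μ (2 * μ + 2) ((4 * μ + 6 + i : ℕ), (t * (μ + 3) + ρ : ℕ))).2 =
      2 * (2 * S - (2 * f (t * (μ + 3)) + f (t * (μ + 3) + (μ + 2)))) := by
    rw [show 4 * μ + 6 = 2 * (2 * μ + 3) by ring, sum_pairs, Finset.sum_add_distrib]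
    have k0 := key 0 (by omega)
    have k1 := key 1 (by omega)
    rw [show 4 * μ + 6 = 2 * (2 * μ + 3) by ring] at k0 k1
    simp only [add_zero] at k0
    rw [k0, k1]; ring
  rw [e1]
  have hS' : |S| ≤ (μ + 3) * B := by
    refine (Finset.abs_sum_le_sum_abs _ _).trans ((Finset.sum_le_sum fun _ _ => hB _).trans ?_)
    simp
  set E := 2 * f (t * (μ + 3)) + f (t * (μ + 3) + (μ + 2))
  have hE : |E| ≤ 3 * B := by
    have a1 := abs_le.1 (hB (t * (μ + 3)))
    have a2 := abs_le.1 (hB (t * (μ + 3) + (μ + 2)))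
    rw [abs_le]; constructor <;> simp only [E] <;> linarith
  have e2 : ((4 * μ + 6 : ℕ) : ℝ)⁻¹ * (2 * (2 * S - E)) - ((μ + 3 : ℕ) : ℝ)⁻¹ * S = (3 * S / (μ + 3) - E) / (2 * μ + 3) := by
    push_cast
    rw [show (4 * μ + 6 : ℝ) = 2 * (2 * μ + 3) by ring]
    field_simp
    ring
  rw [e2, abs_div, abs_of_pos (by positivity : (0:ℝ) < 2 * μ + 3)]
  have h3 : |3 * S / (μ + 3) - E| ≤ 6 * B := by
    refine (abs_sub _ _).trans ?_
    rw [abs_div, abs_mul, abs_of_pos (by positivity : (0:ℝ) < (μ:ℝ) + 3), abs_of_pos (by norm_num : (0:ℝ) < 3)]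
    have : 3 * |S| / (μ + 3) ≤ 3 * B := by rw [div_le_iff₀ (by positivity)]; nlinarith
    linarith
  push_cast
  gcongr
  linarith [(Nat.cast_nonneg μ : (0:ℝ) ≤ μ)]

lemma half_sum (μ t : ℕ) (S : ℤ → ℤ → ℝ) (B : ℝ) (hB : ∀ a b, |S a b| ≤ B) :
    |(((4 * μ + 6 : ℕ) : ℝ) * (μ + 3 : ℕ))⁻¹ * ∑ i ∈ Finset.range (4 * μ + 6), ∑ ρ ∈ Finset.range (μ + 3),
        S (Dst μ (2 * μ + 2) ((4 * μ + 6 + i : ℕ), (t * (μ + 3) + ρ : ℕ))).2 (t * (μ + 3) + ρ : ℕ) -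
      (((μ + 3 : ℕ) : ℝ) * (μ + 3 : ℕ))⁻¹ * ∑ ρ ∈ Finset.range (μ + 3), ∑ ρ' ∈ Finset.range (μ + 3),
        S (t * (μ + 3) + ρ' : ℕ) (t * (μ + 3) + ρ : ℕ)| ≤ 10 * B / (μ + 3 : ℕ) := by
  have hB0 : 0 ≤ B := (abs_nonneg _).trans (hB 0 0)
  set m : ℕ := μ + 3 with hm
  have hm0 : (0:ℝ) < m := by positivity
  have hP0 : (0:ℝ) < (4 * μ + 6 : ℕ) := by positivity
  let X : ℕ → ℝ := fun ρ => ((4 * μ + 6 : ℕ) : ℝ)⁻¹ * ∑ i ∈ Finset.range (4 * μ + 6), S (Dst μ (2 * μ + 2) ((4 * μ + 6 + i : ℕ), (t * m + ρ : ℕ))).2 (t * m + ρ : ℕ) -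
      (m : ℝ)⁻¹ * ∑ ρ' ∈ Finset.range m, S (t * m + ρ' : ℕ) (t * m + ρ : ℕ)
  have e : (((4 * μ + 6 : ℕ) : ℝ) * m)⁻¹ * ∑ i ∈ Finset.range (4 * μ + 6), ∑ ρ ∈ Finset.range m,
        S (Dst μ (2 * μ + 2) ((4 * μ + 6 + i : ℕ), (t * m + ρ : ℕ))).2 (t * m + ρ : ℕ) -
      ((m : ℝ) * m)⁻¹ * ∑ ρ ∈ Finset.range m, ∑ ρ' ∈ Finset.range m,
        S (t * m + ρ' : ℕ) (t * m + ρ : ℕ) = (m:ℝ)⁻¹ * ∑ ρ ∈ Finset.range m, X ρ := by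
    rw [Finset.sum_comm]
    simp only [X, Finset.sum_sub_distrib, ← Finset.mul_sum, mul_sub, mul_inv]
    ring
  rw [e]
  have hX1 : ∀ ρ, |X ρ| ≤ 2 * B := fun ρ => by
    have a1 : |((4 * μ + 6 : ℕ) : ℝ)⁻¹ * ∑ i ∈ Finset.range (4 * μ + 6), S (Dst μ (2 * μ + 2) ((4 * μ + 6 + i : ℕ), (t * m + ρ : ℕ))).2 (t * m + ρ : ℕ)| ≤ B := by
      rw [abs_mul, abs_of_pos (inv_pos.2 hP0), inv_mul_le_iff₀ hP0]
      refine (Finset.abs_sum_le_sum_abs _ _).trans ((Finset.sum_le_sum fun _ _ => hB _ _).trans ?_)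
      rw [Finset.sum_const, Finset.card_range, nsmul_eq_mul]
    have a2 : |(m : ℝ)⁻¹ * ∑ ρ' ∈ Finset.range m, S (t * m + ρ' : ℕ) (t * m + ρ : ℕ)| ≤ B := by
      rw [abs_mul, abs_of_pos (inv_pos.2 hm0), inv_mul_le_iff₀ hm0]
      refine (Finset.abs_sum_le_sum_abs _ _).trans ((Finset.sum_le_sum fun _ _ => hB _ _).trans ?_)
      rw [Finset.sum_const, Finset.card_range, nsmul_eq_mul]
    exact (abs_sub _ _).trans (by linarith)
  have hX2 : ∀ ρ, 1 ≤ ρ → ρ ≤ μ + 1 → |X ρ| ≤ 6 * B / m := fun ρ h0 h1 =>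
    col_avg μ t ρ h0 h1 (fun a => S a (t * m + ρ : ℕ)) B (fun a => hB a _)
  have hs : ∑ ρ ∈ Finset.range m, |X ρ| ≤ 10 * B := by
    rw [hm, Finset.sum_range_succ, show μ + 2 = (μ + 1) + 1 by ring, Finset.sum_range_succ']
    have : ∑ k ∈ Finset.range (μ + 1), |X (k + 1)| ≤ ∑ k ∈ Finset.range (μ + 1), 6 * B / m :=
      Finset.sum_le_sum fun k hk => hX2 _ (by omega) (by have := Finset.mem_range.1 hk; omega)
    rw [Finset.sum_const, Finset.card_range, nsmul_eq_mul] at this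
    have h6 : ((μ + 1 : ℕ):ℝ) * (6 * B / m) ≤ 6 * B := by
      rw [mul_div_assoc', div_le_iff₀ hm0]
      have : ((μ + 1 : ℕ):ℝ) ≤ m := by rw [hm]; push_cast; linarith
      nlinarith
    linarith [hX1 0, hX1 (μ + 1 + 1)]
  rw [abs_mul, abs_of_pos (inv_pos.2 hm0), inv_mul_le_iff₀ hm0, mul_div_cancel₀ _ hm0.ne']
  exact (Finset.abs_sum_le_sum_abs _ _).trans hs

lemma belt_sum (μ t : ℕ) (S : ℤ → ℤ → ℝ) (B : ℝ) (hB : ∀ a b, |S a b| ≤ B) :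
    |(((8 * μ + 12 : ℕ) : ℝ) * (μ + 3 : ℕ))⁻¹ * ∑ i ∈ Finset.range (8 * μ + 12), ∑ ρ ∈ Finset.range (μ + 3),
        S (Dst μ (2 * μ + 2) (((i + (4 * μ + 6)) % (8 * μ + 12) : ℕ), (t * (μ + 3) + ρ : ℕ))).2
          (Dst μ (2 * μ + 2) ((i : ℕ), (t * (μ + 3) + ρ : ℕ))).2 -
      (((μ + 3 : ℕ) : ℝ) * (μ + 3 : ℕ))⁻¹ * ∑ ρ ∈ Finset.range (μ + 3), ∑ ρ' ∈ Finset.range (μ + 3),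
        S (t * (μ + 3) + ρ' : ℕ) (t * (μ + 3) + ρ : ℕ)| ≤ 10 * B / (μ + 3 : ℕ) := by
  have h1 := half_sum μ t S B hB
  have h2 := half_sum μ t (fun a b => S b a) B (fun a b => hB b a)
  rw [Finset.sum_comm (s := Finset.range (μ + 3))] at h2
  have hfix : ∀ i < 4 * μ + 6, ∀ ρ < μ + 3, (Dst μ (2 * μ + 2) ((i : ℕ), (t * (μ + 3) + ρ : ℕ))) = (((i : ℕ) : ℤ), ((t * (μ + 3) + ρ : ℕ) : ℤ)) := by
    intro i hi ρ hρ
    have := Dst_fix μ (2 * μ + 2) t i ρ (by omega) (by omega) (by omega) (by omega) (Or.inl (by omega))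
    push_cast
    exact this
  have e : ∑ i ∈ Finset.range (8 * μ + 12), ∑ ρ ∈ Finset.range (μ + 3),
        S (Dst μ (2 * μ + 2) (((i + (4 * μ + 6)) % (8 * μ + 12) : ℕ), (t * (μ + 3) + ρ : ℕ))).2
          (Dst μ (2 * μ + 2) ((i : ℕ), (t * (μ + 3) + ρ : ℕ))).2 =
      (∑ i ∈ Finset.range (4 * μ + 6), ∑ ρ ∈ Finset.range (μ + 3),
        S (Dst μ (2 * μ + 2) ((4 * μ + 6 + i : ℕ), (t * (μ + 3) + ρ : ℕ))).2 (t * (μ + 3) + ρ : ℕ)) +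
      ∑ i ∈ Finset.range (4 * μ + 6), ∑ ρ ∈ Finset.range (μ + 3),
        S (t * (μ + 3) + ρ : ℕ) (Dst μ (2 * μ + 2) ((4 * μ + 6 + i : ℕ), (t * (μ + 3) + ρ : ℕ))).2 := by
    rw [show Finset.range (8 * μ + 12) = Finset.range ((4 * μ + 6) + (4 * μ + 6)) by congr 1; ring, Finset.sum_range_add]
    congr 1
    · refine Finset.sum_congr rfl fun i hi => Finset.sum_congr rfl fun ρ hρ => ?_
      have hi := Finset.mem_range.1 hi
      have hρ := Finset.mem_range.1 hρ
      rw [hfix i hi ρ hρ, Nat.mod_eq_of_lt (by omega), add_comm i]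
    · refine Finset.sum_congr rfl fun i hi => Finset.sum_congr rfl fun ρ hρ => ?_
      have hi := Finset.mem_range.1 hi
      have hρ := Finset.mem_range.1 hρ
      have : (4 * μ + 6 + i + (4 * μ + 6)) % (8 * μ + 12) = i := by
        rw [show 4 * μ + 6 + i + (4 * μ + 6) = i + (8 * μ + 12) by ring, Nat.add_mod_right, Nat.mod_eq_of_lt (by omega)]
      rw [this, hfix i hi ρ hρ]
  rw [e]
  have e3 : ((8 * μ + 12 : ℕ) : ℝ) = 2 * (4 * μ + 6 : ℕ) := by push_cast; ring
  rw [e3, mul_assoc, mul_inv, mul_add]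
  rw [abs_le] at *
  constructor <;> linarith [h1.1, h1.2, h2.1, h2.2]

/-! ### File Q: the limiting belt map -/

def ccol (μ q : ℕ) (p : Torus2) : ℕ := ⌊((8 * μ + 12 : ℕ) : ℝ) * rep (q • p.1)⌋₊
def crow (μ r : ℕ) (p : Torus2) : ℕ := ⌊((r * (μ + 3) : ℕ) : ℝ) * rep p.2⌋₊
def dD (μ r q : ℕ) (p : Torus2) : ℤ × ℤ := Dst μ (2 * μ + 2) (((ccol μ q p : ℕ) : ℤ), ((crow μ r p : ℕ) : ℤ))
def Ginf (μ r q : ℕ) (p : Torus2) : Torus2 :=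
  (p.1 + (((((dD μ r q p).1 : ℝ) - (ccol μ q p : ℝ)) / ((8 * μ + 12 : ℕ) * q) : ℝ) : Crc),
   p.2 + (((((dD μ r q p).2 : ℝ) - (crow μ r p : ℝ)) / (r * (μ + 3) : ℕ) : ℝ) : Crc))

lemma ccol_measurable (μ q : ℕ) (hq : 0 < q) : Measurable (ccol μ q) :=
  Nat.measurable_floor.comp (((rep_measurable.comp ((nsmul_mp q hq).measurable)).comp measurable_fst).const_mul _)
lemma crow_measurable (μ r : ℕ) : Measurable (crow μ r) :=
  Nat.measurable_floor.comp ((rep_measurable.comp measurable_snd).const_mul _)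

lemma meas_shift (a : Torus2 → Crc) (ha : Measurable a) (n : Torus2 → ℕ × ℕ) (hn : Measurable n) (f : ℕ × ℕ → Crc) :
    Measurable fun p => a p + f (n p) := ha.add ((measurable_of_countable f).comp hn)

lemma Ginf_measurable (μ r q : ℕ) (hq : 0 < q) : Measurable (Ginf μ r q) := by
  have h : Measurable fun p => (ccol μ q p, crow μ r p) := (ccol_measurable μ q hq).prodMk (crow_measurable μ r)
  have h1 := meas_shift Prod.fst measurable_fst _ h
    (fun s => (((((Dst μ (2 * μ + 2) ((s.1 : ℤ), (s.2 : ℤ))).1 : ℝ) - (s.1 : ℝ)) / ((8 * μ + 12 : ℕ) * q) : ℝ) : Crc))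
  have h2 := meas_shift Prod.snd measurable_snd _ h
    (fun s => (((((Dst μ (2 * μ + 2) ((s.1 : ℤ), (s.2 : ℤ))).2 : ℝ) - (s.2 : ℝ)) / (r * (μ + 3) : ℕ) : ℝ) : Crc))
  exact h1.prodMk h2

lemma frac_pos (N : ℕ) (hN : 0 < N) (z : Crc) (hz : N • z ≠ 0) :
    0 < (N:ℝ) * rep z - ⌊(N:ℝ) * rep z⌋₊ ∧ (N:ℝ) * rep z - ⌊(N:ℝ) * rep z⌋₊ < 1 := by
  have h0 : 0 ≤ (N:ℝ) * rep z := mul_nonneg (Nat.cast_nonneg _) (rep_nonneg _)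
  refine ⟨?_, by linarith [Nat.lt_floor_add_one ((N:ℝ) * rep z)]⟩
  rw [sub_pos]
  refine lt_of_le_of_ne (Nat.floor_le h0) fun h => hz ?_
  rw [← coe_rep z, ← AddCircle.coe_nsmul, nsmul_eq_mul, ← h]
  exact coe_nat_crc _

lemma Ginf_lim (μ r q : ℕ) (hr : 0 < r) (hq : 0 < q) (φ : ℕ → Torus2 → Torus2)
    (hφ : ∀ (p0 : Torus2) (ζ o : ℝ), 0 < ζ → ζ < 1 → 0 < o → o < 1 → q • p0.1 = ((ζ / (8 * μ + 12 : ℕ) : ℝ) : Crc) →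
        p0.2 = ((o / (r * (μ + 3) : ℕ) : ℝ) : Crc) →
        ∀ᶠ k in atTop, ∀ s, φ k (bpt (8 * μ + 12) (r * (μ + 3)) q p0 s) = bpt (8 * μ + 12) (r * (μ + 3)) q p0 (Dst μ (2 * μ + 2) s)) :
    ∀ᵐ p, ∀ᶠ k in atTop, φ k p = Ginf μ r q p := by
  have hN1 : (0:ℝ) < (8 * μ + 12 : ℕ) := by positivity
  have hN2 : (0:ℝ) < (r * (μ + 3) : ℕ) := by positivity
  have hq' : (0:ℝ) < q := by positivity
  have hN2' : 0 < r * (μ + 3) := by positivity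
  filter_upwards [ae_fst ((nsmul_mp q hq).quasiMeasurePreserving.ae (ae_nsmul_ne (8 * μ + 12) (by omega))), ae_snd (ae_nsmul_ne (r * (μ + 3)) hN2')] with p h1 h2
  obtain ⟨a1, a2⟩ := frac_pos _ (by omega) _ h1
  obtain ⟨b1, b2⟩ := frac_pos _ hN2' _ h2
  set p0 : Torus2 := (p.1 - (((ccol μ q p : ℝ) / ((8 * μ + 12 : ℕ) * q) : ℝ) : Crc), p.2 - (((crow μ r p : ℝ) / (r * (μ + 3) : ℕ) : ℝ) : Crc)) with hp0
  have := hφ p0 _ _ a1 a2 b1 b2 ?_ ?_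
  · filter_upwards [this] with k hk
    have h := hk (((ccol μ q p : ℕ) : ℤ), ((crow μ r p : ℕ) : ℤ))
    have e1 : bpt (8 * μ + 12) (r * (μ + 3)) q p0 (((ccol μ q p : ℕ) : ℤ), ((crow μ r p : ℕ) : ℤ)) = p := by
      unfold bpt
      rw [hp0]
      ext
      · simp
      · simp
    rw [e1] at h
    rw [h]
    unfold bpt Ginf dD
    rw [hp0]
    ext
    · simp only
      rw [sub_add_eq_add_sub, add_sub_assoc, ← AddCircle.coe_sub, ← sub_div]
    · simp only
      rw [sub_add_eq_add_sub, add_sub_assoc, ← AddCircle.coe_sub, ← sub_div]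
  · rw [hp0]
    simp only
    rw [smul_sub, ← AddCircle.coe_nsmul, ← coe_rep (q • p.1), ← AddCircle.coe_sub, coe_rep]
    congr 1
    rw [nsmul_eq_mul]
    unfold ccol
    field_simp
  · rw [hp0]
    simp only
    conv_lhs => rw [← coe_rep p.2, ← AddCircle.coe_sub]
    congr 1
    unfold crow
    field_simp

lemma row_move (N : ℕ) (hN : 0 < N) (y : Crc) (R R' : ℕ) (hR : ⌊(N:ℝ) * rep y⌋₊ = R) (hR' : R' < N) :
    ⌊(N:ℝ) * rep (y + ((((R':ℝ) - R) / N : ℝ) : Crc))⌋₊ = R' := by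
  have hN' : (0:ℝ) < N := by exact_mod_cast hN
  have h0 : 0 ≤ (N:ℝ) * rep y := mul_nonneg (Nat.cast_nonneg _) (rep_nonneg _)
  rw [Nat.floor_eq_iff h0] at hR
  have hR2 : ((R':ℝ) + 1) ≤ N := by exact_mod_cast hR'
  have e : (N:ℝ) * (rep y + ((R':ℝ) - R) / N) = N * rep y + (R' - R) := by field_simp
  have g0 : 0 ≤ rep y + ((R':ℝ) - R) / N := by
    have : 0 ≤ (N:ℝ) * (rep y + ((R':ℝ) - R) / N) := by rw [e]; linarith [hR.1, (Nat.cast_nonneg R' : (0:ℝ) ≤ R')]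
    exact nonneg_of_mul_nonneg_right this hN'
  have g1 : rep y + ((R':ℝ) - R) / N < 1 := by
    have : (N:ℝ) * (rep y + ((R':ℝ) - R) / N) < N * 1 := by rw [e]; linarith [hR.2]
    exact lt_of_mul_lt_mul_left this hN'.le
  have : y + ((((R':ℝ) - R) / N : ℝ) : Crc) = ((rep y + ((R':ℝ) - R) / N : ℝ) : Crc) := by
    rw [AddCircle.coe_add, coe_rep]
  rw [this, rep_coe g0 g1, e, Nat.floor_eq_iff (by rw [← e]; positivity)]
  constructor <;> linarith [hR.1, hR.2]

lemma dD_bd (μ r q : ℕ) (hr : 0 < r) (p : Torus2) :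
    |((dD μ r q p).1 : ℝ) - ccol μ q p| ≤ 1 ∧ ∃ R' : ℕ, (dD μ r q p).2 = R' ∧ R' < r * (μ + 3) ∧ R' / (μ + 3) = crow μ r p / (μ + 3) := by
  have hc : ccol μ q p < 8 * μ + 12 := cell_lt _ (by omega) _
  have hR : crow μ r p < r * (μ + 3) := cell_lt _ (by positivity) _
  have hd := Nat.div_add_mod' (crow μ r p) (μ + 3)
  have hm := Nat.mod_lt (crow μ r p) (show 0 < μ + 3 by omega)
  set t := crow μ r p / (μ + 3) with ht
  obtain ⟨h1, ρ', g0, g1, h2⟩ := Dst_bd μ (2 * μ + 2) t (ccol μ q p) (crow μ r p % (μ + 3) : ℕ) (by omega) (by omega) (by omega) (by omega)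
  have e : ((t:ℤ) * (μ + 3) + (crow μ r p % (μ + 3) : ℕ)) = ((crow μ r p : ℕ) : ℤ) := by exact_mod_cast hd
  rw [e] at h1 h2
  constructor
  · exact_mod_cast h1
  · lift ρ' to ℕ using g0
    refine ⟨t * (μ + 3) + ρ', by rw [dD, h2]; push_cast; ring, ?_, ?_⟩
    · have : t < r := by rw [ht, Nat.div_lt_iff_lt_mul (by omega)]; exact hR
      calc t * (μ + 3) + ρ' < (t + 1) * (μ + 3) := by rw [add_mul]; omega
        _ ≤ r * (μ + 3) := Nat.mul_le_mul_right _ this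
    · rw [add_comm, Nat.add_mul_div_right _ _ (by omega), Nat.div_eq_of_lt (by omega), zero_add]

lemma Ginf_chi (μ r q t : ℕ) (hr : 0 < r) (p : Torus2) : chi r t (Ginf μ r q p) = chi r t p := by
  obtain ⟨_, R', h1, h2, h3⟩ := dD_bd μ r q hr p
  rw [chi_eq r (μ + 3) t (by omega), chi_eq r (μ + 3) t (by omega) p]
  have : ⌊((r * (μ + 3) : ℕ):ℝ) * rep (Ginf μ r q p).2⌋₊ = R' := by
    unfold Ginf
    rw [h1]
    exact row_move _ (by positivity) _ _ _ rfl h2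
  rw [this, h3]; rfl

lemma Ginf_ne (μ r q : ℕ) (hr : 0 < r) : ∀ᵐ p : Torus2, r • (Ginf μ r q p).2 ≠ 0 := by
  have hN2 : (0:ℝ) < (r * (μ + 3) : ℕ) := by positivity
  filter_upwards [ae_snd (ae_nsmul_ne (r * (μ + 3)) (by positivity))] with p hp h
  apply hp
  have : (μ + 3) • (r • (Ginf μ r q p).2) = (r * (μ + 3)) • p.2 := by
    rw [← mul_smul, mul_comm (μ + 3)]
    unfold Ginf
    simp only
    rw [smul_add, ← AddCircle.coe_nsmul, nsmul_eq_mul, mul_div_cancel₀ _ hN2.ne']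
    have : (((dD μ r q p).2 : ℝ) - (crow μ r p : ℝ)) = (((dD μ r q p).2 - (crow μ r p : ℤ) : ℤ) : ℝ) := by push_cast; rfl
    rw [this, coe_int_crc, add_zero]
  rw [← this, h, smul_zero]

lemma ccol_period (μ q : ℕ) (hq : 0 < q) (p : Torus2) (j : ℤ) : ccol μ q (p + tv (j / q)) = ccol μ q p := by
  unfold ccol
  congr 3
  simp only [tv, Prod.fst_add, smul_add]
  rw [qsmul_div q hq, coe_int_crc, add_zero]

lemma crow_tv (μ r : ℕ) (p : Torus2) (a : ℝ) : crow μ r (p + tv a) = crow μ r p := by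
  unfold crow; simp [tv]

lemma Ginf_period (μ r q : ℕ) (hq : 0 < q) (p : Torus2) (j : ℤ) : Ginf μ r q (p + tv (j / q)) = Ginf μ r q p + tv (j / q) := by
  unfold Ginf dD
  rw [ccol_period μ q hq, crow_tv]
  simp only [tv]
  ext
  · simp only [Prod.fst_add]; abel
  · simp

lemma ccol_half (μ q : ℕ) (hq : 0 < q) (p : Torus2) :
    ccol μ q (p + tv (1 / (2 * q))) = (ccol μ q p + (4 * μ + 6)) % (8 * μ + 12) := by
  have hN : (0:ℝ) < (8 * μ + 12 : ℕ) := by positivity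
  have e0 : q • (p + tv (1 / (2 * q))).1 = ((rep (q • p.1) + 1 / 2 : ℝ) : Crc) := by
    have : (1 / (2 * q) : ℝ) = (1 / 2) / q := by field_simp
    simp only [tv, Prod.fst_add, smul_add]
    rw [this, qsmul_div q hq, AddCircle.coe_add, coe_rep]
  have hc : ccol μ q p < 8 * μ + 12 := cell_lt _ (by omega) _
  unfold ccol at *
  rw [e0]
  set z := rep (q • p.1)
  have z0 : 0 ≤ z := rep_nonneg _
  have z1 : z < 1 := rep_lt _
  rcases lt_or_ge z (1/2) with h | h
  · rw [rep_coe (by linarith) (by linarith)]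
    have : ((8 * μ + 12 : ℕ) : ℝ) * (z + 1 / 2) = (8 * μ + 12 : ℕ) * z + (4 * μ + 6 : ℕ) := by push_cast; ring
    rw [this, Nat.floor_add_natCast (by positivity)]
    rw [Nat.mod_eq_of_lt]
    have : ⌊((8 * μ + 12 : ℕ) : ℝ) * z⌋₊ < 4 * μ + 6 := by
      rw [Nat.floor_lt (by positivity)]; push_cast; nlinarith [(Nat.cast_nonneg μ : (0:ℝ) ≤ μ)]
    omega
  · have e1 : ((z + 1 / 2 : ℝ) : Crc) = ((z - 1 / 2 : ℝ) : Crc) := by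
      rw [show z + 1 / 2 = (z - 1 / 2) + 1 by ring, AddCircle.coe_add_period]
    rw [e1, rep_coe (by linarith) (by linarith)]
    have h6 : 4 * μ + 6 ≤ ⌊((8 * μ + 12 : ℕ) : ℝ) * z⌋₊ := by
      rw [Nat.le_floor_iff (by positivity)]; push_cast; nlinarith [(Nat.cast_nonneg μ : (0:ℝ) ≤ μ)]
    have : ((8 * μ + 12 : ℕ) : ℝ) * (z - 1 / 2) = (8 * μ + 12 : ℕ) * z - (4 * μ + 6 : ℕ) := by push_cast; ring
    rw [this, Nat.floor_sub_natCast]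
    rw [show ⌊((8 * μ + 12 : ℕ) : ℝ) * z⌋₊ + (4 * μ + 6) = (⌊((8 * μ + 12 : ℕ) : ℝ) * z⌋₊ - (4 * μ + 6)) + (8 * μ + 12) by omega,
      Nat.add_mod_right, Nat.mod_eq_of_lt (by omega)]

/-! ### File R: the belt limit -/

lemma abs_mul_le' {a b A B : ℝ} (h1 : |a| ≤ A) (h2 : |b| ≤ B) : |a * b| ≤ A * B := by
  rw [abs_mul]; exact mul_le_mul h1 h2 (abs_nonneg _) ((abs_nonneg _).trans h1)

lemma chi_abs (r t p) : |chi r t p| ≤ 1 := by rw [abs_of_nonneg (chi_nonneg r t p)]; exact chi_le_one r t p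

lemma cell_dist (N : ℕ) (hN : 0 < N) (y : Crc) (a : ℝ) (R : ℕ) (hR : ⌊(N:ℝ) * rep y⌋₊ = R) :
    dist (y + (((a - R) / N : ℝ) : Crc)) ((a / N : ℝ) : Crc) ≤ 1 / N := by
  have hN' : (0:ℝ) < N := by exact_mod_cast hN
  have h0 : 0 ≤ (N:ℝ) * rep y := mul_nonneg (Nat.cast_nonneg _) (rep_nonneg _)
  rw [Nat.floor_eq_iff h0] at hR
  have : y + (((a - R) / N : ℝ) : Crc) = 0 + ((rep y + (a - R) / N : ℝ) : Crc) := by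
    rw [AddCircle.coe_add, coe_rep, zero_add]
  rw [this, ← zero_add ((a / N : ℝ) : Crc)]
  refine (crc_dist_add_coe _ _ _).trans ?_
  have : rep y + (a - R) / N - a / N = (N * rep y - R) / N := by field_simp; ring
  rw [this, abs_of_nonneg (div_nonneg (by linarith [hR.1]) hN'.le)]
  gcongr
  linarith [hR.2]

lemma belt_lim (r q t : ℕ) (hr : 0 < r) (hq : 0 < q) (ht : t < r) (Ψ : C(Crc × Crc, ℝ)) (ε : ℝ) (hε : 0 < ε) :
    ∀ᶠ μ in atTop, |r * (∫ p : Torus2, chi r t p * Ψ ((Ginf μ r q (p + tv (1 / (2 * q)))).2, (Ginf μ r q p).2)) -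
      r ^ 2 * ∫ u : Torus2, chi r t (0, u.1) * (chi r t (0, u.2) * Ψ u)| ≤ ε := by
  have hr' : (0:ℝ) < r := by positivity
  set η := ε / (4 * r ^ 2) with hη
  have hη0 : 0 < η := by positivity
  obtain ⟨δ, hδ, huc⟩ := Metric.uniformContinuous_iff.1 (CompactSpace.uniformContinuous_of_continuous Ψ.continuous) η hη0
  have hB : ∀ u, |Ψ u| ≤ ‖Ψ‖ := fun u => Ψ.norm_coe_le_norm u
  have ev1 : ∀ᶠ μ : ℕ in atTop, 1 / ((μ:ℝ) + 3) < δ := by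
    have : Tendsto (fun μ : ℕ => 1 / ((μ:ℝ) + 3)) atTop (𝓝 0) :=
      tendsto_const_nhds.div_atTop (tendsto_atTop_add_const_right _ _ tendsto_natCast_atTop_atTop)
    exact this.eventually (gt_mem_nhds hδ)
  have ev2 : ∀ᶠ μ : ℕ in atTop, 10 * ‖Ψ‖ / ((μ:ℝ) + 3) < ε / 2 := by
    have : Tendsto (fun μ : ℕ => 10 * ‖Ψ‖ / ((μ:ℝ) + 3)) atTop (𝓝 0) :=
      tendsto_const_nhds.div_atTop (tendsto_atTop_add_const_right _ _ tendsto_natCast_atTop_atTop)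
    exact this.eventually (gt_mem_nhds (by linarith))
  filter_upwards [ev1, ev2] with μ h1 h2
  set m := μ + 3 with hm
  set N2 := r * m with hN2
  have hm0 : (0:ℝ) < m := by positivity
  have hN20 : 0 < N2 := by positivity
  have hN2le : 1 / (N2:ℝ) < δ := by
    refine lt_of_le_of_lt ?_ h1
    apply one_div_le_one_div_of_le (by positivity)
    have : (1:ℝ) ≤ r := by exact_mod_cast hr
    rw [hN2, hm]; push_cast; nlinarith [(Nat.cast_nonneg μ : (0:ℝ) ≤ μ)]
  let S : ℤ → ℤ → ℝ := fun a b => Ψ ((((a:ℝ) / N2 : ℝ) : Crc), (((b:ℝ) / N2 : ℝ) : Crc))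
  have hbelt := belt_sum μ t S ‖Ψ‖ (fun a b => hB _)
  have hΨ : ∀ u v u' v' : Crc, dist u u' ≤ 1 / N2 → dist v v' ≤ 1 / N2 → |Ψ (u, v) - Ψ (u', v')| ≤ η := by
    intro u v u' v' a b
    have := huc (a := (u, v)) (b := (u', v')) (by rw [Prod.dist_eq]; exact max_lt (a.trans_lt hN2le) (b.trans_lt hN2le))
    rw [Real.dist_eq] at this; exact this.le
  have hG2 : ∀ p, dist (Ginf μ r q p).2 ((((dD μ r q p).2 : ℝ) / N2 : ℝ) : Crc) ≤ 1 / N2 := fun p =>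
    cell_dist N2 hN20 p.2 _ _ rfl
  -- first integral
  have I1 := cells_approx (8 * μ + 12) N2 q (by omega) hN20 hq
    (fun i R => r * if R / m = t then S (Dst μ (2 * μ + 2) (((i + (4 * μ + 6)) % (8 * μ + 12) : ℕ), (R : ℕ))).2
          (Dst μ (2 * μ + 2) ((i : ℕ), (R : ℕ))).2 else 0)
    (fun p => r * (chi r t p * Ψ ((Ginf μ r q (p + tv (1 / (2 * q)))).2, (Ginf μ r q p).2)))
    (by
      refine Integrable.const_mul (Integrable.of_bound (C := 1 * ‖Ψ‖) ?_ ?_) _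
      · refine ((chi_measurable r t).mul (Ψ.continuous.measurable.comp (Measurable.prodMk ?_ ?_))).aestronglyMeasurable
        · exact measurable_snd.comp ((Ginf_measurable μ r q hq).comp (torus_add_mp _).measurable)
        · exact measurable_snd.comp (Ginf_measurable μ r q hq)
      · exact Eventually.of_forall fun p => abs_mul_le' (chi_abs _ _ _) (hB _))
    (r * η) (Eventually.of_forall fun p => by
      rw [chi_eq r m t (by omega), ← mul_sub, abs_mul, abs_of_pos hr']
      refine mul_le_mul_of_nonneg_left ?_ hr'.le
      have hc : crow μ r p = ⌊((r * m : ℕ):ℝ) * rep p.2⌋₊ := rfl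
      have hcc : ccol μ q p = ⌊((8 * μ + 12 : ℕ):ℝ) * rep (q • p.1)⌋₊ := rfl
      rw [← hN2] at hc ⊢
      rw [← hc, ← hcc]
      by_cases h : crow μ r p / m = t
      · rw [if_pos h, if_pos h, one_mul]
        refine hΨ _ _ _ _ ?_ ?_
        · have := hG2 (p + tv (1 / (2 * q)))
          unfold dD at this
          rw [ccol_half μ q hq, crow_tv] at this
          exact this
        · exact hG2 p
      · rw [if_neg h, if_neg h]; simp; exact hη0.le)
  have I2 := cells_approx N2 N2 1 hN20 hN20 one_pos
    (fun i R => r ^ 2 * if i / m = t then (if R / m = t then S i R else 0) else 0)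
    (fun u => r ^ 2 * (chi r t (0, u.1) * (chi r t (0, u.2) * Ψ u)))
    (by
      refine Integrable.const_mul (Integrable.of_bound (C := 1 * (1 * ‖Ψ‖)) ?_ ?_) _
      · refine (((chi_measurable r t).comp (measurable_const.prodMk measurable_fst)).mul
          (((chi_measurable r t).comp (measurable_const.prodMk measurable_snd)).mul Ψ.continuous.measurable)).aestronglyMeasurable
      · exact Eventually.of_forall fun p => abs_mul_le' (chi_abs _ _ _) (abs_mul_le' (chi_abs _ _ _) (hB _)))
    (r ^ 2 * η) (Eventually.of_forall fun u => by
      rw [chi_eq r m t (by omega), chi_eq r m t (by omega), ← mul_sub, abs_mul, abs_of_pos (by positivity : (0:ℝ) < r ^ 2)]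
      refine mul_le_mul_of_nonneg_left ?_ (by positivity)
      simp only [one_smul]
      rw [← hN2]
      by_cases h : ⌊(N2:ℝ) * rep u.1⌋₊ / m = t
      · by_cases h' : ⌊(N2:ℝ) * rep u.2⌋₊ / m = t
        · rw [if_pos h, if_pos h', if_pos h, if_pos h', one_mul, one_mul]
          refine hΨ u.1 u.2 _ _ ?_ ?_
          · have := cell_dist N2 hN20 u.1 ⌊(N2:ℝ) * rep u.1⌋₊ _ rfl
            simpa using this
          · have := cell_dist N2 hN20 u.2 ⌊(N2:ℝ) * rep u.2⌋₊ _ rfl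
            simpa using this
        · rw [if_pos h, if_neg h', if_pos h, if_neg h']; simp; exact hη0.le
      · rw [if_neg h, if_neg h]; simp; exact hη0.le)
  rw [integral_const_mul] at I1 I2
  -- evaluate the sums
  have s1 : (((8 * μ + 12 : ℕ):ℝ) * N2)⁻¹ * ∑ i ∈ Finset.range (8 * μ + 12), ∑ R ∈ Finset.range N2,
      (r * if R / m = t then S (Dst μ (2 * μ + 2) (((i + (4 * μ + 6)) % (8 * μ + 12) : ℕ), (R : ℕ))).2
          (Dst μ (2 * μ + 2) ((i : ℕ), (R : ℕ))).2 else 0) =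
      (((8 * μ + 12 : ℕ) : ℝ) * m)⁻¹ * ∑ i ∈ Finset.range (8 * μ + 12), ∑ ρ ∈ Finset.range m,
        S (Dst μ (2 * μ + 2) (((i + (4 * μ + 6)) % (8 * μ + 12) : ℕ), (t * m + ρ : ℕ))).2
          (Dst μ (2 * μ + 2) ((i : ℕ), (t * m + ρ : ℕ))).2 := by
    simp only [← Finset.mul_sum]
    rw [← mul_assoc]
    congr 1
    · rw [hN2]; push_cast; field_simp
    · refine Finset.sum_congr rfl fun i _ => ?_
      rw [hN2]
      exact strip_sum r m t ht (fun R => S (Dst μ (2 * μ + 2) (((i + (4 * μ + 6)) % (8 * μ + 12) : ℕ), (R : ℕ))).2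
          (Dst μ (2 * μ + 2) ((i : ℕ), (R : ℕ))).2)
  have s2 : ((N2:ℝ) * N2)⁻¹ * ∑ i ∈ Finset.range N2, ∑ R ∈ Finset.range N2,
      (r ^ 2 * if i / m = t then (if R / m = t then S i R else 0) else 0) =
      ((m : ℝ) * m)⁻¹ * ∑ ρ ∈ Finset.range m, ∑ ρ' ∈ Finset.range m, S (t * m + ρ' : ℕ) (t * m + ρ : ℕ) := by
    simp only [← Finset.mul_sum]
    rw [← mul_assoc]
    congr 1
    · rw [hN2]; push_cast; field_simp
    · rw [Finset.sum_comm (s := Finset.range m)]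
      have : ∀ i : ℕ, ∑ R ∈ Finset.range N2, (if i / m = t then (if R / m = t then S i R else 0) else 0) =
          if i / m = t then ∑ ρ ∈ Finset.range m, S i (t * m + ρ : ℕ) else 0 := by
        intro i
        split_ifs
        · rw [hN2]; exact strip_sum r m t ht (fun R => S i R)
        · simp
      simp only [this]
      rw [hN2]
      exact strip_sum r m t ht (fun i => ∑ ρ ∈ Finset.range m, S i (t * m + ρ : ℕ))
  rw [s1] at I1
  rw [s2] at I2
  have hmm : (m:ℝ) = μ + 3 := by rw [hm]; push_cast; rfl
  rw [← hmm] at h2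
  have f1 : (r:ℝ) * η ≤ ε / 4 := by
    rw [hη, mul_div_assoc', div_le_div_iff₀ (by positivity) (by positivity)]
    have : (1:ℝ) ≤ r := by exact_mod_cast hr
    nlinarith [mul_le_mul_of_nonneg_left this (mul_nonneg hr'.le hε.le)]
  have f2 : (r:ℝ) ^ 2 * η = ε / 4 := by rw [hη]; field_simp
  rw [f2] at I2
  rw [abs_le] at *
  constructor <;> linarith [I1.1, I1.2, I2.1, I2.2, hbelt.1, hbelt.2]

/-! ### File S: shear averages and the mixing step -/

lemma tor_int_prod (f : Torus2 → ℝ) (hf : Integrable f) : ∫ p : Torus2, f p = ∫ x : Crc, ∫ y : Crc, f (x, y) :=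
  integral_prod f hf

lemma cm_bd (F : C(Torus2, ℝ)) (p) : |F p| ≤ ‖F‖ := F.norm_coe_le_norm p

lemma chi_mul_int (r t : ℕ) (g : Torus2 → ℝ) (hg : Measurable g) (C : ℝ) (hC : ∀ p, |g p| ≤ C) :
    Integrable (fun p => chi r t p * g p) :=
  Integrable.of_bound ((chi_measurable r t).mul hg).aestronglyMeasurable (1 * C)
    (Eventually.of_forall fun p => abs_mul_le' (chi_abs _ _ _) (hC _))

lemma int_abs_le {X : Type*} [MeasurableSpace X] (ν : Measure X) [IsProbabilityMeasure ν] (f : X → ℝ) (C : ℝ)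
    (h : ∀ᵐ x ∂ν, |f x| ≤ C) : |∫ x, f x ∂ν| ≤ C := by
  have := norm_integral_le_of_norm_le_const (μ := ν) (f := f) h
  simpa using this

lemma chi_shift_lim (r t : ℕ) (hr : 0 < r) : Tendsto (fun h : ℝ => ∫ u : Crc, |chi r t (0, u + (h : Crc)) - chi r t (0, u)|) (𝓝 0) (𝓝 0) := by
  have : Tendsto (fun h : ℝ => ∫ u : Crc, |chi r t (0, u + (h : Crc)) - chi r t (0, u)|) (𝓝 0) (𝓝 (∫ u : Crc, (0:ℝ))) := by
    refine tendsto_integral_filter_of_dominated_convergence (fun _ => 1) ?_ ?_ (integrable_const _) ?_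
    · refine Eventually.of_forall fun h => ?_
      have m1 : Measurable fun u : Crc => chi r t (0, u + (h : Crc)) :=
        (chi_measurable r t).comp (measurable_const.prodMk (measurable_id.add_const _))
      have m2 : Measurable fun u : Crc => chi r t (0, u) := (chi_measurable r t).comp (measurable_const.prodMk measurable_id)
      exact (m1.sub m2).abs.aestronglyMeasurable
    · refine Eventually.of_forall fun h => Eventually.of_forall fun u => ?_
      rw [Real.norm_eq_abs, abs_abs, abs_le]
      constructor <;> linarith [chi_nonneg r t (0, u + (h:Crc)), chi_le_one r t (0, u + (h:Crc)), chi_nonneg r t (0, u), chi_le_one r t (0,u)]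
    · filter_upwards [ae_nsmul_ne r hr] with u hu
      have hc : Tendsto (fun h : ℝ => ((0 : Crc), u + (h : Crc))) (𝓝 0) (𝓝 (0, u)) := by
        have : Continuous (fun h : ℝ => ((0 : Crc), u + (h : Crc))) := by
          have := continuous_crc_coe
          fun_prop
        have h2 := this.tendsto 0
        simpa using h2
      refine tendsto_const_nhds.congr' ?_
      filter_upwards [hc.eventually (chi_ev r t (0, u) hu)] with h hh
      rw [hh]; simp
  simpa using this

lemma shear_avg (r t : ℕ) (hr : 0 < r) (F : C(Torus2, ℝ)) (ε : ℝ) (hε : 0 < ε) :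
    ∀ᶠ K : ℕ in atTop, ∀ s : Crc, |(∫ u : Crc, chi r t (0, u) * F (s + (K:ℤ) • u, u)) - ∫ p : Torus2, chi r t p * F p| ≤ ε := by
  set B := ‖F‖
  have hB0 : 0 ≤ B := norm_nonneg _
  obtain ⟨δ1, hδ1, hF⟩ := Metric.uniformContinuous_iff.1 (CompactSpace.uniformContinuous_of_continuous F.continuous) (ε / 2) (by linarith)
  have hg := (chi_shift_lim r t hr).eventually (gt_mem_nhds (show 0 < ε / (2 * (B + 1)) by positivity))
  obtain ⟨δ2, hδ2, hg⟩ := Metric.eventually_nhds_iff.1 hg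
  have hK : ∀ᶠ K : ℕ in atTop, 1 / ((K:ℝ) + 1) < min δ1 δ2 :=
    tendsto_one_div_add_atTop_nhds_zero_nat.eventually (gt_mem_nhds (lt_min hδ1 hδ2))
  obtain ⟨K0, hK⟩ := eventually_atTop.1 hK
  filter_upwards [eventually_ge_atTop (K0 + 1)] with K hK1 s
  have hKp : (0:ℝ) < K := by exact_mod_cast (by omega : 0 < K)
  have hKlt : 1 / (K:ℝ) < min δ1 δ2 := by
    have := hK (K - 1) (by omega)
    rwa [Nat.cast_sub (by omega), Nat.cast_one, sub_add_cancel] at this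
  have mchi : Measurable fun u : Crc => chi r t (0, u) := (chi_measurable r t).comp (measurable_const.prodMk measurable_id)
  let E : Crc → ℝ := fun σ => ∫ u : Crc, chi r t (0, u) * F (σ + s + (K:ℤ) • u, u)
  have cF : ∀ σ : Crc, Continuous fun u : Crc => F (σ + (K:ℤ) • u, u) := fun σ => by fun_prop
  have iF : ∀ (h : Crc) (σ : Crc), Integrable fun u : Crc => chi r t (0, u + h) * F (σ + (K:ℤ) • (u + h), u + h) := fun h σ =>
    Integrable.of_bound (((mchi.comp (measurable_id.add_const h)).mul ((cF σ).measurable.comp (measurable_id.add_const h))).aestronglyMeasurable) (1 * B)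
      (Eventually.of_forall fun p => abs_mul_le' (chi_abs _ _ _) (cm_bd F _))
  have iF0 : ∀ (σ : Crc), Integrable fun u : Crc => chi r t (0, u) * F (σ + (K:ℤ) • u, u) := fun σ => by
    simpa using iF 0 σ
  have key : ∀ σ, |E 0 - E σ| ≤ ε := by
    intro σ
    set h : ℝ := rep σ / K with hh
    have hh0 : |h| < min δ1 δ2 := by
      refine lt_of_le_of_lt ?_ hKlt
      rw [abs_of_nonneg (div_nonneg (rep_nonneg _) hKp.le)]
      gcongr; exact (rep_lt σ).le
    have hσ : (K:ℤ) • (h : Crc) = σ := by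
      rw [natCast_zsmul, ← AddCircle.coe_nsmul, nsmul_eq_mul, hh, mul_div_cancel₀ _ hKp.ne', coe_rep]
    have e0 : E 0 = ∫ u : Crc, chi r t (0, u + (h:Crc)) * F (s + (K:ℤ) • (u + (h:Crc)), u + (h:Crc)) := by
      have := mp_int (measurePreserving_add_right (volume : Measure Crc) (h:Crc)) (iF0 s).aestronglyMeasurable
      rw [this]; simp [E]
    rw [e0, ← integral_sub (iF _ _) (iF0 _)]
    have hb : ∀ u : Crc, ‖chi r t (0, u + (h:Crc)) * F (s + (K:ℤ) • (u + (h:Crc)), u + (h:Crc)) - chi r t (0, u) * F (σ + s + (K:ℤ) • u, u)‖ ≤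
        |chi r t (0, u + (h : Crc)) - chi r t (0, u)| * B + ε / 2 := by
      intro u
      have e1 : s + (K:ℤ) • (u + (h:Crc)) = σ + s + (K:ℤ) • u := by rw [smul_add, hσ]; abel
      rw [e1, Real.norm_eq_abs]
      have e2 : chi r t (0, u + (h:Crc)) * F (σ + s + (K:ℤ) • u, u + (h:Crc)) - chi r t (0, u) * F (σ + s + (K:ℤ) • u, u) =
        (chi r t (0, u + (h:Crc)) - chi r t (0, u)) * F (σ + s + (K:ℤ) • u, u + (h:Crc)) +
        chi r t (0, u) * (F (σ + s + (K:ℤ) • u, u + (h:Crc)) - F (σ + s + (K:ℤ) • u, u)) := by ring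
      rw [e2]
      refine (abs_add_le _ _).trans (add_le_add (abs_mul_le' le_rfl (cm_bd F _)) ?_)
      have e3 : |F (σ + s + (K:ℤ) • u, u + (h:Crc)) - F (σ + s + (K:ℤ) • u, u)| ≤ ε / 2 := by
        have := hF (a := (σ + s + (K:ℤ) • u, u + (h:Crc))) (b := (σ + s + (K:ℤ) • u, u)) (by
          rw [Prod.dist_eq, dist_self]
          refine max_lt hδ1 ?_
          have := crc_dist_add_coe u h 0
          rw [AddCircle.coe_zero, add_zero, sub_zero] at this
          exact this.trans_lt (hh0.trans_le (min_le_left _ _)))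
        rw [Real.dist_eq] at this; exact this.le
      have := abs_mul_le' (chi_abs r t (0, u)) e3
      linarith
    have ichi : Integrable fun u : Crc => |chi r t (0, u + (h : Crc)) - chi r t (0, u)| := by
      refine Integrable.of_bound (((mchi.comp (measurable_id.add_const _)).sub mchi).abs.aestronglyMeasurable) 1 (Eventually.of_forall fun u => ?_)
      rw [Real.norm_eq_abs, abs_abs, abs_le]
      constructor <;> linarith [chi_nonneg r t (0, u + (h:Crc)), chi_le_one r t (0, u + (h:Crc)), chi_nonneg r t (0, u), chi_le_one r t (0,u)]
    have h3 := norm_integral_le_of_norm_le ((ichi.mul_const B).add (integrable_const (ε / 2))) (Eventually.of_forall hb)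
    rw [Real.norm_eq_abs] at h3
    refine h3.trans ?_
    rw [integral_add' (ichi.mul_const B) (integrable_const _), integral_mul_const, integral_const]
    have h4 := (hg (y := h) (by rw [Real.dist_eq, sub_zero]; exact hh0.trans_le (min_le_right _ _))).le
    have h5 : (∫ u : Crc, |chi r t (0, u + (h : Crc)) - chi r t (0, u)|) * B ≤ ε / (2 * (B + 1)) * B := by gcongr
    have h6 : ε / (2 * (B + 1)) * B ≤ ε / 2 := by
      rw [div_mul_eq_mul_div, div_le_div_iff₀ (by positivity) (by positivity)]; nlinarith
    simp
    linarith
  have e1 : ∫ p : Torus2, chi r t p * F p = ∫ σ, E σ := by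
    have hmp := xsh_mp (ContinuousMap.const Crc (rep s)) (K:ℤ)
    have ii : Integrable fun p : Torus2 => chi r t p * F p := chi_mul_int r t F F.continuous.measurable B (cm_bd F)
    rw [← mp_int hmp ii.aestronglyMeasurable]
    have i2 : Integrable fun p : Torus2 => chi r t (xsh (ContinuousMap.const Crc (rep s)) K p) * F (xsh (ContinuousMap.const Crc (rep s)) K p) :=
      hmp.integrable_comp_of_integrable ii
    rw [tor_int_prod _ i2]
    simp only [xsh, ContinuousMap.const_apply, coe_rep]
    rfl
  have iE : Integrable E := by
    have hmp := xsh_mp (ContinuousMap.const Crc (rep s)) (K:ℤ)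
    have ii : Integrable fun p : Torus2 => chi r t p * F p := chi_mul_int r t F F.continuous.measurable B (cm_bd F)
    have i2 : Integrable (fun p : Torus2 => chi r t (xsh (ContinuousMap.const Crc (rep s)) K p) * F (xsh (ContinuousMap.const Crc (rep s)) K p)) ((volume : Measure Crc).prod volume) :=
      hmp.integrable_comp_of_integrable ii
    have := i2.integral_prod_left
    simp only [xsh, ContinuousMap.const_apply, coe_rep] at this
    exact this
  have e2 : ∫ u : Crc, chi r t (0, u) * F (s + (K:ℤ) • u, u) = E 0 := by simp [E]
  rw [e1, e2]
  have e3 : E 0 - ∫ σ, E σ = ∫ σ, (E 0 - E σ) := by rw [integral_sub (integrable_const _) iE]; simp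
  rw [e3]
  exact int_abs_le _ _ _ (Eventually.of_forall key)

/-! ### File T: the mixing step -/

def Psi (F G : C(Torus2, ℝ)) (K : ℕ) : C(Crc × Crc, ℝ) where
  toFun u := ∫ s : Crc, F (s + (K:ℤ) • u.1, u.1) * G (s + (K:ℤ) • u.2, u.2)
  continuous_toFun := by
    refine continuous_of_dominated (bound := fun _ => ‖F‖ * ‖G‖) ?_ ?_ (integrable_const _) ?_
    · intro u
      have : Continuous fun s : Crc => F (s + (K:ℤ) • u.1, u.1) * G (s + (K:ℤ) • u.2, u.2) := by fun_prop
      exact this.aestronglyMeasurable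
    · exact fun u => Eventually.of_forall fun s => abs_mul_le' (cm_bd F _) (cm_bd G _)
    · exact Eventually.of_forall fun s => by fun_prop

lemma psi_lim (r t : ℕ) (hr : 0 < r) (F G : C(Torus2, ℝ)) (ε : ℝ) (hε : 0 < ε) :
    ∀ᶠ K : ℕ in atTop, |(r:ℝ)^2 * (∫ u : Torus2, chi r t (0, u.1) * (chi r t (0, u.2) * Psi F G K u)) -
      (r * ∫ p : Torus2, chi r t p * F p) * (r * ∫ p : Torus2, chi r t p * G p)| ≤ ε := by
  have hrp : (0:ℝ) < r := by exact_mod_cast hr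
  set D := (r:ℝ)^2 * (‖F‖ + ‖G‖ + 1) with hD
  have hDp : 0 < D := by positivity
  filter_upwards [shear_avg r t hr F (ε / D) (by positivity), shear_avg r t hr G (ε / D) (by positivity)] with K hF hG
  have mchi : Measurable fun u : Crc => chi r t (0, u) := (chi_measurable r t).comp (measurable_const.prodMk measurable_id)
  let a : Crc → ℝ := fun s => ∫ u : Crc, chi r t (0, u) * F (s + (K:ℤ) • u, u)
  let b : Crc → ℝ := fun s => ∫ u : Crc, chi r t (0, u) * G (s + (K:ℤ) • u, u)
  have ba : ∀ s, |a s| ≤ ‖F‖ := fun s => by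
    refine int_abs_le _ _ _ (Eventually.of_forall fun u => ?_)
    have := abs_mul_le' (chi_abs r t (0, u)) (cm_bd F (s + (K:ℤ) • u, u))
    linarith
  have mI : Measurable fun z : Torus2 × Crc => chi r t (0, z.1.1) * (chi r t (0, z.1.2) * (F (z.2 + (K:ℤ) • z.1.1, z.1.1) * G (z.2 + (K:ℤ) • z.1.2, z.1.2))) := by
    have c1 : Continuous fun z : Torus2 × Crc => F (z.2 + (K:ℤ) • z.1.1, z.1.1) := by fun_prop
    have c2 : Continuous fun z : Torus2 × Crc => G (z.2 + (K:ℤ) • z.1.2, z.1.2) := by fun_prop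
    exact (mchi.comp (measurable_fst.comp measurable_fst)).mul ((mchi.comp (measurable_snd.comp measurable_fst)).mul (c1.measurable.mul c2.measurable))
  have iI : Integrable (Function.uncurry fun (u : Torus2) (s : Crc) => chi r t (0, u.1) * (chi r t (0, u.2) * (F (s + (K:ℤ) • u.1, u.1) * G (s + (K:ℤ) • u.2, u.2))))
      ((volume : Measure Torus2).prod volume) := by
    refine Integrable.of_bound mI.aestronglyMeasurable (1 * (1 * (‖F‖ * ‖G‖))) (Eventually.of_forall fun z => ?_)
    exact abs_mul_le' (chi_abs _ _ _) (abs_mul_le' (chi_abs _ _ _) (abs_mul_le' (cm_bd _ _) (cm_bd _ _)))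
  have e1 : ∫ u : Torus2, chi r t (0, u.1) * (chi r t (0, u.2) * Psi F G K u) = ∫ s, a s * b s := by
    have : ∀ u : Torus2, chi r t (0, u.1) * (chi r t (0, u.2) * Psi F G K u) =
      ∫ s : Crc, chi r t (0, u.1) * (chi r t (0, u.2) * (F (s + (K:ℤ) • u.1, u.1) * G (s + (K:ℤ) • u.2, u.2))) := fun u => by
      rw [integral_const_mul, integral_const_mul]; rfl
    simp_rw [this]
    rw [integral_integral_swap iI]
    congr 1; ext s
    rw [← integral_prod_mul (μ := (volume : Measure Crc)) (ν := (volume : Measure Crc))]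
    congr 1; ext u; ring
  set A := ∫ p : Torus2, chi r t p * F p with hA
  set B := ∫ p : Torus2, chi r t p * G p with hB
  have bB : |B| ≤ ‖G‖ := by
    refine int_abs_le _ _ _ (Eventually.of_forall fun u => ?_)
    have := abs_mul_le' (chi_abs r t u) (cm_bd G u)
    linarith
  have iab : Integrable fun s => a s * b s := by
    have h := iI.integral_prod_right
    refine h.congr (Eventually.of_forall fun s => ?_)
    simp only [Function.uncurry]
    simp only [a, b]
    rw [← integral_prod_mul (μ := (volume : Measure Crc)) (ν := (volume : Measure Crc))]
    refine integral_congr_ae (Eventually.of_forall fun u => ?_)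
    simp only []; ring
  have e2 : |(∫ s, a s * b s) - A * B| ≤ (‖F‖ + ‖G‖) * (ε / D) := by
    have : (∫ s, a s * b s) - A * B = ∫ s, (a s * b s - A * B) := by
      rw [integral_sub iab (integrable_const _)]; simp
    rw [this]
    refine int_abs_le _ _ _ (Eventually.of_forall fun s => ?_)
    have h1 : a s * b s - A * B = a s * (b s - B) + (a s - A) * B := by ring
    rw [h1]
    refine (abs_add_le _ _).trans ?_
    have h2 := abs_mul_le' (ba s) (hG s)
    have h3 := abs_mul_le' (hF s) bB
    calc _ ≤ ‖F‖ * (ε / D) + ε / D * ‖G‖ := add_le_add h2 h3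
      _ = _ := by ring
  rw [e1]
  have e3 : (r:ℝ)^2 * (∫ s, a s * b s) - r * A * (r * B) = r^2 * ((∫ s, a s * b s) - A * B) := by ring
  rw [e3, abs_mul, abs_of_nonneg (by positivity)]
  calc (r:ℝ)^2 * |(∫ s, a s * b s) - A * B| ≤ r^2 * ((‖F‖ + ‖G‖) * (ε / D)) := by gcongr
    _ ≤ r^2 * ((‖F‖ + ‖G‖ + 1) * (ε / D)) := by
      have h9 : ‖F‖ + ‖G‖ ≤ ‖F‖ + ‖G‖ + 1 := by linarith
      have h10 : 0 ≤ ε / D := by positivity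
      exact mul_le_mul_of_nonneg_left (mul_le_mul_of_nonneg_right h9 h10) (by positivity)
    _ = D * (ε / D) := by rw [hD]; ring
    _ = ε := by field_simp

/-! ### File U: averaging over the deck group -/

lemma prod_diff (F G : C(Torus2, ℝ)) (ω : ℝ) (a a' b b' : Torus2) (h1 : |F a - F a'| ≤ ω) (h2 : |G b - G b'| ≤ ω) :
    |F a * G b - F a' * G b'| ≤ ω * (‖F‖ + ‖G‖) := by
  have e : F a * G b - F a' * G b' = (F a - F a') * G b + F a' * (G b - G b') := by ring
  rw [e]
  refine (abs_add_le _ _).trans ?_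
  have h3 := abs_mul_le' h1 (cm_bd G b)
  have h4 := abs_mul_le' (cm_bd F a') h2
  calc _ ≤ ω * ‖G‖ + ‖F‖ * ω := add_le_add h3 h4
    _ = _ := by ring

lemma avg_W (r t q K : ℕ) (hq : 0 < q) (F G : C(Torus2, ℝ)) (ω : ℝ) (v v' : Torus2 → Crc) (hv : Measurable v) (hv' : Measurable v')
    (iv : ∀ p (j : ℕ), v (p + tv (j / q)) = v p) (iv' : ∀ p (j : ℕ), v' (p + tv (j / q)) = v' p)
    (hF : ∀ x x' y : Crc, dist x x' ≤ 1 / q → |F (x, y) - F (x', y)| ≤ ω)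
    (hG : ∀ x x' y : Crc, dist x x' ≤ 1 / q → |G (x, y) - G (x', y)| ≤ ω) :
    |(∫ p : Torus2, chi r t p * (F (p.1 + (K:ℤ) • v' p, v' p) * G (p.1 + (K:ℤ) • v p, v p))) -
      ∫ p : Torus2, chi r t p * Psi F G K (v' p, v p)| ≤ ω * (‖F‖ + ‖G‖) := by
  have hqp : (0:ℝ) < q := by exact_mod_cast hq
  let u : Torus2 → Crc → ℝ := fun p x => F (x + (K:ℤ) • v' p, v' p) * G (x + (K:ℤ) • v p, v p)
  have hu : ∀ p, Continuous (u p) := fun p => by simp only [u]; fun_prop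
  have hum : ∀ c : Crc, Measurable fun p : Torus2 => u p (p.1 + c) := fun c => by
    have c1 : Continuous fun z : Torus2 × Crc => F (z.1.1 + (K:ℤ) • z.2, z.2) := by fun_prop
    have c2 : Continuous fun z : Torus2 × Crc => G (z.1.1 + (K:ℤ) • z.2, z.2) := by fun_prop
    have m1 := c1.measurable.comp ((measurable_id.add_const ((c, 0) : Torus2)).prodMk hv')
    have m2 := c2.measurable.comp ((measurable_id.add_const ((c, 0) : Torus2)).prodMk hv)
    exact m1.mul m2
  have hub : ∀ p x, |u p x| ≤ ‖F‖ * ‖G‖ := fun p x => abs_mul_le' (cm_bd _ _) (cm_bd _ _)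
  have hui : ∀ c : Crc, Integrable fun p : Torus2 => chi r t p * u p (p.1 + c) := fun c => chi_mul_int r t _ (hum c) _ fun p => hub p _
  have e1 : ∀ j : ℕ, ∫ p : Torus2, chi r t p * u p p.1 = ∫ p : Torus2, chi r t p * u p (p.1 + ((j * (1 / q : ℝ) : ℝ) : Crc)) := by
    intro j
    have h0 := hui 0
    simp only [add_zero] at h0
    rw [← mp_int (torus_add_mp (tv (j / q))) h0.aestronglyMeasurable]
    congr 1; ext p
    have : u (p + tv (j / q)) = u p := by ext x; simp only [u, iv, iv']
    rw [this]
    have h2 : chi r t (p + tv (j / q)) = chi r t p := by simp [chi, tv]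
    rw [h2]
    simp only [tv, Prod.fst_add, mul_one_div]
  have e2 : ∫ p : Torus2, chi r t p * u p p.1 =
      ∫ p : Torus2, chi r t p * ((1 / q : ℝ) * ∑ j ∈ Finset.range q, u p (p.1 + ((j * (1 / q : ℝ) : ℝ) : Crc))) := by
    have h1 : ∀ p : Torus2, chi r t p * ((1 / q : ℝ) * ∑ j ∈ Finset.range q, u p (p.1 + ((j * (1 / q : ℝ) : ℝ) : Crc))) =
      ∑ j ∈ Finset.range q, (1 / q : ℝ) * (chi r t p * u p (p.1 + ((j * (1 / q : ℝ) : ℝ) : Crc))) := fun p => by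
      rw [Finset.mul_sum, Finset.mul_sum]; exact Finset.sum_congr rfl fun j _ => by ring
    simp_rw [h1]
    rw [integral_finsetSum _ fun j _ => (hui _).const_mul _]
    simp_rw [integral_const_mul, ← e1]
    simp; field_simp
  have hPsi : ∀ p : Torus2, Psi F G K (v' p, v p) = ∫ z in (0:ℝ)..(q * (1 / q : ℝ)), u p (p.1 + (z : Crc)) := fun p => by
    rw [mul_one_div, div_self hqp.ne', ← crc_int (fun z => u p (p.1 + z)), integral_add_left_eq_self (u p) p.1]
    rfl
  have ipsi : Integrable fun p : Torus2 => chi r t p * Psi F G K (v' p, v p) :=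
    chi_mul_int r t _ ((Psi F G K).continuous.measurable.comp (hv'.prodMk hv)) _ fun p => (Psi F G K).norm_coe_le_norm _
  have isum : Integrable fun p : Torus2 => chi r t p * ((1 / q : ℝ) * ∑ j ∈ Finset.range q, u p (p.1 + ((j * (1 / q : ℝ) : ℝ) : Crc))) := by
    have h1 : ∀ p : Torus2, chi r t p * ((1 / q : ℝ) * ∑ j ∈ Finset.range q, u p (p.1 + ((j * (1 / q : ℝ) : ℝ) : Crc))) =
      ∑ j ∈ Finset.range q, (1 / q : ℝ) * (chi r t p * u p (p.1 + ((j * (1 / q : ℝ) : ℝ) : Crc))) := fun p => by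
      rw [Finset.mul_sum, Finset.mul_sum]; exact Finset.sum_congr rfl fun j _ => by ring
    simp_rw [h1]
    exact integrable_finsetSum _ fun j _ => (hui _).const_mul _
  change |(∫ p : Torus2, chi r t p * u p p.1) - _| ≤ _
  rw [e2, ← integral_sub isum ipsi]
  refine int_abs_le _ _ _ (Eventually.of_forall fun p => ?_)
  rw [← mul_sub, hPsi]
  have h5 := riemann_sum (u p) (hu p) (1 / q) (ω * (‖F‖ + ‖G‖)) (by positivity) p.1 (fun x x' hxx => by
    refine prod_diff F G ω _ _ _ _ (hF _ _ _ ?_) (hG _ _ _ ?_)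
    · rwa [dist_add_right]
    · rwa [dist_add_right]) q
  have h6 := abs_mul_le' (chi_abs r t p) h5
  refine h6.trans (le_of_eq ?_)
  field_simp

/-! ### File V: the mixing lemma -/

lemma Cinf_bd (r t q K μ : ℕ) (hr : 0 < r) (hq : 0 < q) (F G : C(Torus2, ℝ)) (ω : ℝ)
    (hF : ∀ x x' y : Crc, dist x x' ≤ 1 / q → |F (x, y) - F (x', y)| ≤ ω)
    (hG : ∀ x x' y : Crc, dist x x' ≤ 1 / q → |G (x, y) - G (x', y)| ≤ ω) :
    |r * (∫ p : Torus2, chi r t p * (F (xsh 0 K (Ginf μ r q (p + tv (1 / (2 * q))))) * G (xsh 0 K (Ginf μ r q p)))) -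
      r * (∫ p : Torus2, chi r t p * Psi F G K ((Ginf μ r q (p + tv (1 / (2 * q)))).2, (Ginf μ r q p).2))| ≤ 2 * r * ω * (‖F‖ + ‖G‖) := by
  have hqp : (0:ℝ) < q := by exact_mod_cast hq
  have hrp : (0:ℝ) < r := by exact_mod_cast hr
  have mG := Ginf_measurable μ r q hq
  have mG' : Measurable fun p : Torus2 => Ginf μ r q (p + tv (1 / (2 * q))) := mG.comp (measurable_id.add_const _)
  have hav := avg_W r t q K hq F G ω (fun p => (Ginf μ r q p).2) (fun p => (Ginf μ r q (p + tv (1 / (2 * q)))).2)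
    (measurable_snd.comp mG) (measurable_snd.comp mG')
    (fun p j => by have := Ginf_period μ r q hq p j; push_cast at this; simp only [this]; simp [tv])
    (fun p j => by
      have := Ginf_period μ r q hq (p + tv (1 / (2 * q))) j
      push_cast at this
      have e : p + tv (j / q) + tv (1 / (2 * q)) = p + tv (1 / (2 * q)) + tv (j / q) := by abel
      simp only [e, this]; simp [tv]) hF hG
  have i1 : Integrable fun p : Torus2 => chi r t p * (F (xsh 0 K (Ginf μ r q (p + tv (1 / (2 * q))))) * G (xsh 0 K (Ginf μ r q p))) :=
    chi_mul_int r t _ ((F.continuous.measurable.comp ((xsh_continuous 0 K).measurable.comp mG')).mul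
      (G.continuous.measurable.comp ((xsh_continuous 0 K).measurable.comp mG))) (‖F‖ * ‖G‖) fun p => abs_mul_le' (cm_bd _ _) (cm_bd _ _)
  have i2 : Integrable fun p : Torus2 => chi r t p * (F (p.1 + (K:ℤ) • (Ginf μ r q (p + tv (1 / (2 * q)))).2, (Ginf μ r q (p + tv (1 / (2 * q)))).2) *
      G (p.1 + (K:ℤ) • (Ginf μ r q p).2, (Ginf μ r q p).2)) := by
    have c1 : ∀ F : C(Torus2, ℝ), Continuous fun z : Torus2 × Crc => F (z.1.1 + (K:ℤ) • z.2, z.2) := fun F => by fun_prop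
    exact chi_mul_int r t _ (((c1 F).measurable.comp (measurable_id.prodMk (measurable_snd.comp mG'))).mul
      ((c1 G).measurable.comp (measurable_id.prodMk (measurable_snd.comp mG)))) (‖F‖ * ‖G‖) fun p => abs_mul_le' (cm_bd _ _) (cm_bd _ _)
  have hd : ∀ p : Torus2, ∃ d : ℝ, |d| ≤ 1 / (2 * q) ∧ (Ginf μ r q p).1 = p.1 + (d : Crc) := fun p => by
    refine ⟨_, ?_, rfl⟩
    rw [abs_div, abs_of_nonneg (by positivity : (0:ℝ) ≤ (8 * μ + 12 : ℕ) * q)]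
    refine div_le_div₀ zero_le_one (dD_bd μ r q hr p).1 (by positivity) ?_
    push_cast; gcongr; linarith [(Nat.cast_nonneg μ : (0:ℝ) ≤ μ)]
  have hbd : |(∫ p : Torus2, chi r t p * (F (xsh 0 K (Ginf μ r q (p + tv (1 / (2 * q))))) * G (xsh 0 K (Ginf μ r q p)))) -
      ∫ p : Torus2, chi r t p * (F (p.1 + (K:ℤ) • (Ginf μ r q (p + tv (1 / (2 * q)))).2, (Ginf μ r q (p + tv (1 / (2 * q)))).2) *
      G (p.1 + (K:ℤ) • (Ginf μ r q p).2, (Ginf μ r q p).2))| ≤ ω * (‖F‖ + ‖G‖) := by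
    rw [← integral_sub i1 i2]
    refine int_abs_le _ _ _ (Eventually.of_forall fun p => ?_)
    rw [← mul_sub]
    refine (abs_mul_le' (chi_abs r t p) (prod_diff F G ω _ _ _ _ (hF _ _ _ ?_) (hG _ _ _ ?_))).trans (one_mul _).le
    · obtain ⟨d, hd1, hd2⟩ := hd (p + tv (1 / (2 * q)))
      simp only [ContinuousMap.zero_apply, AddCircle.coe_zero, add_zero]
      rw [dist_add_right, hd2]
      have := crc_dist_add_coe p.1 (1 / (2 * q) + d) 0
      rw [AddCircle.coe_zero, add_zero, sub_zero, AddCircle.coe_add, ← add_assoc] at this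
      refine le_trans this ((abs_add_le _ _).trans ?_)
      rw [abs_of_nonneg (by positivity : (0:ℝ) ≤ 1 / (2 * q))]
      calc 1 / (2 * q : ℝ) + |d| ≤ 1 / (2 * q) + 1 / (2 * q) := by gcongr
        _ = 1 / q := by field_simp; norm_num
    · obtain ⟨d, hd1, hd2⟩ := hd p
      simp only [ContinuousMap.zero_apply, AddCircle.coe_zero, add_zero]
      rw [dist_add_right, hd2]
      have := crc_dist_add_coe p.1 d 0
      rw [AddCircle.coe_zero, add_zero, sub_zero] at this
      refine this.trans (hd1.trans ?_)
      gcongr; linarith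
  rw [← mul_sub, abs_mul, abs_of_pos hrp]
  calc (r:ℝ) * _ ≤ r * (ω * (‖F‖ + ‖G‖) + ω * (‖F‖ + ‖G‖)) := by
        gcongr
        refine (abs_sub_le _ _ _).trans (add_le_add hbd hav)
    _ = _ := by ring

lemma M_lemma (r q : ℕ) (hr : 0 < r) (hq : 0 < q) (F : ℕ → C(Torus2, ℝ)) (n : ℕ) (ω : ℝ)
    (hF : ∀ j < n, ∀ x x' y : Crc, dist x x' ≤ 1 / q → |F j (x, y) - F j (x', y)| ≤ ω) (ε : ℝ) (hε : 0 < ε) :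
    ∃ e : EMap, e.Good q ∧ (∀ t < r, ∫ p, |chi r t (e.h p) - chi r t p| ≤ ε) ∧
      (∀ x : Crc, dist (e.h (x, 0)) (x, 0) ≤ ε) ∧
      ∀ t < r, ∀ j < n, ∀ k < n, |r * (∫ p : Torus2, chi r t p * (F j (e.h (p + tv (1 / (2 * q)))) * F k (e.h p))) -
        (r * ∫ p : Torus2, chi r t p * F j p) * (r * ∫ p : Torus2, chi r t p * F k p)| ≤ 2 * r * ω * (‖F j‖ + ‖F k‖) + ε := by
  have hrp : (0:ℝ) < r := by exact_mod_cast hr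
  have comb : ∀ (P : ℕ → ℕ → ℕ → ℕ → Prop), (∀ t < r, ∀ j < n, ∀ k < n, ∀ᶠ m in atTop, P t j k m) →
      ∀ᶠ m in atTop, ∀ t < r, ∀ j < n, ∀ k < n, P t j k m := by
    intro P h
    have fin := fun n : ℕ => Set.finite_Iio n
    refine (eventually_all_finite (fin r)).2 fun t ht => ?_
    refine (eventually_all_finite (fin n)).2 fun j hj => ?_
    exact (eventually_all_finite (fin n)).2 fun k hk => h t ht j hj k hk
  obtain ⟨K, hK⟩ := (comb _ fun t _ j _ k _ => psi_lim r t hr (F j) (F k) (ε / 3) (by positivity)).exists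
  obtain ⟨μ, hμ⟩ := (comb _ fun t ht j _ k _ => belt_lim r q t hr hq ht (Psi (F j) (F k) K) (ε / 3) (by positivity)).exists
  obtain ⟨φ, f1, f2, f3⟩ := exists_belt μ r q hr hq (2 * μ + 2)
  have hGl := Ginf_lim μ r q hr hq φ f3
  have hap : ∀ k : ℕ, ∃ e : EMap, e.Good q ∧ ∀ p, dist (e.h p) (xsh 0 K (φ k p)) ≤ 1 / ((k:ℝ) + 1) := fun k =>
    CG.approx hq (CG.xs 0 K rfl _ (f1 k)) _ (by positivity)
  choose e he hd using hap
  have h0 := tendsto_one_div_add_atTop_nhds_zero_nat (𝕜 := ℝ)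
  have hlim : ∀ᵐ p, Tendsto (fun k => (e k).h p) atTop (𝓝 (xsh 0 K (Ginf μ r q p))) := by
    filter_upwards [hGl] with p hp
    rw [tendsto_iff_dist_tendsto_zero]
    refine squeeze_zero' (Eventually.of_forall fun _ => dist_nonneg) ?_ h0
    filter_upwards [hp] with k hk
    rw [← hk]; exact hd k p
  have hlim' : ∀ᵐ p, Tendsto (fun k => (e k).h (p + tv (1 / (2 * q)))) atTop (𝓝 (xsh 0 K (Ginf μ r q (p + tv (1 / (2 * q)))))) :=
    (torus_add_mp (tv (1 / (2 * q)))).quasiMeasurePreserving.ae hlim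
  have hx2 : ∀ p : Torus2, ∀ t, chi r t (xsh 0 K p) = chi r t p := fun p t => by simp [chi, xsh]
  have ev1 : ∀ᶠ k in atTop, ∀ t < r, ∫ p, |chi r t ((e k).h p) - chi r t p| ≤ ε := by
    refine (eventually_all_finite (Set.finite_Iio r)).2 fun t ht => ?_
    have := chi_lim r t (fun k => (e k).h) (fun k => (e k).h.continuous.measurable) _ hlim (Ginf_ne μ r q hr)
      (Eventually.of_forall fun p => by rw [hx2, Ginf_chi μ r q t hr])
    filter_upwards [this.eventually (gt_mem_nhds hε)] with k hk using hk.le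
  have ev2 : ∀ᶠ k : ℕ in atTop, 1 / ((k:ℝ) + 1) ≤ ε := by
    filter_upwards [h0.eventually (gt_mem_nhds hε)] with k hk using hk.le
  have ev3 : ∀ᶠ m in atTop, ∀ t < r, ∀ j < n, ∀ k < n,
      |r * (∫ p : Torus2, chi r t p * (F j ((e m).h (p + tv (1 / (2 * q)))) * F k ((e m).h p))) -
        r * (∫ p : Torus2, chi r t p * (F j (xsh 0 K (Ginf μ r q (p + tv (1 / (2 * q))))) * F k (xsh 0 K (Ginf μ r q p))))| ≤ ε / 3 := by
    refine comb _ fun t _ j _ k _ => ?_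
    have hc : Tendsto (fun m => r * (∫ p : Torus2, chi r t p * (F j ((e m).h (p + tv (1 / (2 * q)))) * F k ((e m).h p)))) atTop
        (𝓝 (r * (∫ p : Torus2, chi r t p * (F j (xsh 0 K (Ginf μ r q (p + tv (1 / (2 * q))))) * F k (xsh 0 K (Ginf μ r q p)))))) := by
      refine Tendsto.const_mul _ ?_
      refine tendsto_integral_of_dominated_convergence (fun _ => 1 * (‖F j‖ * ‖F k‖)) ?_ (integrable_const _) ?_ ?_
      · intro m
        have c1 : Continuous fun p : Torus2 => F j ((e m).h (p + tv (1 / (2 * q)))) * F k ((e m).h p) := by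
          have := (e m).h.continuous
          fun_prop
        exact ((chi_measurable r t).mul c1.measurable).aestronglyMeasurable
      · exact fun m => Eventually.of_forall fun p => abs_mul_le' (chi_abs _ _ _) (abs_mul_le' (cm_bd _ _) (cm_bd _ _))
      · filter_upwards [hlim, hlim'] with p h1 h2
        exact Tendsto.const_mul _ ((((F j).continuous.tendsto _).comp h2).mul (((F k).continuous.tendsto _).comp h1))
    have := (Metric.tendsto_nhds.1 hc) (ε / 3) (by positivity)
    filter_upwards [this] with m hm
    rw [Real.dist_eq] at hm; exact hm.le
  obtain ⟨m, h1, h2, h3⟩ := (ev1.and (ev2.and ev3)).exists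
  refine ⟨e m, he m, h1, fun x => ?_, fun t ht j hj k hk => ?_⟩
  · have := hd m (x, 0)
    rw [f2] at this
    have e0 : xsh 0 K ((x, 0) : Torus2) = (x, 0) := by simp [xsh]
    rw [e0] at this; exact this.trans h2
  · have a1 := h3 t ht j hj k hk
    have a2 := Cinf_bd r t q K μ hr hq (F j) (F k) ω (hF j hj) (hF k hk)
    have a3 := hμ t ht j hj k hk
    have a4 := hK t ht j hj k hk
    rw [abs_le] at *
    constructor <;> linarith [a1.1, a1.2, a2.1, a2.2, a3.1, a3.2, a4.1, a4.2]

/-! ### File W: states of the inductive construction -/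

structure St where
  H : EMap
  p : ℕ
  q : ℕ
  hq : 0 < q
  H0 : H.h 0 = 0

def St.al (s : St) : ℝ := s.p / s.q

def St.next (s : St) (h : EMap) (hh : h.Good s.q) (k : ℕ) : St where
  H := s.H.comp h
  p := 2 * (k + 1) * s.q * s.p + 1
  q := 2 * (k + 1) * s.q ^ 2
  hq := by have := s.hq; positivity
  H0 := by simp [hh.2, s.H0]

def St.del (s : St) (k : ℕ) : ℝ := 1 / (2 * (k + 1) * s.q ^ 2)

lemma St.next_al (s : St) (h : EMap) (hh : h.Good s.q) (k : ℕ) : (s.next h hh k).al = s.al + s.del k := by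
  have hq : (0:ℝ) < s.q := by exact_mod_cast s.hq
  unfold St.al St.next St.del
  push_cast
  field_simp

lemma St.del_pos (s : St) (k : ℕ) : 0 < s.del k := by
  have hq : (0:ℝ) < s.q := by exact_mod_cast s.hq
  unfold St.del; positivity

lemma St.del_lim (s : St) : Tendsto s.del atTop (𝓝 0) := by
  have hq : (1:ℝ) ≤ s.q := by exact_mod_cast s.hq
  refine squeeze_zero (fun k => (s.del_pos k).le) (fun k => ?_) (tendsto_one_div_add_atTop_nhds_zero_nat (𝕜 := ℝ))
  unfold St.del
  apply one_div_le_one_div_of_le (by positivity)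
  have : (1:ℝ) ≤ (s.q:ℝ) ^ 2 := one_le_pow₀ hq
  nlinarith [(Nat.cast_nonneg k : (0:ℝ) ≤ k)]

def ep (n : ℕ) : ℝ := (1 / 2) ^ n

lemma ep_pos (n) : 0 < ep n := by unfold ep; positivity

def fH (H : EMap) (F : C(Torus2, ℝ)) : C(Torus2, ℝ) := F.comp ⟨H.h, H.h.continuous⟩

lemma fH_apply (H F p) : fH H F p = F (H.h p) := rfl

lemma fH_norm (H : EMap) (F) : ‖fH H F‖ ≤ ‖F‖ :=
  (ContinuousMap.norm_le _ (norm_nonneg _)).2 fun p => F.norm_coe_le_norm _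

def sl (G : C(Torus2, ℝ)) (y : Crc) : C(Crc, ℝ) := ⟨fun x => G (x, y), by fun_prop⟩

lemma sl_apply (G y x) : sl G y x = G (x, y) := rfl

def Phi (G : C(Torus2, ℝ)) : C(Crc, ℝ) where
  toFun y := ∫ s : Crc, G (s, y)
  continuous_toFun := by
    refine continuous_of_dominated (bound := fun _ => ‖G‖) ?_ ?_ (integrable_const _) ?_
    · intro u
      have : Continuous fun s : Crc => G (s, u) := by fun_prop
      exact this.aestronglyMeasurable
    · exact fun u => Eventually.of_forall fun s => cm_bd G _
    · exact Eventually.of_forall fun s => by fun_prop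

lemma Phi_apply (G y) : Phi G y = ∫ s : Crc, G (s, y) := rfl

lemma cm_integrable (G : C(Torus2, ℝ)) : Integrable G :=
  Integrable.of_bound G.continuous.aestronglyMeasurable ‖G‖ (Eventually.of_forall fun p => cm_bd G p)

lemma Phi_int (G : C(Torus2, ℝ)) : ∫ y, Phi G y = ∫ p, G p := by
  have := integral_prod_symm (μ := (volume : Measure Crc)) (ν := (volume : Measure Crc)) G (cm_integrable G)
  exact this.symm

lemma fH_int (H : EMap) (F : C(Torus2, ℝ)) : ∫ p, fH H F p = ∫ p, F p :=
  mp_int H.mp F.continuous.aestronglyMeasurable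

def Ls (f : ℕ → C(Torus2, ℝ)) (n : ℕ) (s : St) : ℕ :=
  n + s.q + ∑ j ∈ Finset.range n, ⌈2 * s.q * ‖f j‖ * 2 ^ n⌉₊

structure StInv (f : ℕ → C(Torus2, ℝ)) (n : ℕ) (s : St) : Prop where
  mod : ∀ x x' y : Crc, dist x x' ≤ 4 / s.q → dist (s.H.h (x, y)) (s.H.h (x', y)) ≤ ep n
  modf : ∀ j < n, ∀ x x' y : Crc, dist x x' ≤ 4 / s.q → |f j (s.H.h (x, y)) - f j (s.H.h (x', y))| ≤ ep n
  er : ∀ j < n, ∀ y x : Crc, |ubar (sl (fH s.H (f j)) y) s.p s.q x - Phi (fH s.H (f j)) y| ≤ ep n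

lemma cont_ev {Z : Type*} [PseudoMetricSpace Z] (g : Torus2 → Z) (hg : Continuous g) (c ε : ℝ) (hε : 0 < ε) :
    ∀ᶠ k : ℕ in atTop, ∀ x x' y : Crc, dist x x' ≤ c * (1 / ((k:ℝ) + 1)) → dist (g (x, y)) (g (x', y)) ≤ ε := by
  obtain ⟨δ, hδ, h⟩ := Metric.uniformContinuous_iff.1 (CompactSpace.uniformContinuous_of_continuous hg) ε hε
  have h0 := (tendsto_one_div_add_atTop_nhds_zero_nat (𝕜 := ℝ)).const_mul c
  rw [mul_zero] at h0
  filter_upwards [h0.eventually (gt_mem_nhds hδ)] with k hk x x' y hx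
  refine (h ?_).le
  rw [Prod.dist_eq, dist_self]
  exact max_lt (hx.trans_lt hk) hδ

lemma ubar_int (u : C(Crc, ℝ)) (p q : ℕ) (hq : 0 < q) (x : Crc) : ∫ z in (0:ℝ)..1, ubar u p q (x + (z : Crc)) = ∫ s, u s := by
  have hqp : (0:ℝ) < q := by exact_mod_cast hq
  rw [← crc_int (fun z => ubar u p q (x + z)), integral_add_left_eq_self (ubar u p q) x]
  unfold ubar
  have hi : ∀ c : Crc, Integrable fun y : Crc => u (y + c) := fun c =>
    Integrable.of_bound (by fun_prop : Continuous fun y : Crc => u (y + c)).aestronglyMeasurable ‖u‖ (Eventually.of_forall fun p => u.norm_coe_le_norm _)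
  rw [integral_const_mul, integral_finsetSum _ fun j _ => hi _]
  simp_rw [integral_add_right_eq_self (fun y => u y)]
  simp; field_simp

lemma ubar_shift (G : C(Torus2, ℝ)) (h : EMap) (p q : ℕ) (hh : h.Good q) (x y : Crc) :
    ubar (sl (fH h G) y) p q x = ubar (sl G (h.h (x, y)).2) p q (h.h (x, y)).1 := by
  unfold ubar
  congr 1
  refine Finset.sum_congr rfl fun l _ => ?_
  have := hh.commT ((l * p : ℕ) : ℤ) (x, y)
  have e1 : (((l * p : ℕ) : ℤ) : ℝ) / q = l * (p / q : ℝ) := by push_cast; ring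
  rw [e1] at this
  rw [sl_apply, sl_apply, fH_apply]
  have e2 : ((x + ((l * (p / q : ℝ) : ℝ) : Crc), y) : Torus2) = (x, y) + tv (l * (p / q : ℝ)) := by simp [tv]
  rw [e2, this]
  congr 1
  ext <;> simp [tv]

lemma fH_comp (H h : EMap) (F) : fH (H.comp h) F = fH h (fH H F) := by
  ext p; simp [fH_apply]

lemma interval_avg_diff (g1 g2 : ℝ → ℝ) (h1 : Continuous g1) (h2 : Continuous g2) (ε Z : ℝ) (hZ : 0 < Z) (h : ∀ z, |g1 z - g2 z| ≤ ε) :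
    |Z⁻¹ * (∫ z in (0:ℝ)..Z, g1 z) - Z⁻¹ * ∫ z in (0:ℝ)..Z, g2 z| ≤ ε := by
  rw [← mul_sub, ← intervalIntegral.integral_sub (h1.intervalIntegrable _ _) (h2.intervalIntegrable _ _), abs_mul, abs_of_pos (inv_pos.2 hZ)]
  have := intervalIntegral.norm_integral_le_of_norm_le_const (a := 0) (b := Z) (f := fun z => g1 z - g2 z) (C := ε) (fun z _ => h z)
  rw [Real.norm_eq_abs, sub_zero, abs_of_pos hZ] at this
  calc Z⁻¹ * |∫ z in (0:ℝ)..Z, (g1 z - g2 z)| ≤ Z⁻¹ * (ε * Z) := by gcongr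
    _ = ε := by field_simp

/-- curve average versus the orbit integral -/
def cav (s : St) (f : C(Torus2, ℝ)) (h : EMap) (Z : ℝ) : ℝ := Z⁻¹ * ∫ z in (0:ℝ)..Z, Phi (fH s.H f) (h.h ((z : Crc), 0)).2

lemma cav_cont (s : St) (f : C(Torus2, ℝ)) (h : EMap) : Continuous fun z : ℝ => Phi (fH s.H f) (h.h ((z : Crc), 0)).2 := by
  have := continuous_crc_coe
  have := h.h.continuous
  fun_prop

lemma cav_ubar (f n s) (hI : StInv f n s) (h : EMap) (hh : h.Good s.q) (j) (hj : j < n) (Z : ℝ) (hZ : 0 < Z) :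
    |Z⁻¹ * (∫ z in (0:ℝ)..Z, ubar (sl (fH (s.H.comp h) (f j)) 0) s.p s.q (0 + (z : Crc))) - cav s (f j) h Z| ≤ ep n := by
  refine interval_avg_diff _ _ ?_ (cav_cont _ _ _) _ _ hZ fun z => ?_
  · have := continuous_crc_coe
    have := ubar_continuous (sl (fH (s.H.comp h) (f j)) 0) s.p s.q
    fun_prop
  · rw [fH_comp, ubar_shift _ _ _ _ hh, zero_add]
    exact hI.er j hj _ _

lemma Phi_next (f n s) (hI : StInv f n s) (h : EMap) (hh : h.Good s.q) (j) (hj : j < n) :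
    |Phi (fH (s.H.comp h) (f j)) 0 - cav s (f j) h 1| ≤ ep n := by
  have := cav_ubar f n s hI h hh j hj 1 one_pos
  rw [ubar_int _ _ _ s.hq, inv_one, one_mul] at this
  exact this

/-! ### File X: eventual properties of the next state -/

lemma St.q_ge (s : St) : (1:ℝ) ≤ s.q := by exact_mod_cast s.hq

lemma St.next_q (s : St) (h : EMap) (hh : h.Good s.q) (k : ℕ) : ((s.next h hh k).q : ℝ) = 2 * (k + 1) * (s.q:ℝ) ^ 2 := by
  simp [St.next]

lemma St.next_H (s : St) (h : EMap) (hh : h.Good s.q) (k : ℕ) : (s.next h hh k).H = s.H.comp h := rfl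

lemma St.q_del (s : St) (k : ℕ) : s.q * s.del k ≤ 4 * (1 / ((k:ℝ) + 1)) := by
  have hq1 := s.q_ge
  have hk : (0:ℝ) < (k:ℝ) + 1 := by positivity
  unfold St.del
  rw [mul_one_div, mul_one_div, div_le_div_iff₀ (by positivity) hk]
  have : (s.q:ℝ) ≤ (s.q:ℝ) ^ 2 := by nlinarith
  nlinarith

lemma sl_fH_bd (H : EMap) (F : C(Torus2, ℝ)) (y x : Crc) : |sl (fH H F) y x| ≤ ‖F‖ := (cm_bd (fH H F) (x, y)).trans (fH_norm _ _)

lemma ext_inv (f n) (s : St) (h : EMap) (hh : h.Good s.q) : ∀ᶠ k in atTop, StInv f (n + 1) (s.next h hh k) := by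
  have hq1 := s.q_ge
  set e' := ep (n + 1) with he'
  have he0 : 0 < e' := ep_pos _
  have ev1 := cont_ev (s.H.comp h).h (s.H.comp h).h.continuous 4 e' he0
  have ev2 : ∀ᶠ k : ℕ in atTop, ∀ j < n + 1, ∀ x x' y : Crc, dist x x' ≤ 4 * (1 / ((k:ℝ) + 1)) →
      dist (fH (s.H.comp h) (f j) (x, y)) (fH (s.H.comp h) (f j) (x', y)) ≤ e' / 4 :=
    (eventually_all_finite (Set.finite_Iio (n + 1))).2 fun j _ =>
      cont_ev (fH (s.H.comp h) (f j)) (fH (s.H.comp h) (f j)).continuous 4 (e' / 4) (by positivity)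
  have ev3 : ∀ᶠ k : ℕ in atTop, ∀ j < n + 1, ‖f j‖ * (1 / ((k:ℝ) + 1)) ≤ e' / 2 := by
    refine (eventually_all_finite (Set.finite_Iio (n + 1))).2 fun j _ => ?_
    have h0 := (tendsto_one_div_add_atTop_nhds_zero_nat (𝕜 := ℝ)).const_mul ‖f j‖
    rw [mul_zero] at h0
    filter_upwards [h0.eventually (gt_mem_nhds (show 0 < e' / 2 by positivity))] with k hk using hk.le
  filter_upwards [ev1, ev2, ev3] with k h1 h2 h3
  have hk : (0:ℝ) < (k:ℝ) + 1 := by positivity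
  have hle : 4 / ((s.next h hh k).q : ℝ) ≤ 4 * (1 / ((k:ℝ) + 1)) := by
    rw [s.next_q, mul_one_div]
    apply div_le_div_of_nonneg_left (by norm_num) hk
    have : (1:ℝ) ≤ (s.q:ℝ) ^ 2 := one_le_pow₀ hq1
    nlinarith
  refine ⟨fun x x' y hx => h1 x x' y (hx.trans hle), fun j hj x x' y hx => ?_, fun j hj y x => ?_⟩
  · have := h2 j hj x x' y (hx.trans hle)
    rw [Real.dist_eq] at this
    exact this.trans (by linarith)
  · have hom : ∀ a b : Crc, dist a b ≤ s.q * s.del k → |sl (fH (s.H.comp h) (f j)) y a - sl (fH (s.H.comp h) (f j)) y b| ≤ e' / 4 := fun a b hab => by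
      have := h2 j hj a b y (hab.trans (s.q_del k))
      rw [Real.dist_eq] at this; exact this
    have hb := block (sl (fH (s.H.comp h) (f j)) y) s.p s.q s.hq (s.del k) (s.del_pos k) (e' / 4) ‖f j‖ hom (sl_fH_bd _ _ _) (s.next h hh k).q (s.next h hh k).hq x
    have e1 : ((s.next h hh k).q : ℝ) * s.del k = 1 := by
      rw [s.next_q]; unfold St.del; field_simp
    rw [e1, ubar_int _ _ _ s.hq, inv_one, one_mul] at hb
    have e2 : (s.p / s.q : ℝ) + s.del k = (s.next h hh k).p / (s.next h hh k).q := (s.next_al h hh k).symm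
    rw [e2] at hb
    refine hb.trans ?_
    have e3 : 2 * (s.q:ℝ) * ‖f j‖ / (s.next h hh k).q ≤ ‖f j‖ * (1 / ((k:ℝ) + 1)) := by
      rw [s.next_q, mul_one_div, div_le_div_iff₀ (by positivity) hk]
      have : (s.q:ℝ) ≤ (s.q:ℝ) ^ 2 := by nlinarith
      have h9 : 0 ≤ ‖f j‖ * (k + 1) := by positivity
      nlinarith
    have := h3 j hj
    linarith

lemma ext_c1 (n : ℕ) (s : St) (h : EMap) (hh : h.Good s.q) : ∀ᶠ k in atTop, ∀ z : ℂ × ℂ, ‖z‖ ≤ n →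
    ‖(s.next h hh k).H.rotC (s.next h hh k).al z - s.H.rotC s.al z‖ ≤ ep n ∧
    ‖(s.next h hh k).H.rotC (-(s.next h hh k).al) z - s.H.rotC (-s.al) z‖ ≤ ep n := by
  have hl : Tendsto (fun k => s.al + s.del k) atTop (𝓝 s.al) := by simpa using s.del_lim.const_add s.al
  have hl' : Tendsto (fun k => -(s.al + s.del k)) atTop (𝓝 (-s.al)) := hl.neg
  have hK := isCompact_closedBall (0 : ℂ × ℂ) (n : ℝ)
  have h1 := hl.eventually (unif_ev _ (s.H.comp h).rotC_continuous2 _ hK s.al (ep n) (ep_pos n))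
  have h2 := hl'.eventually (unif_ev _ (s.H.comp h).rotC_continuous2 _ hK (-s.al) (ep n) (ep_pos n))
  filter_upwards [h1, h2] with k h1 h2 z hz
  have hz' : z ∈ Metric.closedBall (0 : ℂ × ℂ) (n:ℝ) := by simpa using hz
  have a1 := h1 z hz'
  have a2 := h2 z hz'
  rw [dist_eq_norm] at a1 a2
  have e1 := hh.rotC_comp s.H s.p z
  have e2 := hh.rotC_comp s.H (-s.p) z
  have e3 : ((s.p : ℤ) : ℝ) / s.q = s.al := by simp [St.al]
  have e4 : ((-(s.p : ℤ) : ℤ) : ℝ) / s.q = -s.al := by simp [St.al, neg_div]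
  rw [e3] at e1; rw [e4] at e2
  simp only [e1, e2] at a1 a2
  rw [s.next_al, s.next_H]
  exact ⟨a1, a2⟩

lemma ext_c2 (n : ℕ) (s : St) (h : EMap) (hh : h.Good s.q) (i : ℤ) : ∀ᶠ k in atTop, ∀ x,
    dist ((s.next h hh k).H.rot (i * (s.next h hh k).al) x) (s.H.rot (i * s.al) x) ≤ ep n := by
  have hl : Tendsto (fun k => i * (s.al + s.del k)) atTop (𝓝 (i * s.al)) := by
    simpa using (s.del_lim.const_add s.al).const_mul (i:ℝ)
  have h1 := hl.eventually (unif_ev _ (s.H.comp h).rot_continuous2 _ isCompact_univ (i * s.al) (ep n) (ep_pos n))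
  filter_upwards [h1] with k h1 x
  have a1 := h1 x (Set.mem_univ _)
  have e1 := hh.rot_comp s.H (i * s.p) x
  have e3 : (((i * s.p : ℤ)) : ℝ) / s.q = i * s.al := by simp [St.al]; ring
  rw [e3] at e1
  simp only [e1] at a1
  rw [s.next_al, s.next_H]
  exact a1

lemma ext_lm (f n) (s : St) (h : EMap) (hh : h.Good s.q) (k) : Ls f n s ≤ Ls f (n + 1) (s.next h hh k) := by
  unfold Ls
  have hq : s.q ≤ (s.next h hh k).q := by
    have := s.hq
    show s.q ≤ 2 * (k + 1) * s.q ^ 2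
    nlinarith [Nat.zero_le k, Nat.zero_le (k * s.q ^ 2)]
  have hqr : (s.q : ℝ) ≤ (s.next h hh k).q := by exact_mod_cast hq
  have : ∑ j ∈ Finset.range n, ⌈2 * (s.q:ℝ) * ‖f j‖ * 2 ^ n⌉₊ ≤ ∑ j ∈ Finset.range (n + 1), ⌈2 * ((s.next h hh k).q:ℝ) * ‖f j‖ * 2 ^ (n + 1)⌉₊ := by
    rw [Finset.sum_range_succ]
    refine (Finset.sum_le_sum fun j _ => ?_).trans (Nat.le_add_right _ _)
    apply Nat.ceil_mono
    gcongr
    · norm_num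
    · omega
  omega

lemma rot_zero_orbit (s : St) (a : ℝ) : s.H.rot a 0 = s.H.h ((a : Crc), 0) := by
  have : s.H.h.symm 0 = 0 := by
    rw [Homeomorph.symm_apply_eq, s.H0]
  simp [EMap.rot, this, tv]

lemma ext_gen (f n) (s : St) (hI : StInv f n s) (h : EMap) (hh : h.Good s.q) : ∀ᶠ k in atTop, ∀ j < n, ∀ N, Ls f n s ≤ N →
    |(N:ℝ)⁻¹ * (∑ i ∈ Finset.range N, f j ((s.next h hh k).H.rot (i * (s.next h hh k).al) 0)) - cav s (f j) h (N * s.del k)| ≤ 4 * ep n := by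
  have hq1 := s.q_ge
  have ev2 : ∀ᶠ k : ℕ in atTop, ∀ j < n, ∀ x x' y : Crc, dist x x' ≤ 4 * (1 / ((k:ℝ) + 1)) →
      dist (fH (s.H.comp h) (f j) (x, y)) (fH (s.H.comp h) (f j) (x', y)) ≤ ep n :=
    (eventually_all_finite (Set.finite_Iio n)).2 fun j _ =>
      cont_ev (fH (s.H.comp h) (f j)) (fH (s.H.comp h) (f j)).continuous 4 (ep n) (ep_pos n)
  filter_upwards [ev2] with k h2 j hj N hN
  have hk : (0:ℝ) < (k:ℝ) + 1 := by positivity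
  have hNq : 0 < N := by
    have := s.hq
    unfold Ls at hN; omega
  have hNp : (0:ℝ) < N := by exact_mod_cast hNq
  have hom : ∀ a b : Crc, dist a b ≤ s.q * s.del k → |sl (fH (s.H.comp h) (f j)) 0 a - sl (fH (s.H.comp h) (f j)) 0 b| ≤ ep n := fun a b hab => by
    have := h2 j hj a b 0 (hab.trans (s.q_del k))
    rw [Real.dist_eq] at this; exact this
  have hb := block (sl (fH (s.H.comp h) (f j)) 0) s.p s.q s.hq (s.del k) (s.del_pos k) (ep n) ‖f j‖ hom (sl_fH_bd _ _ _) N hNq 0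
  have hc := cav_ubar f n s hI h hh j hj (N * s.del k) (mul_pos hNp (s.del_pos k))
  have e1 : ∀ i : ℕ, f j ((s.next h hh k).H.rot (i * (s.next h hh k).al) 0) =
      sl (fH (s.H.comp h) (f j)) 0 (0 + ((i * (s.p / s.q + s.del k) : ℝ) : Crc)) := fun i => by
    rw [rot_zero_orbit, s.next_al, zero_add]; rfl
  simp_rw [e1]
  have e3 : 2 * (s.q:ℝ) * ‖f j‖ / N ≤ ep n := by
    rw [div_le_iff₀ hNp]
    have h5 : ⌈2 * (s.q:ℝ) * ‖f j‖ * 2 ^ n⌉₊ ≤ N := by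
      have := Finset.single_le_sum (f := fun j => ⌈2 * (s.q:ℝ) * ‖f j‖ * 2 ^ n⌉₊) (fun _ _ => Nat.zero_le _) (Finset.mem_range.2 hj)
      unfold Ls at hN
      omega
    have h6 := Nat.ceil_le.1 h5
    have h7 : ep n * 2 ^ n = 1 := by unfold ep; rw [← mul_pow]; norm_num
    calc 2 * (s.q:ℝ) * ‖f j‖ = ep n * (2 * (s.q:ℝ) * ‖f j‖ * 2 ^ n) := by linear_combination (-(2 * (s.q:ℝ) * ‖f j‖)) * h7
      _ ≤ ep n * N := by have := ep_pos n; gcongr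
  rw [abs_le] at *
  constructor <;> linarith [hb.1, hb.2, hc.1, hc.2]

/-! ### File Y: the inductive step -/

def dev (s : St) (F : C(Torus2, ℝ)) : ℝ := |Phi (fH s.H F) 0 - ∫ p, F p|

structure Stp0 (f : ℕ → C(Torus2, ℝ)) (r n : ℕ) (s s' : St) : Prop where
  c1 : ∀ z : ℂ × ℂ, ‖z‖ ≤ n → ‖s'.H.rotC s'.al z - s.H.rotC s.al z‖ ≤ ep n ∧ ‖s'.H.rotC (-s'.al) z - s.H.rotC (-s.al) z‖ ≤ ep n
  c2 : ∀ i : ℕ, i ≤ Ls f n s → ∀ x, dist (s'.H.rot (i * s'.al) x) (s.H.rot (i * s.al) x) ≤ ep n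
  c2' : ∀ x, dist (s'.H.rot (-s'.al) x) (s.H.rot (-s.al) x) ≤ ep n
  lm : Ls f n s ≤ Ls f (n + 1) s'
  hs : ∃ h : EMap, s'.H = s.H.comp h ∧ ∀ t < r, ∫ p, |chi r t (h.h p) - chi r t p| ≤ ep n
  gen : ∀ j < n, ∀ N, Ls f n s ≤ N → |(N:ℝ)⁻¹ * (∑ i ∈ Finset.range N, f j (s'.H.rot (i * s'.al) 0)) - ∫ p, f j p| ≤ dev s (f j) + 5 * ep n

structure Stp (f : ℕ → C(Torus2, ℝ)) (r n : ℕ) (s s' : St) : Prop extends Stp0 f r n s s' where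
  dv1 : Odd n → ∀ j < n, dev s' (f j) ≤ 2 * ep n
  dv2 : ∀ j < n, dev s' (f j) ≤ dev s (f j) + 2 * ep n
  mnl : Odd n → ∀ x y, ∃ i : ℕ, i ≤ Ls f (n + 1) s' ∧ dist (s'.H.rot (i * s'.al) x) y ≤ 3 * ep n
  mix : Even n → ∃ m : ℕ, n ≤ m ∧ m ≤ Ls f (n + 1) s' ∧ ∀ t < r, ∀ j < n, ∀ k < n,
    |r * (∫ p : Torus2, chi r t p * (f j (s'.H.rot (m * s'.al) (s'.H.h p)) * f k (s'.H.h p))) -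
      (r * ∫ p : Torus2, chi r t p * f j (s.H.h p)) * (r * ∫ p : Torus2, chi r t p * f k (s.H.h p))| ≤ 2 * r * ep n * (‖f j‖ + ‖f k‖) + ep n

lemma ext_all (f r n) (s : St) (hI : StInv f n s) (h : EMap) (hh : h.Good s.q)
    (hc : ∀ t < r, ∫ p, |chi r t (h.h p) - chi r t p| ≤ ep n)
    (D1 : ∀ j < n, ∀ Z > 0, |cav s (f j) h Z - ∫ p, f j p| ≤ dev s (f j) + ep n) :
    ∀ᶠ k in atTop, StInv f (n + 1) (s.next h hh k) ∧ Stp0 f r n s (s.next h hh k) := by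
  have e2 : ∀ᶠ k in atTop, ∀ i ≤ Ls f n s, ∀ x, dist ((s.next h hh k).H.rot (((i:ℕ):ℤ) * (s.next h hh k).al) x) (s.H.rot (((i:ℕ):ℤ) * s.al) x) ≤ ep n :=
    (eventually_all_finite (Set.finite_Iic (Ls f n s))).2 fun i _ => ext_c2 n s h hh i
  filter_upwards [ext_inv f n s h hh, ext_c1 n s h hh, e2, ext_c2 n s h hh (-1), ext_gen f n s hI h hh] with k h1 h2 h3 h4 h5
  refine ⟨h1, h2, ?_, ?_, ext_lm f n s h hh k, ⟨h, rfl, hc⟩, fun j hj N hN => ?_⟩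
  · intro i hi x; have := h3 i hi x; push_cast at this; exact this
  · intro x; have := h4 x; push_cast at this; simpa using this
  · have a1 := h5 j hj N hN
    have hN' : (0:ℝ) < N := by
      have := s.hq
      unfold Ls at hN; exact_mod_cast (by omega : 0 < N)
    have a2 := D1 j hj (N * s.del k) (mul_pos hN' (s.del_pos k))
    rw [abs_le] at *
    constructor <;> linarith [a1.1, a1.2, a2.1, a2.2]

lemma dev_next (f n) (s : St) (hI : StInv f n s) (h : EMap) (hh : h.Good s.q) (k j) (hj : j < n) (c : ℝ)
    (hc : |cav s (f j) h 1 - ∫ p, f j p| ≤ c) : dev (s.next h hh k) (f j) ≤ c + ep n := by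
  have := Phi_next f n s hI h hh j hj
  unfold dev
  rw [s.next_H]
  rw [abs_le] at *
  constructor <;> linarith [this.1, this.2, hc.1, hc.2]

lemma step_M (f r n) (hr : 0 < r) (s : St) (hI : StInv f n s) (hn : Even n) : ∃ s', StInv f (n + 1) s' ∧ Stp f r n s s' := by
  have hq1 := s.q_ge
  have hqp : (0:ℝ) < s.q := by linarith
  have e0 := ep_pos n
  obtain ⟨η, hη, hη2⟩ : ∃ η > 0, ∀ j < n, ∀ y : Crc, dist y 0 ≤ η → |Phi (fH s.H (f j)) y - Phi (fH s.H (f j)) 0| ≤ ep n := by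
    have h1 : ∀ᶠ y in 𝓝 (0 : Crc), ∀ j < n, |Phi (fH s.H (f j)) y - Phi (fH s.H (f j)) 0| ≤ ep n := by
      refine (eventually_all_finite (Set.finite_Iio n)).2 fun j _ => ?_
      have := Metric.tendsto_nhds.1 ((Phi (fH s.H (f j))).continuous.tendsto 0) (ep n) e0
      filter_upwards [this] with y hy
      rw [Real.dist_eq] at hy; exact hy.le
    obtain ⟨η, hη, h2⟩ := Metric.nhds_basis_closedBall.eventually_iff.1 h1
    exact ⟨η, hη, fun j hj y hy => h2 hy j hj⟩
  obtain ⟨h, hh, m1, m2, m3⟩ := M_lemma r s.q hr s.hq (fun j => fH s.H (f j)) n (ep n) (fun j hj x x' y hx => hI.modf j hj x x' y (hx.trans (by gcongr; norm_num)))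
    (min (ep n) η) (lt_min e0 hη)
  have D1 : ∀ j < n, ∀ Z > 0, |cav s (f j) h Z - ∫ p, f j p| ≤ dev s (f j) + ep n := by
    intro j hj Z hZ
    have a1 := interval_avg_diff _ (fun _ => Phi (fH s.H (f j)) 0) (cav_cont s (f j) h) continuous_const (ep n) Z hZ (fun z => by
      refine hη2 j hj _ ?_
      have := m2 (z : Crc)
      rw [Prod.dist_eq] at this
      exact (le_max_right _ _).trans (this.trans (min_le_right _ _)))
    have e1 : Z⁻¹ * ∫ z in (0:ℝ)..Z, Phi (fH s.H (f j)) 0 = Phi (fH s.H (f j)) 0 := by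
      simp; field_simp
    rw [e1] at a1
    unfold dev
    exact (abs_sub_le _ _ _).trans (by rw [add_comm]; gcongr; exact a1)
  obtain ⟨k, ⟨h1, h2⟩, hk⟩ := ((ext_all f r n s hI h hh (fun t ht => (m1 t ht).trans (min_le_left _ _)) D1).and (eventually_ge_atTop n)).exists
  refine ⟨_, h1, h2, fun ho => absurd hn (Nat.not_even_iff_odd.2 ho), fun j hj => ?_, fun ho => absurd hn (Nat.not_even_iff_odd.2 ho), fun _ => ?_⟩
  · have := dev_next f n s hI h hh k j hj _ (D1 j hj 1 one_pos)
    linarith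
  · refine ⟨(k + 1) * s.q, ?_, ?_, ?_⟩
    · have := s.hq; nlinarith
    · have : (k + 1) * s.q ≤ (s.next h hh k).q := by
        show (k + 1) * s.q ≤ 2 * (k + 1) * s.q ^ 2
        have := s.hq
        have h3 : s.q ≤ s.q ^ 2 := by nlinarith
        nlinarith [Nat.zero_le (k * s.q ^ 2)]
      unfold Ls; omega
    · intro t ht j hj l hl
      have a := m3 t ht j hj l hl
      have e1 : ∀ p : Torus2, (s.next h hh k).H.rot (((k + 1) * s.q : ℕ) * (s.next h hh k).al) ((s.next h hh k).H.h p) = s.H.h (h.h (p + tv (1 / (2 * s.q)))) := by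
        intro p
        have e2 : (((k + 1) * s.q : ℕ) * (s.next h hh k).al : ℝ) = (((k + 1) * s.p : ℕ) : ℤ) + 1 / (2 * s.q) := by
          rw [s.next_al]; unfold St.al St.del; push_cast; field_simp
        rw [e2]
        simp only [EMap.rot, Homeomorph.symm_apply_apply, tv_add, tv_int, zero_add]
        simp only [s.next_H, EMap.comp_h]
      simp only [e1]
      simp only [fH_apply] at a
      refine a.trans ?_
      have b1 := fH_norm s.H (f j)
      have b2 := fH_norm s.H (f l)
      have b3 := min_le_left (ep n) η
      have b4 : 2 * (r:ℝ) * ep n * (‖fH s.H (f j)‖ + ‖fH s.H (f l)‖) ≤ 2 * r * ep n * (‖f j‖ + ‖f l‖) := by gcongr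
      linarith

lemma step_G (f r n) (hr : 0 < r) (s : St) (hI : StInv f n s) (hn : Odd n) : ∃ s', StInv f (n + 1) s' ∧ Stp f r n s s' := by
  have hq1 := s.q_ge
  have hqp : (0:ℝ) < s.q := by linarith
  have e0 := ep_pos n
  obtain ⟨η, hη, hH⟩ := Metric.uniformContinuous_iff.1 (CompactSpace.uniformContinuous_of_continuous s.H.h.continuous) (ep n) e0
  set ε := min (ep n) (min (η / 2) (1 / s.q)) with hε
  have hε0 : 0 < ε := lt_min e0 (lt_min (by positivity) (by positivity))
  have hε1 : ε ≤ ep n := min_le_left _ _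
  have hε2 : ε ≤ η / 2 := (min_le_right _ _).trans (min_le_left _ _)
  have hε3 : ε ≤ 1 / s.q := (min_le_right _ _).trans (min_le_right _ _)
  obtain ⟨h, hh, g1, g2, g3, g4⟩ := G_lemma r s.q hr s.hq (fun j => Phi (fH s.H (f j))) n ε hε0
  simp only [Phi_int, fH_int] at g2 g3
  have D1 : ∀ j < n, ∀ Z > 0, |cav s (f j) h Z - ∫ p, f j p| ≤ dev s (f j) + ep n := fun j hj Z hZ =>
    (g2 j hj Z hZ).trans (by unfold dev; gcongr)
  have D2 : ∀ j < n, |cav s (f j) h 1 - ∫ p, f j p| ≤ ep n := fun j hj => by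
    have := g3 j hj
    unfold cav; rw [inv_one, one_mul]; exact this.trans hε1
  have ev := cont_ev (s.H.comp h).h (s.H.comp h).h.continuous 1 (ep n) e0
  obtain ⟨k, ⟨h1, h2⟩, hk⟩ := ((ext_all f r n s hI h hh (fun t ht => (g1 t ht).trans hε1) D1).and ev).exists
  refine ⟨_, h1, h2, fun _ j hj => ?_, fun j hj => ?_, fun _ x y => ?_, fun he => absurd hn (Nat.not_odd_iff_even.2 he)⟩
  · have := dev_next f n s hI h hh k j hj _ (D2 j hj)
    linarith
  · have := dev_next f n s hI h hh k j hj _ (D1 j hj 1 one_pos)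
    linarith
  · set s' := s.next h hh k
    set z := s'.H.h.symm x with hz
    set w := s.H.h.symm y with hw
    obtain ⟨a, ha1, ha2⟩ := g4 z.2 w.1 w.2
    have hkp : (0:ℝ) < 2 * (k + 1) * s.q := by positivity
    -- choose the number of jumps
    set l := ⌊(2 * (k + 1) * s.q : ℝ) * rep (a - z.1)⌋₊ with hl
    have hl1 : (l : ℝ) ≤ (2 * (k + 1) * s.q : ℝ) * rep (a - z.1) := Nat.floor_le (mul_nonneg hkp.le (rep_nonneg _))
    have hl2 : (2 * (k + 1) * s.q : ℝ) * rep (a - z.1) < l + 1 := Nat.lt_floor_add_one _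
    have hl3 : (l:ℝ) < 2 * (k + 1) * s.q := hl1.trans_lt (by have := rep_lt (a - z.1); nlinarith)
    have hl4 : l < 2 * (k + 1) * s.q := by exact_mod_cast hl3
    refine ⟨s.q * l, ?_, ?_⟩
    · have : s.q * l ≤ s'.q := by
        show s.q * l ≤ 2 * (k + 1) * s.q ^ 2
        nlinarith
      unfold Ls; omega
    · have e1 : ((s.q * l : ℕ) * s'.al : ℝ) = ((l * s.p : ℕ) : ℤ) + l / (2 * (k + 1) * s.q) := by
        rw [s.next_al]; unfold St.al St.del; push_cast; field_simp
      have e2 : s'.H.rot ((s.q * l : ℕ) * s'.al) x = (s.H.comp h).h (z.1 + ((l / (2 * (k + 1) * s.q) : ℝ) : Crc), z.2) := by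
        rw [e1]
        simp only [EMap.rot, tv_add, tv_int, zero_add]
        rw [← hz]
        show (s.H.comp h).h _ = _
        congr 1
        ext <;> simp [tv]
      have e3 : dist (z.1 + ((l / (2 * (k + 1) * s.q) : ℝ) : Crc)) a ≤ 1 * (1 / ((k:ℝ) + 1)) := by
        have e4 : a = z.1 + ((rep (a - z.1) : ℝ) : Crc) := by rw [coe_rep]; abel
        conv_lhs => rw [e4]
        refine (crc_dist_add_coe _ _ _).trans ?_
        rw [one_mul, abs_sub_comm, abs_le]
        have e5 : (l:ℝ) / (2 * (k + 1) * s.q) ≤ rep (a - z.1) := by rw [div_le_iff₀ hkp]; linarith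
        have e6 : rep (a - z.1) ≤ (l + 1) / (2 * (k + 1) * s.q) := by rw [le_div_iff₀ hkp]; linarith
        have e7 : (1:ℝ) / (2 * (k + 1) * s.q) ≤ 1 / (k + 1) := by
          apply one_div_le_one_div_of_le (by positivity); nlinarith [(Nat.cast_nonneg k : (0:ℝ) ≤ k)]
        rw [add_div] at e6
        have e8 : (0:ℝ) < 1 / (k + 1) := by positivity
        constructor <;> linarith
      rw [e2]
      have f1 := hk _ _ z.2 e3
      have f2 : dist ((s.H.comp h).h (a, z.2)) (s.H.h (w.1, (h.h (a, z.2)).2)) ≤ ep n := by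
        refine hI.mod _ _ _ (ha2.trans ?_)
        calc 1 / (s.q:ℝ) + ε ≤ 1 / s.q + 1 / s.q := by gcongr
          _ ≤ 4 / s.q := by rw [← add_div]; gcongr; norm_num
      have f3 : dist (s.H.h (w.1, (h.h (a, z.2)).2)) y ≤ ep n := by
        have : y = s.H.h (w.1, w.2) := by simp [hw]
        rw [this]
        refine (hH ?_).le
        rw [Prod.dist_eq, dist_self]
        exact max_lt hη (by linarith)
      calc _ ≤ _ := dist_triangle4 _ _ _ _
        _ ≤ ep n + ep n + ep n := add_le_add (add_le_add f1 f2) f3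
        _ = _ := by ring

lemma base_inv (f) : StInv f 0 ⟨EMap.one, 0, 1, one_pos, rfl⟩ := by
  refine ⟨fun x x' y _ => ?_, fun j hj => absurd hj (by omega), fun j hj => absurd hj (by omega)⟩
  simp only [ep, pow_zero, EMap.one_h]
  rw [Prod.dist_eq, dist_self]
  refine max_le ?_ zero_le_one
  rw [dist_eq_norm]
  have := AddCircle.norm_le_half_period (p := 1) (x := x - x') one_ne_zero
  rw [abs_one] at this
  linarith

lemma exists_seq (f : ℕ → C(Torus2, ℝ)) (r : ℕ) (hr : 0 < r) : ∃ s : ℕ → St, ∀ n, Stp f r n (s n) (s (n + 1)) := by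
  have hst : ∀ n (s : {s : St // StInv f n s}), ∃ s' : {s : St // StInv f (n + 1) s}, Stp f r n s.1 s'.1 := fun n s => by
    rcases Nat.even_or_odd n with hn | hn
    · obtain ⟨s', h1, h2⟩ := step_M f r n hr s.1 s.2 hn
      exact ⟨⟨s', h1⟩, h2⟩
    · obtain ⟨s', h1, h2⟩ := step_G f r n hr s.1 s.2 hn
      exact ⟨⟨s', h1⟩, h2⟩
  choose g hg using hst
  let S : ∀ n, {s : St // StInv f n s} := fun n => Nat.rec ⟨_, base_inv f⟩ (fun n s => g n s) n
  exact ⟨fun n => (S n).1, fun n => hg n (S n)⟩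

/-! ### File AA: the limit diffeomorphism -/

lemma geo_lim {X : Type*} [MetricSpace X] [CompleteSpace X] (u : ℕ → X) (C : ℝ) (h : ∀ n, dist (u n) (u (n + 1)) ≤ C * (1 / 2) ^ n) :
    ∃ a, Tendsto u atTop (𝓝 a) :=
  cauchySeq_tendsto_of_complete (cauchySeq_of_le_geometric (1 / 2) C (by norm_num) h)

lemma geo_dist {X : Type*} [MetricSpace X] (u : ℕ → X) (n : ℕ) (h : ∀ m, n ≤ m → dist (u m) (u (m + 1)) ≤ ep m) (a : X)
    (ha : Tendsto u atTop (𝓝 a)) : dist (u n) a ≤ 2 * ep n := by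
  have h1 : ∀ k, dist (u (n + k)) (u (n + k + 1)) ≤ ep n * (1 / 2) ^ k := fun k => by
    have := h (n + k) (by omega)
    unfold ep at *; rwa [pow_add] at this
  have h2 : Tendsto (fun k => u (n + k)) atTop (𝓝 a) := by
    have := (tendsto_add_atTop_iff_nat n).2 ha
    simpa [add_comm] using this
  have := dist_le_of_le_geometric_of_tendsto (1 / 2) (ep n) (by norm_num) h1 h2 0
  simp only [add_zero, pow_zero] at this
  have e : ep n * 1 / (1 - 1 / 2) = 2 * ep n := by ring
  rwa [e] at this

lemma ep_lim : Tendsto ep atTop (𝓝 0) := tendsto_pow_atTop_nhds_zero_of_lt_one (by norm_num) (by norm_num)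

lemma ev_2ep (ε : ℝ) (hε : 0 < ε) : ∀ᶠ n in atTop, 2 * ep n < ε := by
  have := ep_lim.const_mul 2
  rw [mul_zero] at this
  exact this.eventually (gt_mem_nhds hε)

lemma lift_lim (e : ℕ → EMap) (a : ℕ → ℝ) (T : Torus2 → Torus2)
    (h1 : ∀ n : ℕ, ∀ z : ℂ × ℂ, ‖z‖ ≤ n → ‖(e (n + 1)).rotC (a (n + 1)) z - (e n).rotC (a n) z‖ ≤ ep n)
    (h2 : ∀ x, Tendsto (fun n => (e n).rot (a n) x) atTop (𝓝 (T x))) :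
    ∃ F : ℝ × ℝ → ℝ × ℝ, (∀ p, AnalyticAt ℝ F p) ∧ IntEquivariant F ∧ IsLift F T := by
  have hd : ∀ n : ℕ, ∀ z : ℂ × ℂ, ‖z‖ ≤ n → ∀ m : ℕ, n ≤ m → dist ((e m).rotC (a m) z) ((e (m + 1)).rotC (a (m + 1)) z) ≤ ep m := by
    intro n z hz m hm
    rw [dist_comm, dist_eq_norm]
    exact h1 m z (hz.trans (by exact_mod_cast hm))
  have hex : ∀ z : ℂ × ℂ, ∃ w, Tendsto (fun n => (e n).rotC (a n) z) atTop (𝓝 w) := by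
    intro z
    obtain ⟨n, hn⟩ := exists_nat_ge ‖z‖
    obtain ⟨w, hw⟩ := geo_lim (fun k => (e (k + n)).rotC (a (k + n)) z) 1 (fun k => by
      have := hd n z hn (k + n) (by omega)
      rw [show k + 1 + n = k + n + 1 by ring, one_mul]
      refine this.trans ?_
      unfold ep
      exact pow_le_pow_of_le_one (by norm_num) (by norm_num) (by omega))
    exact ⟨w, (tendsto_add_atTop_iff_nat n).1 hw⟩
  choose G hG using hex
  have hlu : TendstoLocallyUniformly (fun n => (e n).rotC (a n)) G atTop := by
    rw [Metric.tendstoLocallyUniformly_iff]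
    intro ε hε z
    obtain ⟨n, hn⟩ := exists_nat_ge (‖z‖ + 1)
    refine ⟨Metric.ball z 1, Metric.ball_mem_nhds z one_pos, ?_⟩
    filter_upwards [ev_2ep ε hε, eventually_ge_atTop n] with m hm hnm y hy
    have hy' : ‖y‖ ≤ m := by
      have h5 : ‖y - z‖ < 1 := by rwa [← dist_eq_norm]
      have h6 := norm_le_norm_add_norm_sub' y z
      have : (n:ℝ) ≤ m := by exact_mod_cast hnm
      linarith
    rw [dist_comm]
    exact (geo_dist (fun n => (e n).rotC (a n) y) m (hd m y hy') (G y) (hG y)).trans_lt hm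
  have hGa : ∀ p, AnalyticAt ℂ G p := analytic_limit _ G (fun n => (e n).rotC_diff (a n)) hlu
  let F : ℝ × ℝ → ℝ × ℝ := fun p => ((G (cplx p)).1.re, (G (cplx p)).2.re)
  have hFl : ∀ p, Tendsto (fun n => (e n).rl ((e n).rli p + (a n, 0))) atTop (𝓝 (F p)) := by
    intro p
    have h3 := hG (cplx p)
    have h4 : Continuous fun z : ℂ × ℂ => (z.1.re, z.2.re) := by fun_prop
    have h5 := (h4.tendsto _).comp h3
    refine h5.congr fun n => ?_
    simp only [Function.comp_apply, (e n).rotC_real]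
    simp [cplx]
  refine ⟨F, fun p => ?_, fun p m => ?_, fun p => ?_⟩
  · have a1 : AnalyticAt ℝ G (cplx p) := (hGa _).restrictScalars
    have a2 : AnalyticAt ℝ cplx p := by
      let L : ℝ × ℝ →L[ℝ] ℂ × ℂ := (Complex.ofRealCLM.comp (ContinuousLinearMap.fst ℝ ℝ ℝ)).prod (Complex.ofRealCLM.comp (ContinuousLinearMap.snd ℝ ℝ ℝ))
      exact L.analyticAt p
    let L2 : ℂ × ℂ →L[ℝ] ℝ × ℝ := (Complex.reCLM.comp (ContinuousLinearMap.fst ℝ ℂ ℂ)).prod (Complex.reCLM.comp (ContinuousLinearMap.snd ℝ ℂ ℂ))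
    exact (L2.analyticAt _).comp (a1.comp a2)
  · have h3 : G (cplx p + cvec m) = G (cplx p) + cvec m := by
      refine tendsto_nhds_unique (hG _) ?_
      simp_rw [EMap.rotC_per]
      exact (hG (cplx p)).add_const _
    have h4 : cplx (p + ((m.1 : ℝ), (m.2 : ℝ))) = cplx p + cvec m := by
      simp [cplx, cvec]
    simp only [F, h4, h3]
    ext <;> simp [cvec]
  · have hc : Continuous torusProj := by
      unfold torusProj
      have := continuous_crc_coe
      fun_prop
    refine tendsto_nhds_unique ((hc.tendsto _).comp (hFl p)) ?_
    refine (h2 (torusProj p)).congr fun n => ?_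
    simp only [Function.comp_apply, (e n).rot_lift]

lemma rot_lim (e : ℕ → EMap) (a : ℕ → ℝ) (h : ∀ n x, dist ((e (n + 1)).rot (a (n + 1)) x) ((e n).rot (a n) x) ≤ ep n) :
    ∃ T : Torus2 → Torus2, Continuous T ∧ TendstoUniformly (fun n => (e n).rot (a n)) T atTop := by
  have h' : ∀ x n, dist ((e n).rot (a n) x) ((e (n + 1)).rot (a (n + 1)) x) ≤ ep n := fun x n => by rw [dist_comm]; exact h n x
  have hex : ∀ x, ∃ y, Tendsto (fun n => (e n).rot (a n) x) atTop (𝓝 y) := fun x =>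
    geo_lim _ 1 (fun n => by rw [one_mul]; exact h' x n)
  choose T hT using hex
  have hu : TendstoUniformly (fun n => (e n).rot (a n)) T atTop := by
    rw [Metric.tendstoUniformly_iff]
    intro ε hε
    filter_upwards [ev_2ep ε hε] with n hn x
    rw [dist_comm]
    exact (geo_dist _ n (fun m _ => h' x m) _ (hT x)).trans_lt hn
  exact ⟨T, hu.continuous (Frequently.of_forall fun n => (e n).rot_continuous _), hu⟩

lemma tu_comp {F : ℕ → Torus2 → Torus2} {T : Torus2 → Torus2} (h : TendstoUniformly F T atTop) (hT : Continuous T) {u : ℕ → Torus2} {x}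
    (hu : Tendsto u atTop (𝓝 x)) : Tendsto (fun n => F n (u n)) atTop (𝓝 (T x)) :=
  h.tendsto_comp hT.continuousAt hu

lemma mp_of_int (ν : Measure Torus2) [IsFiniteMeasure ν] (T : Torus2 → Torus2) (hT : Continuous T)
    (h : ∀ F : C(Torus2, ℝ), ∫ x, F (T x) ∂ν = ∫ x, F x ∂ν) : MeasurePreserving T ν ν := by
  refine ⟨hT.measurable, ?_⟩
  have : IsFiniteMeasure (ν.map T) := Measure.isFiniteMeasure_map ν T
  refine ext_of_forall_integral_eq_of_IsFiniteMeasure fun F => ?_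
  rw [integral_map hT.measurable.aemeasurable F.continuous.aestronglyMeasurable]
  exact h F.toContinuousMap

lemma exists_diffeo (f r) (s : ℕ → St) (hs : ∀ n, Stp f r n (s n) (s (n + 1))) :
    ∃ D : AnalyticMPTorusDiffeo, Continuous D.toEquiv ∧ ∀ n, ∀ i ≤ Ls f n (s n), ∀ x, dist (D.toEquiv^[i] x) ((s n).H.rot (i * (s n).al) x) ≤ 2 * ep n := by
  have hL1 : ∀ n, 1 ≤ Ls f n (s n) := fun n => by have := (s n).hq; unfold Ls; omega
  have hLm : Monotone fun n => Ls f n (s n) := monotone_nat_of_le_succ fun n => (hs n).lm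
  obtain ⟨T, Tc, Tu⟩ := rot_lim (fun n => (s n).H) (fun n => (s n).al) (fun n x => by
    have := (hs n).c2 1 (hL1 n) x
    simpa using this)
  obtain ⟨S, Sc, Su⟩ := rot_lim (fun n => (s n).H) (fun n => -(s n).al) (fun n x => (hs n).c2' x)
  have hT : ∀ x, Tendsto (fun n => (s n).H.rot (s n).al x) atTop (𝓝 (T x)) := fun x => Tu.tendsto_at x
  have hS : ∀ x, Tendsto (fun n => (s n).H.rot (-(s n).al) x) atTop (𝓝 (S x)) := fun x => Su.tendsto_at x
  have hTS : ∀ x, T (S x) = x := fun x => by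
    refine tendsto_nhds_unique (tu_comp Tu Tc (hS x)) ?_
    simp_rw [EMap.rot_rot]; simp [EMap.rot_zero]
  have hST : ∀ x, S (T x) = x := fun x => by
    refine tendsto_nhds_unique (tu_comp Su Sc (hT x)) ?_
    simp_rw [EMap.rot_rot]; simp [EMap.rot_zero]
  obtain ⟨F, F1, F2, F3⟩ := lift_lim (fun n => (s n).H) (fun n => (s n).al) T (fun n z hz => ((hs n).c1 z hz).1) hT
  obtain ⟨F', F1', F2', F3'⟩ := lift_lim (fun n => (s n).H) (fun n => -(s n).al) S (fun n z hz => ((hs n).c1 z hz).2) hS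
  have hmp : MeasurePreserving T volume volume := by
    refine mp_of_int _ T Tc fun φ => ?_
    have h1 : Tendsto (fun n => ∫ x, φ ((s n).H.rot (s n).al x)) atTop (𝓝 (∫ x, φ (T x))) := by
      refine tendsto_integral_of_dominated_convergence (fun _ => ‖φ‖) ?_ (integrable_const _) ?_ ?_
      · intro n
        exact (φ.continuous.comp ((s n).H.rot_continuous _)).aestronglyMeasurable
      · exact fun n => Eventually.of_forall fun x => cm_bd φ _
      · exact Eventually.of_forall fun x => (φ.continuous.tendsto _).comp (hT x)
    refine tendsto_nhds_unique h1 ?_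
    simp_rw [fun n => mp_int ((s n).H.rot_mp (s n).al) φ.continuous.aestronglyMeasurable]
    exact tendsto_const_nhds
  refine ⟨⟨⟨T, S, hST, hTS⟩, F, F', F1, F1', F2, F2', F3, F3', hmp⟩, Tc, fun n i hi x => ?_⟩
  have hit : ∀ i : ℕ, Tendsto (fun m => (s m).H.rot (i * (s m).al) x) atTop (𝓝 (T^[i] x)) := by
    intro i
    induction i with
    | zero => simp [EMap.rot_zero]
    | succ i ih =>
      rw [Function.iterate_succ_apply']
      refine (tu_comp Tu Tc ih).congr fun m => ?_
      rw [EMap.rot_rot]; congr 1; push_cast; ring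
  have := geo_dist (fun m => (s m).H.rot (i * (s m).al) x) n (fun m hm => by
    rw [dist_comm]; exact (hs m).c2 i (hi.trans (hLm hm)) x) _ (hit i)
  rw [dist_comm]; exact this

/-! ### File AB: genericity and minimality -/

lemma ep_succ (n : ℕ) : ep n = 2 * ep (n + 1) := by unfold ep; rw [pow_succ]; ring

lemma ev_ep (C ε : ℝ) (hε : 0 < ε) : ∀ᶠ n in atTop, C * ep n < ε := by
  have := ep_lim.const_mul C
  rw [mul_zero] at this
  exact this.eventually (gt_mem_nhds hε)

lemma le_Ls (f) (n : ℕ) (s : St) : n ≤ Ls f n s := by unfold Ls; omega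

lemma dev_bd (f r) (s : ℕ → St) (hs : ∀ n, Stp f r n (s n) (s (n + 1))) (j n : ℕ) (h : j + 3 ≤ n) : dev (s n) (f j) ≤ 12 * ep n := by
  obtain ⟨k, rfl⟩ : ∃ k, n = k + 2 := ⟨n - 2, by omega⟩
  have e1 := ep_succ k
  have e2 := ep_succ (k + 1)
  have e3 := ep_pos (k + 2)
  rw [show k + 1 + 1 = k + 2 by ring] at e2
  rcases Nat.even_or_odd k with hk | hk
  · have := (hs (k + 1)).dv1 hk.add_one j (by omega)
    rw [show k + 1 + 1 = k + 2 by ring] at this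
    linarith
  · have h1 := (hs k).dv1 hk j (by omega)
    have h2 := (hs (k + 1)).dv2 j (by omega)
    rw [show k + 1 + 1 = k + 2 by ring] at h2
    linarith

lemma cm_unif (F : C(Torus2, ℝ)) (ε : ℝ) (hε : 0 < ε) : ∃ δ > 0, ∀ x y, dist x y < δ → |F x - F y| < ε := by
  have := CompactSpace.uniformContinuous_of_continuous F.continuous
  obtain ⟨δ, h0, h⟩ := Metric.uniformContinuous_iff.1 this ε hε
  exact ⟨δ, h0, fun x y hxy => by have := h hxy; rwa [Real.dist_eq] at this⟩

lemma avg_bd (N : ℕ) (a : ℕ → ℝ) (c : ℝ) (hc : 0 ≤ c) (h : ∀ i < N, |a i| ≤ c) : |(N : ℝ)⁻¹ * ∑ i ∈ Finset.range N, a i| ≤ c := by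
  rcases Nat.eq_zero_or_pos N with rfl | hN
  · simpa using hc
  have hN' : (0:ℝ) < N := by exact_mod_cast hN
  rw [abs_mul, abs_of_pos (inv_pos.2 hN'), inv_mul_le_iff₀ hN']
  refine (Finset.abs_sum_le_sum_abs _ _).trans ?_
  refine (Finset.sum_le_sum fun i hi => h i (Finset.mem_range.1 hi)).trans ?_
  simp

lemma generic_lim (f : ℕ → C(Torus2, ℝ)) (hf : DenseRange f) (r) (s : ℕ → St) (hs : ∀ n, Stp f r n (s n) (s (n + 1))) (T : Torus2 → Torus2)
    (hd : ∀ n, ∀ i ≤ Ls f n (s n), ∀ x, dist (T^[i] x) ((s n).H.rot (i * (s n).al) x) ≤ 2 * ep n) : IsGenericPt T volume 0 := by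
  have key : ∀ j, ∀ ε > 0, ∀ᶠ N : ℕ in atTop, |(N : ℝ)⁻¹ * (∑ i ∈ Finset.range N, f j (T^[i] 0)) - ∫ y, f j y| < ε := by
    intro j ε hε
    obtain ⟨δ, hδ, hu⟩ := cm_unif (f j) (ε / 2) (by linarith)
    obtain ⟨n0, hn0⟩ := eventually_atTop.1 ((ev_ep 2 δ hδ).and ((ev_ep 17 (ε / 2) (by linarith)).and (eventually_ge_atTop (j + 3))))
    filter_upwards [eventually_ge_atTop (Ls f n0 (s n0))] with N hN
    have hex : ∃ k, N < Ls f (n0 + k + 1) (s (n0 + k + 1)) := ⟨N, by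
      have := le_Ls f (n0 + N + 1) (s (n0 + N + 1)); omega⟩
    obtain ⟨n, hn, h1, h2⟩ : ∃ n, n0 ≤ n ∧ Ls f n (s n) ≤ N ∧ N < Ls f (n + 1) (s (n + 1)) := by
      classical
      refine ⟨n0 + Nat.find hex, by omega, ?_, Nat.find_spec hex⟩
      rcases Nat.eq_zero_or_pos (Nat.find hex) with h | h
      · rw [h]; exact hN
      · have := Nat.find_min hex (m := Nat.find hex - 1) (by omega)
        rw [show n0 + (Nat.find hex - 1) + 1 = n0 + Nat.find hex by omega] at this
        omega
    obtain ⟨-, b2, b3⟩ := hn0 n hn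
    obtain ⟨b1, -, -⟩ := hn0 (n + 1) (by omega)
    have g1 := (hs n).gen j (by omega) N h1
    have g2 := dev_bd f r s hs j n b3
    have g3 : |(N : ℝ)⁻¹ * ∑ i ∈ Finset.range N, (f j (T^[i] 0) - f j ((s (n + 1)).H.rot (i * (s (n + 1)).al) 0))| ≤ ε / 2 := by
      refine avg_bd N _ _ (by linarith) fun i hi => (hu _ _ ?_).le
      exact (hd (n + 1) i (by omega) 0).trans_lt b1
    rw [Finset.sum_sub_distrib, mul_sub] at g3
    rw [abs_lt]; rw [abs_le] at g1 g3
    constructor <;> linarith [g1.1, g1.2, g3.1, g3.2]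
  intro F
  rw [Metric.tendsto_atTop']
  intro ε hε
  obtain ⟨j, hj⟩ := hf.exists_dist_lt F (show 0 < ε / 4 by linarith)
  rw [dist_eq_norm] at hj
  obtain ⟨N0, hN0⟩ := eventually_atTop.1 (key j (ε / 4) (by linarith))
  refine ⟨N0, fun N hN => ?_⟩
  have h1 := hN0 N hN.le
  have h2 : |(N : ℝ)⁻¹ * ∑ i ∈ Finset.range N, (F (T^[i] 0) - f j (T^[i] 0))| ≤ ε / 4 :=
    avg_bd N _ _ (by linarith) fun i hi => (cm_bd (F - f j) _).trans hj.le
  have h3 : |∫ y : Torus2, (F y - f j y)| ≤ ε / 4 := by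
    exact int_abs_le volume (fun y => F y - f j y) _ (Eventually.of_forall fun y => (cm_bd (F - f j) y).trans hj.le)
  rw [integral_sub (cm_integrable F) (cm_integrable (f j))] at h3
  rw [Finset.sum_sub_distrib, mul_sub] at h2
  rw [Real.dist_eq, abs_lt]; rw [abs_le] at h2 h3; rw [abs_lt] at h1
  constructor <;> linarith [h1.1, h1.2, h2.1, h2.2, h3.1, h3.2]

lemma minimal_lim (f : ℕ → C(Torus2, ℝ)) (r) (s : ℕ → St) (hs : ∀ n, Stp f r n (s n) (s (n + 1))) (T : Torus2 → Torus2)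
    (hd : ∀ n, ∀ i ≤ Ls f n (s n), ∀ x, dist (T^[i] x) ((s n).H.rot (i * (s n).al) x) ≤ 2 * ep n) : IsMinimalMap T := by
  intro x
  rw [Metric.dense_iff]
  intro y ε hε
  obtain ⟨n0, hn0⟩ := eventually_atTop.1 (ev_ep 4 ε hε)
  have b := hn0 (2 * n0 + 1) (by omega)
  obtain ⟨i, hi, h1⟩ := (hs (2 * n0 + 1)).mnl ⟨n0, rfl⟩ x y
  have h2 := hd _ i hi x
  have e := ep_succ (2 * n0 + 1)
  refine ⟨T^[i] x, ?_, ⟨i, rfl⟩⟩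
  rw [Metric.mem_ball]
  refine (dist_triangle _ _ _).trans_lt ((add_le_add h2 h1).trans_lt ?_)
  linarith

/-! ### File AC: the invariant measures -/

/-- density at stage `s` -/
def dens (r t : ℕ) (s : St) (x : Torus2) : ℝ := r * chi r t (s.H.h.symm x)

lemma dens_meas (r t s) : Measurable (dens r t s) :=
  measurable_const.mul ((chi_measurable r t).comp s.H.h.symm.continuous.measurable)

lemma dens_nonneg (r t s x) : 0 ≤ dens r t s x := mul_nonneg (Nat.cast_nonneg _) (chi_nonneg _ _ _)

lemma dens_int (r t s) : Integrable (dens r t s) :=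
  Integrable.of_bound (dens_meas r t s).aestronglyMeasurable (r * 1) (Eventually.of_forall fun x => by
    rw [Real.norm_eq_abs, abs_of_nonneg (dens_nonneg _ _ _ _)]
    exact mul_le_mul_of_nonneg_left (chi_le_one _ _ _) (Nat.cast_nonneg _))

lemma dens_mul (r t) (s : St) (φ : Torus2 → ℝ) (hφ : Measurable φ) : ∫ x, φ x * dens r t s x = r * ∫ p, chi r t p * φ (s.H.h p) := by
  rw [← mp_int s.H.mp (f := fun x => φ x * dens r t s x) (hφ.mul (dens_meas r t s)).aestronglyMeasurable, ← integral_const_mul]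
  congr 1; ext p
  simp only [dens, Homeomorph.symm_apply_apply]
  ring

lemma chi_int (r t : ℕ) (h : t < r) : ∫ p, chi r t p = (r : ℝ)⁻¹ := by
  rw [tor_int_prod]
  · have : ∀ x y : Crc, chi r t (x, y) = cind r t y := fun x y => rfl
    simp_rw [this, cell_meas r (by omega) t h]
    simp
  · have := chi_mul_int r t (fun _ => 1) measurable_const 1 (by simp)
    simpa using this

lemma dens_tot (r t : ℕ) (h : t < r) (s) : ∫ x, dens r t s x = 1 := by
  have := dens_mul r t s (fun _ => 1) measurable_const
  simp only [one_mul, mul_one] at this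
  rw [this, chi_int r t h]
  have : (r:ℝ) ≠ 0 := by exact_mod_cast (by omega : r ≠ 0)
  field_simp

lemma dens_step (f r n) (s s' : St) (hs : Stp f r n s s') (t : ℕ) (ht : t < r) :
    ∫ x, |dens r t s' x - dens r t s x| ≤ r * ep n := by
  obtain ⟨h, hh, hc⟩ := hs.hs
  have h1 := mp_int s'.H.mp (f := fun x => |dens r t s' x - dens r t s x|)
    (((dens_meas r t s').sub (dens_meas r t s)).abs).aestronglyMeasurable
  rw [← h1]
  have h2 : ∀ p, |dens r t s' (s'.H.h p) - dens r t s (s'.H.h p)| = r * |chi r t (h.h p) - chi r t p| := by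
    intro p
    simp only [dens, Homeomorph.symm_apply_apply]
    have : s.H.h.symm (s'.H.h p) = h.h p := by rw [hh]; simp
    rw [this, ← mul_sub, abs_mul, abs_of_nonneg (Nat.cast_nonneg (α := ℝ) r), abs_sub_comm]
  simp_rw [h2]
  rw [integral_const_mul]
  exact mul_le_mul_of_nonneg_left (hc t ht) (Nat.cast_nonneg _)

lemma dens_rot (r t) (s : St) (a : ℝ) (x) : dens r t s (s.H.rot a x) = dens r t s x := by
  simp [dens, EMap.rot, chi, tv]

lemma l1_lim (d : ℕ → Torus2 → ℝ) (hi : ∀ n, Integrable (d n)) (h0 : ∀ n x, 0 ≤ d n x) (C : ℝ)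
    (hc : ∀ n, ∫ x, |d (n + 1) x - d n x| ≤ C * (1 / 2) ^ n) :
    ∃ ρ : Torus2 → ℝ, Measurable ρ ∧ (∀ x, 0 ≤ ρ x) ∧ Integrable ρ ∧ Tendsto (fun n => ∫ x, |d n x - ρ x|) atTop (𝓝 0) := by
  obtain ⟨g, hg⟩ := geo_lim (fun n => (hi n).toL1 (d n)) C (fun n => by
    rw [dist_comm, dist_eq_norm, ← Integrable.toL1_sub, L1.norm_eq_integral_norm]
    refine le_trans (le_of_eq ?_) (hc n)
    refine integral_congr_ae ?_
    filter_upwards [((hi (n + 1)).sub (hi n)).coeFn_toL1] with x hx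
    rw [hx]; rfl)
  have gi : Integrable g := L1.integrable_coeFn g
  refine ⟨fun x => |g x|, (Lp.stronglyMeasurable g).measurable.abs, fun x => abs_nonneg _, gi.abs, ?_⟩
  rw [tendsto_iff_dist_tendsto_zero] at hg
  refine squeeze_zero (fun n => integral_nonneg fun x => abs_nonneg _) (fun n => ?_) hg
  rw [dist_eq_norm, L1.norm_eq_integral_norm]
  refine integral_mono_ae ((hi n).sub gi.abs).abs (L1.integrable_coeFn _).norm ?_
  filter_upwards [(hi n).coeFn_toL1, Lp.coeFn_sub ((hi n).toL1 (d n)) g] with x hx1 hx2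
  rw [hx2, Pi.sub_apply, hx1]
  have := abs_abs_sub_abs_le_abs_sub (d n x) (g x)
  rwa [abs_of_nonneg (h0 n x)] at this

lemma bmul_int {φ ρ : Torus2 → ℝ} (hφ : Measurable φ) (C : ℝ) (hC : ∀ x, |φ x| ≤ C) (hρ : Integrable ρ) : Integrable (fun x => φ x * ρ x) :=
  hρ.bdd_mul hφ.aestronglyMeasurable (Eventually.of_forall hC)

lemma l1_test {φ d ρ : Torus2 → ℝ} (hφ : Measurable φ) (C : ℝ) (hC : ∀ x, |φ x| ≤ C) (hd : Integrable d) (hρ : Integrable ρ) :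
    |(∫ x, φ x * d x) - ∫ x, φ x * ρ x| ≤ C * ∫ x, |d x - ρ x| := by
  rw [← integral_sub (bmul_int hφ C hC hd) (bmul_int hφ C hC hρ), ← integral_const_mul, ← Real.norm_eq_abs]
  refine norm_integral_le_of_norm_le ((hd.sub hρ).abs.const_mul C) (Eventually.of_forall fun x => ?_)
  rw [← mul_sub, norm_mul]
  exact mul_le_mul_of_nonneg_right (hC x) (abs_nonneg _)

lemma l1_test_lim {d : ℕ → Torus2 → ℝ} {ρ : Torus2 → ℝ} (hd : ∀ n, Integrable (d n)) (hρ : Integrable ρ)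
    (hl : Tendsto (fun n => ∫ x, |d n x - ρ x|) atTop (𝓝 0)) (φ : ℕ → Torus2 → ℝ) (hφ : ∀ n, Measurable (φ n)) (C : ℝ) (hC : ∀ n x, |φ n x| ≤ C) :
    Tendsto (fun n => (∫ x, φ n x * d n x) - ∫ x, φ n x * ρ x) atTop (𝓝 0) := by
  have := hl.const_mul C
  rw [mul_zero] at this
  exact squeeze_zero_norm (fun n => l1_test (hφ n) C (hC n) (hd n) hρ) this

/-- measure with density -/
def nu (ρ : Torus2 → ℝ) : Measure Torus2 := volume.withDensity fun x => ENNReal.ofReal (ρ x)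

lemma nu_int {ρ : Torus2 → ℝ} (hm : Measurable ρ) (h0 : ∀ x, 0 ≤ ρ x) (φ : Torus2 → ℝ) : ∫ x, φ x ∂(nu ρ) = ∫ x, φ x * ρ x := by
  unfold nu
  rw [integral_withDensity_eq_integral_toReal_smul hm.ennreal_ofReal (Eventually.of_forall fun x => ENNReal.ofReal_lt_top)]
  congr 1; ext x
  rw [ENNReal.toReal_ofReal (h0 x), smul_eq_mul, mul_comm]

lemma nu_prob {ρ : Torus2 → ℝ} (h0 : ∀ x, 0 ≤ ρ x) (hi : Integrable ρ) (h1 : ∫ x, ρ x = 1) : IsProbabilityMeasure (nu ρ) := by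
  constructor
  unfold nu
  rw [withDensity_apply _ MeasurableSet.univ, Measure.restrict_univ, ← ofReal_integral_eq_lintegral_ofReal hi (Eventually.of_forall h0), h1]
  simp

/-- limit density package -/
structure LimD (r : ℕ) (s : ℕ → St) (t : ℕ) (ρ : Torus2 → ℝ) : Prop where
  m : Measurable ρ
  nn : ∀ x, 0 ≤ ρ x
  i : Integrable ρ
  l : Tendsto (fun n => ∫ x, |dens r t (s n) x - ρ x|) atTop (𝓝 0)
  one : ∫ x, ρ x = 1

lemma exists_limD (f r) (s : ℕ → St) (hs : ∀ n, Stp f r n (s n) (s (n + 1))) (t : ℕ) (ht : t < r) : ∃ ρ, LimD r s t ρ := by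
  obtain ⟨ρ, h1, h2, h3, h4⟩ := l1_lim (fun n => dens r t (s n)) (fun n => dens_int _ _ _) (fun n x => dens_nonneg _ _ _ _) r
    (fun n => dens_step f r n _ _ (hs n) t ht)
  refine ⟨ρ, h1, h2, h3, h4, ?_⟩
  have := l1_test_lim (fun n => dens_int r t (s n)) h3 h4 (fun _ _ => 1) (fun _ => measurable_const) 1 (by simp)
  simp only [one_mul, dens_tot r t ht] at this
  have h := tendsto_nhds_unique this tendsto_const_nhds
  linarith

lemma limD_inv {r : ℕ} {s : ℕ → St} {t : ℕ} {ρ} (h : LimD r s t ρ) (T : Torus2 → Torus2) (hT : Continuous T)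
    (hd : ∀ x, Tendsto (fun n => (s n).H.rot (s n).al x) atTop (𝓝 (T x))) : MeasurePreserving T (nu ρ) (nu ρ) := by
  have := nu_prob h.nn h.i h.one
  refine mp_of_int _ T hT fun F => ?_
  rw [nu_int h.m h.nn, nu_int h.m h.nn]
  have a1 : Tendsto (fun n => ∫ x, F ((s n).H.rot (s n).al x) * ρ x) atTop (𝓝 (∫ x, F (T x) * ρ x)) := by
    refine tendsto_integral_of_dominated_convergence (fun x => ‖F‖ * ρ x) ?_ (h.i.const_mul _) ?_ ?_
    · intro n
      exact ((F.continuous.comp ((s n).H.rot_continuous _)).measurable.mul h.m).aestronglyMeasurable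
    · refine fun n => Eventually.of_forall fun x => ?_
      rw [norm_mul, Real.norm_of_nonneg (h.nn x)]
      exact mul_le_mul_of_nonneg_right (cm_bd F _) (h.nn x)
    · exact Eventually.of_forall fun x => ((F.continuous.tendsto _).comp (hd x)).mul_const _
  have a2 := l1_test_lim (fun n => dens_int r t (s n)) h.i h.l (fun n x => F ((s n).H.rot (s n).al x))
    (fun n => (F.continuous.comp ((s n).H.rot_continuous _)).measurable) ‖F‖ (fun n x => cm_bd F _)
  have a3 := l1_test_lim (fun n => dens_int r t (s n)) h.i h.l (fun n x => F x)
    (fun n => F.continuous.measurable) ‖F‖ (fun n x => cm_bd F _)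
  have e : ∀ n, ∫ x, F ((s n).H.rot (s n).al x) * dens r t (s n) x = ∫ x, F x * dens r t (s n) x := by
    intro n
    rw [← mp_int ((s n).H.rot_mp (s n).al) (f := fun x => F x * dens r t (s n) x) (F.continuous.measurable.mul (dens_meas r t (s n))).aestronglyMeasurable]
    simp only [dens_rot]
  simp_rw [e] at a2
  have a4 := (a1.add a2).sub a3
  have a5 := tendsto_nhds_unique a4 (tendsto_const_nhds (x := ∫ x, F x * ρ x)|>.congr fun n => by ring)
  linarith

lemma limD_ne {r : ℕ} {s : ℕ → St} {t u : ℕ} {ρ σ} (ht : t < r) (htu : t ≠ u) (h : LimD r s t ρ) (h' : LimD r s u σ) : nu ρ ≠ nu σ := by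
  intro he
  let φ : ℕ → Torus2 → ℝ := fun n x => chi r t ((s n).H.h.symm x)
  have hφ : ∀ n, Measurable (φ n) := fun n => (chi_measurable r t).comp (s n).H.h.symm.continuous.measurable
  have a1 := l1_test_lim (fun n => dens_int r t (s n)) h.i h.l φ hφ 1 (fun n x => chi_abs _ _ _)
  have a2 := l1_test_lim (fun n => dens_int r u (s n)) h'.i h'.l φ hφ 1 (fun n x => chi_abs _ _ _)
  have e1 : ∀ n, ∫ x, φ n x * dens r t (s n) x = 1 := by
    intro n
    refine Eq.trans ?_ (dens_tot r t ht (s n))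
    congr 1; ext x
    simp only [φ, dens, chi]
    split_ifs <;> simp
  have e2 : ∀ n, ∫ x, φ n x * dens r u (s n) x = 0 := by
    intro n
    rw [← integral_zero Torus2 ℝ]
    congr 1; ext x
    simp only [φ, dens, chi]
    split_ifs <;> simp
    omega
  have e3 : ∀ n, ∫ x, φ n x * ρ x = ∫ x, φ n x * σ x := fun n => by
    rw [← nu_int h.m h.nn, ← nu_int h'.m h'.nn, he]
  simp_rw [e1, e3] at a1
  simp_rw [e2] at a2
  have := tendsto_nhds_unique (a1.sub a2) (tendsto_const_nhds (x := (1:ℝ)) |>.congr fun n => by ring)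
  norm_num at this

/-! ### File AD: weak mixing -/

lemma dens_small (r t : ℕ) (ht : t < r) (s : St) (ψ : Torus2 → ℝ) (hψ : Measurable ψ) (C : ℝ) (hC : ∀ x, |ψ x| ≤ C) :
    |∫ x, ψ x * dens r t s x| ≤ C := by
  have := l1_test (ρ := fun _ => 0) hψ C hC (dens_int r t s) (integrable_zero Torus2 ℝ volume)
  simp only [mul_zero, integral_zero, sub_zero] at this
  have e : ∀ x, |dens r t s x| = dens r t s x := fun x => abs_of_nonneg (dens_nonneg r t s x)
  simp only [e] at this
  rwa [dens_tot r t ht s, mul_one] at this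

lemma two_mul_lim (c : ℕ) : Tendsto (fun a : ℕ => 2 * a + c) atTop atTop :=
  tendsto_atTop_mono (fun a => by simp only [id]; omega) tendsto_id

lemma mix_lim (f : ℕ → C(Torus2, ℝ)) (r) (s : ℕ → St) (T : Torus2 → Torus2) (hT : Continuous T)
    (hd : ∀ n, ∀ i ≤ Ls f n (s n), ∀ x, dist (T^[i] x) ((s n).H.rot (i * (s n).al) x) ≤ 2 * ep n)
    (M : ℕ → ℕ) (hM : ∀ a, M a ≤ Ls f (2 * a + 1) (s (2 * a + 1))) (t : ℕ) (ht : t < r) (ρ) (h : LimD r s t ρ) (j k : ℕ)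
    (hmix : ∀ a, j < 2 * a → k < 2 * a → |r * (∫ p, chi r t p * (f j ((s (2 * a + 1)).H.rot (M a * (s (2 * a + 1)).al) ((s (2 * a + 1)).H.h p)) * f k ((s (2 * a + 1)).H.h p)))
      - (r * ∫ p, chi r t p * f j ((s (2 * a)).H.h p)) * (r * ∫ p, chi r t p * f k ((s (2 * a)).H.h p))| ≤ 2 * r * ep (2 * a) * (‖f j‖ + ‖f k‖) + ep (2 * a)) :
    Tendsto (fun a => ∫ x, f j (T^[M a] x) * f k x ∂(nu ρ)) atTop (𝓝 ((∫ x, f j x ∂(nu ρ)) * ∫ x, f k x ∂(nu ρ))) := by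
  have hTi : ∀ i, Continuous (T^[i]) := fun i => hT.iterate i
  have hmX : ∀ a, Measurable fun x => f j (T^[M a] x) * f k x := fun a =>
    (((f j).continuous.comp (hTi _)).mul (f k).continuous).measurable
  have hmR : ∀ a, Measurable fun x => f j ((s (2 * a + 1)).H.rot (M a * (s (2 * a + 1)).al) x) * f k x := fun a =>
    (((f j).continuous.comp (EMap.rot_continuous _ _)).mul (f k).continuous).measurable
  have hbX : ∀ a x, |f j (T^[M a] x) * f k x| ≤ ‖f j‖ * ‖f k‖ := fun a x => abs_mul_le' (cm_bd _ _) (cm_bd _ _)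
  have hbR : ∀ a x, |f j ((s (2 * a + 1)).H.rot (M a * (s (2 * a + 1)).al) x) * f k x| ≤ ‖f j‖ * ‖f k‖ := fun a x => abs_mul_le' (cm_bd _ _) (cm_bd _ _)
  have a1 := l1_test_lim (fun a => dens_int r t (s (2 * a + 1))) h.i (h.l.comp (two_mul_lim 1)) _ hmX _ hbX
  have a2 : Tendsto (fun a => (∫ x, f j (T^[M a] x) * f k x * dens r t (s (2 * a + 1)) x)
      - ∫ x, f j ((s (2 * a + 1)).H.rot (M a * (s (2 * a + 1)).al) x) * f k x * dens r t (s (2 * a + 1)) x) atTop (𝓝 0) := by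
    rw [Metric.tendsto_atTop']
    intro ε hε
    have hk : 0 < ‖f k‖ + 1 := by positivity
    obtain ⟨δ, hδ, hu⟩ := cm_unif (f j) (ε / (‖f k‖ + 1)) (by positivity)
    obtain ⟨n0, hn0⟩ := eventually_atTop.1 (ev_ep 2 δ hδ)
    refine ⟨n0, fun a ha => ?_⟩
    have b := hn0 (2 * a + 1) (by omega)
    rw [Real.dist_eq, sub_zero, ← integral_sub (bmul_int (hmX a) _ (hbX a) (dens_int _ _ _)) (bmul_int (hmR a) _ (hbR a) (dens_int _ _ _))]
    simp_rw [← sub_mul]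
    refine (dens_small r t ht _ _ ?_ (ε / (‖f k‖ + 1) * ‖f k‖) fun x => ?_).trans_lt ?_
    · exact (((f j).continuous.comp (hTi _)).measurable.sub ((f j).continuous.comp (EMap.rot_continuous _ _)).measurable).mul (f k).continuous.measurable
    · exact abs_mul_le' (hu _ _ ((hd _ _ (hM a) x).trans_lt b)).le (cm_bd _ _)
    · rw [div_mul_eq_mul_div, div_lt_iff₀ hk]; nlinarith
  have a3 : Tendsto (fun a => (∫ x, f j ((s (2 * a + 1)).H.rot (M a * (s (2 * a + 1)).al) x) * f k x * dens r t (s (2 * a + 1)) x)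
      - (∫ x, f j x * dens r t (s (2 * a)) x) * (∫ x, f k x * dens r t (s (2 * a)) x)) atTop (𝓝 0) := by
    have e1 : Tendsto (fun a => 2 * r * ep (2 * a) * (‖f j‖ + ‖f k‖) + ep (2 * a)) atTop (𝓝 0) := by
      have e2 := ep_lim.comp (two_mul_lim 0)
      have := ((e2.const_mul (2 * (r:ℝ))).mul_const (‖f j‖ + ‖f k‖)).add e2
      simpa using this
    refine squeeze_zero_norm' ?_ e1
    filter_upwards [eventually_gt_atTop (j + k)] with a ha
    rw [dens_mul r t _ _ (hmR a), dens_mul r t _ _ (f j).continuous.measurable, dens_mul r t _ _ (f k).continuous.measurable]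
    exact hmix a (by omega) (by omega)
  have a4 := l1_test_lim (fun a => dens_int r t (s (2 * a))) h.i (h.l.comp (two_mul_lim 0)) (fun _ => f j) (fun _ => (f j).continuous.measurable) _ (fun _ => cm_bd _)
  have a5 := l1_test_lim (fun a => dens_int r t (s (2 * a))) h.i (h.l.comp (two_mul_lim 0)) (fun _ => f k) (fun _ => (f k).continuous.measurable) _ (fun _ => cm_bd _)
  have a6 := a4.add_const (∫ x, f j x * ρ x)
  have a7 := a5.add_const (∫ x, f k x * ρ x)
  simp only [sub_add_cancel, zero_add] at a6 a7
  have a8 := ((a2.add a3).sub a1).add (a6.mul a7)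
  simp_rw [nu_int h.m h.nn]
  simp only [add_zero, sub_zero, zero_add] at a8
  refine a8.congr fun a => ?_
  ring

lemma approx_set (ν : Measure Torus2) [IsProbabilityMeasure ν] (f : ℕ → C(Torus2, ℝ)) (hf : DenseRange f) (A : Set Torus2) (hA : MeasurableSet A)
    (ε : ℝ) (hε : 0 < ε) : ∃ j, ∫ x, |A.indicator (fun _ => (1:ℝ)) x - f j x| ∂ν ≤ ε := by
  have hi : Integrable (A.indicator (fun _ => (1:ℝ))) ν := (integrable_const _).indicator hA
  obtain ⟨g, hg, hgi⟩ := hi.exists_boundedContinuous_integral_sub_le (show 0 < ε / 2 by linarith)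
  obtain ⟨j, hj⟩ := hf.exists_dist_lt g.toContinuousMap (show 0 < ε / 2 by linarith)
  rw [dist_eq_norm] at hj
  refine ⟨j, ?_⟩
  have fi : Integrable (f j) ν := Integrable.of_bound (f j).continuous.aestronglyMeasurable ‖f j‖ (Eventually.of_forall fun p => cm_bd _ p)
  have h1 : ∀ x, |A.indicator (fun _ => (1:ℝ)) x - f j x| ≤ ‖A.indicator (fun _ => (1:ℝ)) x - g x‖ + ε / 2 := by
    intro x
    have h2 := (cm_bd (g.toContinuousMap - f j) x).trans hj.le
    have h3 : |g x - f j x| ≤ ε / 2 := h2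
    rw [Real.norm_eq_abs]
    exact (abs_sub_le _ (g x) _).trans (by linarith)
  refine (integral_mono (hi.sub fi).abs ((hi.sub hgi).norm.add (integrable_const _)) h1).trans ?_
  simp only [Pi.add_apply]
  rw [integral_add (hi.sub hgi).norm (integrable_const _)]
  simp only [integral_const, probReal_univ, smul_eq_mul, one_mul]
  simp only [Pi.sub_apply]
  linarith

lemma wm_of_dense (ν : Measure Torus2) [IsProbabilityMeasure ν] (T : Torus2 → Torus2) (hT : Continuous T) (hmp : MeasurePreserving T ν ν)
    (f : ℕ → C(Torus2, ℝ)) (hf : DenseRange f) (m : ℕ → ℕ) (hm : StrictMono m)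
    (h : ∀ j k, Tendsto (fun n => ∫ x, f j (T^[m n] x) * f k x ∂ν) atTop (𝓝 ((∫ x, f j x ∂ν) * ∫ x, f k x ∂ν))) : IsWeakMixingWrt T ν := by
  refine ⟨m, hm, fun A B hA hB => ?_⟩
  rw [Metric.tendsto_atTop']
  intro ε hε
  set e1 := ε / 5 with he1
  have he1p : 0 < e1 := by positivity
  obtain ⟨j, hj⟩ := approx_set ν f hf A hA e1 he1p
  have hC : 0 < ‖f j‖ + 1 := by positivity
  obtain ⟨k, hk⟩ := approx_set ν f hf B hB (e1 / (‖f j‖ + 1)) (by positivity)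
  set e2 := e1 / (‖f j‖ + 1) with he2
  have he3 : ‖f j‖ * e2 ≤ e1 := by
    rw [he2, mul_div_assoc', div_le_iff₀ hC]; nlinarith
  obtain ⟨N, hN⟩ := Metric.tendsto_atTop'.1 (h j k) e1 he1p
  refine ⟨N, fun n hn => ?_⟩
  have h1 := hN n hn
  rw [Real.dist_eq] at h1 ⊢
  rw [sub_zero, abs_abs]
  set IA : Torus2 → ℝ := A.indicator (fun _ => (1:ℝ)) with hIA
  set IB : Torus2 → ℝ := B.indicator (fun _ => (1:ℝ)) with hIB
  have mA : Measurable IA := measurable_const.indicator hA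
  have mB : Measurable IB := measurable_const.indicator hB
  have bA : ∀ x, |IA x| ≤ 1 := fun x => by simp only [hIA, Set.indicator]; split_ifs <;> simp
  have bB : ∀ x, |IB x| ≤ 1 := fun x => by simp only [hIB, Set.indicator]; split_ifs <;> simp
  have bi : ∀ (φ : Torus2 → ℝ) (C : ℝ), Measurable φ → (∀ x, |φ x| ≤ C) → Integrable φ ν := fun φ C h1 h2 =>
    Integrable.of_bound h1.aestronglyMeasurable C (Eventually.of_forall h2)
  have iA := bi IA 1 mA bA
  have iB := bi IB 1 mB bB
  have mj := (f j).continuous.measurable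
  have mk := (f k).continuous.measurable
  have ij := bi (f j) _ mj (cm_bd _)
  have ik := bi (f k) _ mk (cm_bd _)
  have mT : Measurable (T^[m n]) := (hT.iterate (m n)).measurable
  have vA : (ν A).toReal = ∫ x, IA x ∂ν := by
    rw [hIA, integral_indicator_const _ hA]; simp [Measure.real]
  have vB : (ν B).toReal = ∫ x, IB x ∂ν := by
    rw [hIB, integral_indicator_const _ hB]; simp [Measure.real]
  have vAB : (ν (B ∩ (T^[m n]) ⁻¹' A)).toReal = ∫ x, IA (T^[m n] x) * IB x ∂ν := by
    have : (fun x => IA (T^[m n] x) * IB x) = (B ∩ (T^[m n]) ⁻¹' A).indicator (fun _ => (1:ℝ)) := by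
      ext x
      simp only [hIA, hIB, Set.indicator, Set.mem_inter_iff, Set.mem_preimage]
      split_ifs <;> simp_all
    rw [this, integral_indicator_const _ (hB.inter (mT hA))]; simp [Measure.real]
  have d1 : |(∫ x, IA (T^[m n] x) * IB x ∂ν) - ∫ x, f j (T^[m n] x) * f k x ∂ν| ≤ e1 + ‖f j‖ * e2 := by
    have i1 := bi (fun x => IA (T^[m n] x) * IB x) _ ((mA.comp mT).mul mB) (fun x => abs_mul_le' (bA _) (bB _))
    have i2 := bi (fun x => f j (T^[m n] x) * f k x) _ ((mj.comp mT).mul mk) (fun x => abs_mul_le' (cm_bd _ _) (cm_bd _ _))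
    have i3 : Integrable (fun x => |IA (T^[m n] x) - f j (T^[m n] x)|) ν :=
      (bi (fun x => IA (T^[m n] x)) _ (mA.comp mT) (fun x => bA _)).sub (bi (fun x => f j (T^[m n] x)) _ (mj.comp mT) (fun x => cm_bd _ _)) |>.abs
    have i4 : Integrable (fun x => ‖f j‖ * |IB x - f k x|) ν := (iB.sub ik).abs.const_mul _
    rw [← integral_sub i1 i2, ← Real.norm_eq_abs]
    refine (norm_integral_le_of_norm_le (i3.add i4) (Eventually.of_forall fun x => ?_)).trans ?_
    · have : IA (T^[m n] x) * IB x - f j (T^[m n] x) * f k x = (IA (T^[m n] x) - f j (T^[m n] x)) * IB x + f j (T^[m n] x) * (IB x - f k x) := by ring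
      rw [Real.norm_eq_abs, this]
      refine (abs_add_le _ _).trans ?_
      simp only [Pi.add_apply, abs_mul]
      refine add_le_add ?_ ?_
      · exact mul_le_of_le_one_right (abs_nonneg _) (bB _)
      · exact mul_le_mul_of_nonneg_right (cm_bd _ _) (abs_nonneg _)
    · have i5 : ∫ x, |IA (T^[m n] x) - f j (T^[m n] x)| ∂ν = ∫ x, |IA x - f j x| ∂ν :=
        mp_int (hmp.iterate (m n)) (f := fun x => |IA x - f j x|) (mA.sub mj).abs.aestronglyMeasurable
      simp only [Pi.add_apply]
      rw [integral_add i3 i4, i5, integral_const_mul]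
      exact add_le_add hj (mul_le_mul_of_nonneg_left hk (norm_nonneg _))
  have d2 : |(∫ x, IA x ∂ν) - ∫ x, f j x ∂ν| ≤ e1 := by
    rw [← integral_sub iA ij]
    exact (abs_integral_le_integral_abs).trans hj
  have d3 : |(∫ x, IB x ∂ν) - ∫ x, f k x ∂ν| ≤ e2 := by
    rw [← integral_sub iB ik]
    exact (abs_integral_le_integral_abs).trans hk
  have d4 : |∫ x, f j x ∂ν| ≤ ‖f j‖ := int_abs_le ν _ _ (Eventually.of_forall fun x => cm_bd _ x)
  have d5 : |∫ x, IB x ∂ν| ≤ 1 := int_abs_le ν _ _ (Eventually.of_forall bB)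
  rw [vA, vB, vAB]
  have d6 : |(∫ x, IA x ∂ν) * (∫ x, IB x ∂ν) - (∫ x, f j x ∂ν) * ∫ x, f k x ∂ν| ≤ e1 + ‖f j‖ * e2 := by
    have : (∫ x, IA x ∂ν) * (∫ x, IB x ∂ν) - (∫ x, f j x ∂ν) * ∫ x, f k x ∂ν
      = ((∫ x, IA x ∂ν) - ∫ x, f j x ∂ν) * (∫ x, IB x ∂ν) + (∫ x, f j x ∂ν) * ((∫ x, IB x ∂ν) - ∫ x, f k x ∂ν) := by ring
    rw [this]
    refine (abs_add_le _ _).trans (add_le_add ?_ ?_)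
    · have := abs_mul_le' d2 d5
      rwa [mul_one] at this
    · exact abs_mul_le' d4 d3
  rw [abs_lt] at h1 ⊢
  rw [abs_le] at d1 d6
  constructor <;> linarith [h1.1, h1.2, d1.1, d1.2, d6.1, d6.2]

theorem analytic_anosov_katok_generic_weak_mixing (r : ℕ) (hr : 1 ≤ r) :
    ∃ T : AnalyticMPTorusDiffeo,
      -- (1) minimality
      IsMinimalMap T.toEquiv ∧
      -- (2) Lebesgue measure is a generic measure for `T`
      (∃ x : Torus2, IsGenericPt T.toEquiv volume x) ∧
      -- (3) `r` distinct absolutely continuous invariant weak mixing measures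
      (∃ μs : Fin r → Measure Torus2,
        (∀ t, IsProbabilityMeasure (μs t)) ∧
        Function.Injective μs ∧
        (∀ t, μs t ≪ (volume : Measure Torus2)) ∧
        (∀ t, MeasurePreserving T.toEquiv (μs t) (μs t)) ∧
        (∀ t, IsWeakMixingWrt T.toEquiv (μs t))) := by
  obtain ⟨f, hf⟩ := TopologicalSpace.exists_dense_seq C(Torus2, ℝ)
  obtain ⟨s, hs⟩ := exists_seq f r hr
  obtain ⟨D, Dc, hd⟩ := exists_diffeo f r s hs
  have hL : ∀ x, Tendsto (fun n => (s n).H.rot (s n).al x) atTop (𝓝 (D.toEquiv x)) := by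
    intro x
    rw [tendsto_iff_dist_tendsto_zero]
    have e := ep_lim.const_mul 2
    rw [mul_zero] at e
    refine squeeze_zero (fun n => dist_nonneg) (fun n => ?_) e
    have := hd n 1 (by have := (s n).hq; unfold Ls; omega) x
    rw [dist_comm]
    simpa using this
  have hρ : ∀ t : Fin r, ∃ ρ, LimD r s t ρ := fun t => exists_limD f r s hs t t.2
  choose ρ hρ using hρ
  have hmx : ∀ a : ℕ, ∃ m, 2 * a ≤ m ∧ m ≤ Ls f (2 * a + 1) (s (2 * a + 1)) ∧ ∀ t < r, ∀ j < 2 * a, ∀ k < 2 * a,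
      |r * (∫ p, chi r t p * (f j ((s (2 * a + 1)).H.rot (m * (s (2 * a + 1)).al) ((s (2 * a + 1)).H.h p)) * f k ((s (2 * a + 1)).H.h p)))
      - (r * ∫ p, chi r t p * f j ((s (2 * a)).H.h p)) * (r * ∫ p, chi r t p * f k ((s (2 * a)).H.h p))| ≤ 2 * r * ep (2 * a) * (‖f j‖ + ‖f k‖) + ep (2 * a) :=
    fun a => (hs (2 * a)).mix (even_two_mul a)
  choose M hM1 hM2 hM3 using hmx
  have hMl : Tendsto M atTop atTop := tendsto_atTop_mono (fun a => by have := hM1 a; simp only [id]; omega) tendsto_id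
  obtain ⟨φ, hφ, hφM⟩ := strictMono_subseq_of_tendsto_atTop hMl
  refine ⟨D, minimal_lim f r s hs _ hd, ⟨0, generic_lim f hf r s hs _ hd⟩, fun t => nu (ρ t), ?_, ?_, ?_, ?_, ?_⟩
  · exact fun t => nu_prob (hρ t).nn (hρ t).i (hρ t).one
  · intro t u htu
    by_contra hne
    exact limD_ne t.2 (fun h => hne (Fin.ext h)) (hρ t) (hρ u) htu
  · exact fun t => withDensity_absolutelyContinuous _ _
  · exact fun t => limD_inv (hρ t) _ Dc hL
  · intro t
    have := nu_prob (hρ t).nn (hρ t).i (hρ t).one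
    refine wm_of_dense (nu (ρ t)) _ Dc (limD_inv (hρ t) _ Dc hL) f hf (M ∘ φ) hφM fun j k => ?_
    exact (mix_lim f r s _ Dc hd M hM2 t t.2 (ρ t) (hρ t) j k (fun a hj hk => hM3 a t t.2 j hj k hk)).comp hφ.tendsto_atTop
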